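/- Assume Hypotheses 1–3. For every a > 0 there exist a constant c > 0 (depending on a) and ε₀ ∈ (0,1/4) such that for every ε ∈ (0,ε₀) there is a constant c_ε > 0 (depending on a and ε) with the following property: for every non-negative function ψ : 𝕏 → ℝ, every y ∈ ℝ and every integer n ≥ 3ε^{−3}, sup_{x∈𝕏, z≥0} n·| 𝔼_x( ψ(X_n) ; y+S_n ∈ [z,z+a] , τ_y > n ) − (2a·ν(ψ)·V(x,y)/(√(2π)σ²·n))·φ₊( z/(σ√n) ) | ≤ c·(1 + max(y,0))·‖ψ‖_∞·( √ε + c_ε·(1 + max(y,0))/n^{ε} ). -/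

import Mathlib

open Finset Filter Real Topology MeasureTheory

namespace CLLT

variable {X : Type*}

/-- Product of the transition weights along a path. -/
noncomputable def wt (P : X → X → ℝ) : X → List X → ℝ
  | _, [] => 1
  | x, y :: ys => P x y * wt P y ys

/-- Extension of a finite path `X₁, …, Xₙ` to a trajectory `ℕ → X` with `X₀ = x`
(values beyond time `n` are irrelevant and set to `x`). -/
def pathExt (x : X) {n : ℕ} (path : Fin n → X) : ℕ → X := fun k =>
  if h : 1 ≤ k ∧ k ≤ n then path ⟨k - 1, by omega⟩ else x

/-- Expectation `𝔼_x (F (X₀, X₁, …))` of a functional of the first `n` steps of the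
Markov chain with transition kernel `P` started at `X₀ = x`. -/
noncomputable def Ex [Fintype X] (P : X → X → ℝ) (x : X) (n : ℕ)
    (F : (ℕ → X) → ℝ) : ℝ :=
  ∑ path : Fin n → X, wt P x (List.ofFn path) * F (pathExt x path)

open Classical in
/-- Real-valued indicator of a proposition. -/
noncomputable def ind (p : Prop) : ℝ := if p then 1 else 0

/-- Partial sum `S_k = f(X₁) + ⋯ + f(X_k)` along a trajectory. -/
noncomputable def Spath (f : X → ℝ) (ω : ℕ → X) (k : ℕ) : ℝ :=
  ∑ i ∈ Finset.Icc 1 k, f (ω i)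

/-- The event `τ_y > n`, i.e. `y + S_k > 0` for all `k = 1, …, n`. -/
def survives (f : X → ℝ) (y : ℝ) (n : ℕ) (ω : ℕ → X) : Prop :=
  ∀ k ∈ Finset.Icc 1 n, 0 < y + Spath f ω k

/-- `n`-step transition kernel. -/
noncomputable def kpow [Fintype X] [DecidableEq X] (P : X → X → ℝ) : ℕ → X → X → ℝ
  | 0 => fun x x' => if x = x' then 1 else 0
  | n + 1 => fun x x' => ∑ y, P x y * kpow P n y x'

/-- Transition operator acting on functions. -/
noncomputable def Pop [Fintype X] (P : X → X → ℝ) (g : X → ℝ) (x : X) : ℝ :=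
  ∑ x', P x x' * g x'

/-- Asymptotic variance `σ² = ν(f²) + 2 ∑_{n ≥ 1} ν(f ⬝ Pⁿ f)`. -/
noncomputable def sigma2 [Fintype X] (P : X → X → ℝ) (ν f : X → ℝ) : ℝ :=
  (∑ x, f x ^ 2 * ν x) + 2 * ∑' n : ℕ, ∑ x, f x * ((Pop P)^[n + 1] f) x * ν x

/-- Hypothesis 1 (primitivity). -/
def Primitive [Fintype X] [DecidableEq X] (P : X → X → ℝ) : Prop :=
  ∃ k₀ : ℕ, 1 ≤ k₀ ∧ ∀ x x', 0 < kpow P k₀ x x'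

/-- Hypothesis 3 (non-lattice condition). -/
def NonLattice [Fintype X] (P : X → X → ℝ) (f : X → ℝ) : Prop :=
  ∀ θ a : ℝ, ∃ (n : ℕ) (g : Fin (n + 1) → X),
    (0 < ∏ i : Fin (n + 1), P (g i) (g (i + 1))) ∧
    ∀ m : ℤ, (∑ i, f (g i)) - (n + 1 : ℝ) * θ ≠ a * (m : ℝ)

/-- `P` is a stochastic matrix and `ν` is a positive invariant probability for it. -/
structure IsStochastic [Fintype X] (P : X → X → ℝ) (ν : X → ℝ) : Prop where
  nonneg : ∀ x x', 0 ≤ P x x'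
  rowSum : ∀ x, ∑ x', P x x' = 1
  nuPos : ∀ x, 0 < ν x
  nuSum : ∑ x, ν x = 1
  nuInv : ∀ x', ∑ x, ν x * P x x' = ν x'

/-- Dual kernel `P*(x, x') = ν(x') P(x', x) / ν(x)`. -/
noncomputable def dualK (P : X → X → ℝ) (ν : X → ℝ) (x x' : X) : ℝ :=
  ν x' * P x' x / ν x

/-- Sup norm of a function on a finite set. -/
noncomputable def supN [Fintype X] [Nonempty X] (ψ : X → ℝ) : ℝ := ⨆ x, |ψ x|

/-- Rayleigh density `φ₊(t) = t e^{-t²/2} 𝟙_{t ≥ 0}`. -/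
noncomputable def rayleigh (t : ℝ) : ℝ := if 0 ≤ t then t * Real.exp (-t ^ 2 / 2) else 0

/-- Centred normal density with standard deviation `s`. -/
noncomputable def gauss (s u : ℝ) : ℝ :=
  Real.exp (-u ^ 2 / (2 * s ^ 2)) / (s * Real.sqrt (2 * π))

/-- Perturbed transition operator `P_t`, as a complex matrix. -/
noncomputable def Pmat [Fintype X] (P : X → X → ℝ) (f : X → ℝ) (t : ℝ) : Matrix X X ℂ :=
  Matrix.of fun x x' => (P x x' : ℂ) * Complex.exp (Complex.I * (t : ℂ) * (f x' : ℂ))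

/-- A complex matrix viewed as a continuous linear operator on `X → ℂ`
(equipped with the sup norm). -/
noncomputable def toCLM [Fintype X] (M : Matrix X X ℂ) : (X → ℂ) →L[ℂ] (X → ℂ) :=
  LinearMap.toContinuousLinearMap M.mulVecLin

/-- Fourier transform `ĥ(t) = ∫ e^{-i t u} h(u) du`. -/
noncomputable def FT (h : ℝ → ℝ) (t : ℝ) : ℂ :=
  ∫ u : ℝ, Complex.exp (-(Complex.I * (t : ℂ) * (u : ℂ))) * (h u : ℂ)

/-- Convolution `(g ∗ k)(u) = ∫ g(v) k(u - v) dv`. -/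
noncomputable def convR (g k : ℝ → ℝ) (u : ℝ) : ℝ := ∫ v : ℝ, g v * k (u - v)

/-- Stone's kernel `κ`. -/
noncomputable def kapp (u : ℝ) : ℝ :=
  if u = 0 then 1 / (2 * π) else (Real.sin (u / 2) / (u / 2)) ^ 2 / (2 * π)

/-- Scaled kernel `κ_δ(u) = κ(u/δ)/δ`. -/
noncomputable def kappD (δ u : ℝ) : ℝ := kapp (u / δ) / δ

/-- Upper regularisation `h̄_ε(u) = sup_{v ∈ [u-ε, u+ε]} h(v)`. -/
noncomputable def upReg (h : ℝ → ℝ) (ε u : ℝ) : ℝ := sSup (h '' Set.Icc (u - ε) (u + ε))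

/-- Lower regularisation `ẖ_ε(u) = inf_{v ∈ [u-ε, u+ε]} h(v)`. -/
noncomputable def loReg (h : ℝ → ℝ) (ε u : ℝ) : ℝ := sInf (h '' Set.Icc (u - ε) (u + ε))

/-- The class `𝓗_ε`: non-negative, locally bounded, with `h`, `h̄_ε`, `ẖ_ε`
measurable and Lebesgue integrable. -/
def MemH (ε : ℝ) (h : ℝ → ℝ) : Prop :=
  (∀ u, 0 ≤ h u) ∧ (∀ K : Set ℝ, IsCompact K → BddAbove (h '' K)) ∧
  Measurable h ∧ Measurable (upReg h ε) ∧ Measurable (loReg h ε) ∧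
  Integrable h ∧ Integrable (upReg h ε) ∧ Integrable (loReg h ε)

/-- Masked transition operator of the additive walk. -/
noncomputable def Tm [Fintype X] (P w : X → X → ℝ) (m : ℝ → ℝ) : Module.End ℝ (X → ℝ → ℝ) where
  toFun g x y := ∑ x', P x x' * (m (y + w x x') * g x' (y + w x x'))
  map_add' g h := by
    funext x y
    simp [mul_add, Finset.sum_add_distrib]
  map_smul' c g := by
    funext x y
    simp only [Pi.smul_apply, smul_eq_mul, RingHom.id_apply, Finset.mul_sum]
    refine Finset.sum_congr rfl fun _ _ => by ring

lemma Tm_apply [Fintype X] (P w : X → X → ℝ) (m : ℝ → ℝ) (g : X → ℝ → ℝ) (x : X) (y : ℝ) :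
    Tm P w m g x y = ∑ x', P x x' * (m (y + w x x') * g x' (y + w x x')) := rfl

/-- mask `y > 0` -/
noncomputable def mpos (y : ℝ) : ℝ := if 0 < y then 1 else 0
/-- mask `y ≤ 0` -/
noncomputable def mneg (y : ℝ) : ℝ := if 0 < y then 0 else 1
/-- mask `0 < y < L` -/
noncomputable def mstrip (L y : ℝ) : ℝ := if 0 < y ∧ y < L then 1 else 0
/-- mask `0 < y`, `L ≤ y` -/
noncomputable def mtop (L y : ℝ) : ℝ := if 0 < y ∧ L ≤ y then 1 else 0
/-- trivial mask -/
noncomputable def mone (_ : ℝ) : ℝ := 1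

lemma mpos_nonneg (y : ℝ) : 0 ≤ mpos y := by unfold mpos; split_ifs <;> norm_num
lemma mneg_nonneg (y : ℝ) : 0 ≤ mneg y := by unfold mneg; split_ifs <;> norm_num
lemma mstrip_nonneg (L y : ℝ) : 0 ≤ mstrip L y := by unfold mstrip; split_ifs <;> norm_num
lemma mtop_nonneg (L y : ℝ) : 0 ≤ mtop L y := by unfold mtop; split_ifs <;> norm_num
lemma mpos_le_one (y : ℝ) : mpos y ≤ 1 := by unfold mpos; split_ifs <;> norm_num
lemma mstrip_le_one (L y : ℝ) : mstrip L y ≤ 1 := by unfold mstrip; split_ifs <;> norm_num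
lemma mtop_le_one (L y : ℝ) : mtop L y ≤ 1 := by unfold mtop; split_ifs <;> norm_num
lemma mneg_le_one (y : ℝ) : mneg y ≤ 1 := by unfold mneg; split_ifs <;> norm_num
lemma mone_nonneg (y : ℝ) : 0 ≤ mone y := by unfold mone; norm_num

lemma mpos_ne (y : ℝ) (h : mpos y ≠ 0) : 0 < y := by
  unfold mpos at h; by_contra h'; simp [h'] at h
lemma mneg_ne (y : ℝ) (h : mneg y ≠ 0) : y ≤ 0 := by
  unfold mneg at h; by_contra h'; simp [not_le.mp h'] at h
lemma mstrip_ne (L y : ℝ) (h : mstrip L y ≠ 0) : 0 < y ∧ y < L := by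
  unfold mstrip at h; by_contra h'; simp [h'] at h
lemma mtop_ne (L y : ℝ) (h : mtop L y ≠ 0) : 0 < y ∧ L ≤ y := by
  unfold mtop at h; by_contra h'; simp [h'] at h

section
variable [Fintype X] {P w : X → X → ℝ}

lemma Tm_add_mask (m₁ m₂ m : ℝ → ℝ) (h : ∀ y, m y = m₁ y + m₂ y) :
    Tm P w m = Tm P w m₁ + Tm P w m₂ := by
  ext g x y
  simp only [Tm_apply, LinearMap.add_apply, Pi.add_apply, h, ← Finset.sum_add_distrib]
  refine Finset.sum_congr rfl fun _ _ => by ring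

lemma Tm_pos_eq (L : ℝ) : Tm P w mpos = Tm P w (mstrip L) + Tm P w (mtop L) := by
  apply Tm_add_mask
  intro y
  unfold mpos mstrip mtop
  by_cases h : 0 < y <;> by_cases h' : L ≤ y <;> simp [h, h', not_lt.mpr, not_le.mp]

lemma Tm_one_eq : Tm P w mone = Tm P w mpos + Tm P w mneg := by
  apply Tm_add_mask
  intro y
  unfold mpos mneg mone
  by_cases h : 0 < y <;> simp [h]

lemma Tm_one_eq3 (L : ℝ) :
    Tm P w mone = Tm P w (mstrip L) + (Tm P w (mtop L) + Tm P w mneg) := by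
  rw [Tm_one_eq, Tm_pos_eq L, add_assoc]

lemma pow_decomp {R : Type*} [Ring R] (A B : R) (n m : ℕ) :
    (A + B) ^ (m + n) = A ^ m * (A + B) ^ n +
      ∑ k ∈ Finset.range m, A ^ k * B * (A + B) ^ (m + n - 1 - k) := by
  induction m with
  | zero => simp
  | succ m ih =>
    rw [Finset.sum_range_succ, show m + 1 + n - 1 - m = n by omega]
    have h1 : (A + B) ^ (m + 1 + n) =
        (A ^ m * (A + B) ^ n + ∑ k ∈ Finset.range m, A ^ k * B * (A + B) ^ (m + n - 1 - k))
          * (A + B) := by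
      rw [← ih, ← pow_succ]; congr 1; omega
    rw [h1, add_mul, Finset.sum_mul]
    have h2 : ∑ k ∈ Finset.range m, A ^ k * B * (A + B) ^ (m + n - 1 - k) * (A + B) =
        ∑ k ∈ Finset.range m, A ^ k * B * (A + B) ^ (m + 1 + n - 1 - k) := by
      refine Finset.sum_congr rfl fun k hk => ?_
      have := Finset.mem_range.mp hk
      rw [mul_assoc, ← pow_succ]; congr 2; omega
    rw [h2, mul_assoc, ← pow_succ, pow_succ', pow_succ]
    noncomm_ring

lemma Tm_le_on (hP : ∀ x x', 0 ≤ P x x') {m : ℝ → ℝ} (hm : ∀ y, 0 ≤ m y)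
    {g h : X → ℝ → ℝ} (x : X) (y : ℝ)
    (H : ∀ x', m (y + w x x') ≠ 0 → g x' (y + w x x') ≤ h x' (y + w x x')) :
    Tm P w m g x y ≤ Tm P w m h x y := by
  rw [Tm_apply, Tm_apply]
  refine Finset.sum_le_sum fun x' _ => mul_le_mul_of_nonneg_left ?_ (hP _ _)
  by_cases h0 : m (y + w x x') = 0
  · simp [h0]
  · exact mul_le_mul_of_nonneg_left (H x' h0) (hm _)

lemma Tm_mono (hP : ∀ x x', 0 ≤ P x x') {m : ℝ → ℝ} (hm : ∀ y, 0 ≤ m y)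
    {g h : X → ℝ → ℝ} (H : ∀ x y, g x y ≤ h x y) (x : X) (y : ℝ) :
    Tm P w m g x y ≤ Tm P w m h x y :=
  Tm_le_on hP hm x y fun _ _ => H _ _

lemma Tm_pow_mono_on (hP : ∀ x x', 0 ≤ P x x') {m : ℝ → ℝ} (hm : ∀ y, 0 ≤ m y) (A : Set ℝ)
    (hA : ∀ y, m y ≠ 0 → y ∈ A) {g h : X → ℝ → ℝ} (H : ∀ x, ∀ y ∈ A, g x y ≤ h x y) (n : ℕ) :
    ∀ x, ∀ y ∈ A, (Tm P w m ^ n) g x y ≤ (Tm P w m ^ n) h x y := by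
  induction n with
  | zero => simpa using H
  | succ n ih =>
    intro x y _
    rw [pow_succ', Module.End.mul_apply, Module.End.mul_apply]
    exact Tm_le_on hP hm x y fun x' h0 => ih _ _ (hA _ h0)

lemma Tm_pow_mono (hP : ∀ x x', 0 ≤ P x x') {m : ℝ → ℝ} (hm : ∀ y, 0 ≤ m y)
    {g h : X → ℝ → ℝ} (H : ∀ x y, g x y ≤ h x y) (n : ℕ) (x : X) (y : ℝ) :
    (Tm P w m ^ n) g x y ≤ (Tm P w m ^ n) h x y :=
  Tm_pow_mono_on hP hm Set.univ (fun _ _ => trivial) (fun x y _ => H x y) n x y trivial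

lemma Tm_pow_nonneg (hP : ∀ x x', 0 ≤ P x x') {m : ℝ → ℝ} (hm : ∀ y, 0 ≤ m y)
    {g : X → ℝ → ℝ} (H : ∀ x y, 0 ≤ g x y) (n : ℕ) (x : X) (y : ℝ) :
    0 ≤ (Tm P w m ^ n) g x y := by
  have := Tm_pow_mono (w := w) hP hm (g := 0) (h := g) (by simpa using H) n x y
  simpa using this

lemma Tm_nonneg (hP : ∀ x x', 0 ≤ P x x') {m : ℝ → ℝ} (hm : ∀ y, 0 ≤ m y)
    {g : X → ℝ → ℝ} (H : ∀ x y, 0 ≤ g x y) (x : X) (y : ℝ) :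
    0 ≤ Tm P w m g x y := by
  simpa using Tm_pow_nonneg (w := w) hP hm H 1 x y

/-- Constant function one. -/
def one1 : X → ℝ → ℝ := fun _ _ => 1

lemma Tm_one_le (hP : ∀ x x', 0 ≤ P x x') (hP1 : ∀ x, ∑ x', P x x' = 1) {m : ℝ → ℝ}
    (hm1 : ∀ y, m y ≤ 1) (x : X) (y : ℝ) : Tm P w m one1 x y ≤ 1 := by
  rw [Tm_apply, ← hP1 x]
  refine Finset.sum_le_sum fun x' _ => ?_
  have := mul_le_mul_of_nonneg_left (hm1 (y + w x x')) (hP x x')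
  simpa [one1] using this

lemma Tm_pow_one_succ_le (hP : ∀ x x', 0 ≤ P x x') (hP1 : ∀ x, ∑ x', P x x' = 1) {m : ℝ → ℝ}
    (hm : ∀ y, 0 ≤ m y) (hm1 : ∀ y, m y ≤ 1) (n : ℕ) (x : X) (y : ℝ) :
    (Tm P w m ^ (n + 1)) one1 x y ≤ (Tm P w m ^ n) one1 x y := by
  rw [pow_succ, Module.End.mul_apply]
  exact Tm_pow_mono hP hm (fun x y => Tm_one_le hP hP1 hm1 x y) n x y

lemma Tm_pow_one_antitone (hP : ∀ x x', 0 ≤ P x x') (hP1 : ∀ x, ∑ x', P x x' = 1) {m : ℝ → ℝ}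
    (hm : ∀ y, 0 ≤ m y) (hm1 : ∀ y, m y ≤ 1) (x : X) (y : ℝ) :
    Antitone fun n => (Tm P w m ^ n) one1 x y :=
  antitone_nat_of_succ_le fun n => Tm_pow_one_succ_le hP hP1 hm hm1 n x y

lemma Tm_pow_one_le (hP : ∀ x x', 0 ≤ P x x') (hP1 : ∀ x, ∑ x', P x x' = 1) {m : ℝ → ℝ}
    (hm : ∀ y, 0 ≤ m y) (hm1 : ∀ y, m y ≤ 1) (n : ℕ) (x : X) (y : ℝ) :
    (Tm P w m ^ n) one1 x y ≤ 1 := by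
  have := Tm_pow_one_antitone (w := w) hP hP1 hm hm1 x y (Nat.zero_le n)
  simpa [one1] using this

lemma Tm_pow_mask_mono (hP : ∀ x x', 0 ≤ P x x') {m m' : ℝ → ℝ} (hm : ∀ y, 0 ≤ m y)
    (hmm : ∀ y, m y ≤ m' y) {g : X → ℝ → ℝ} (H : ∀ x y, 0 ≤ g x y) (n : ℕ) (x : X) (y : ℝ) :
    (Tm P w m ^ n) g x y ≤ (Tm P w m' ^ n) g x y := by
  have hm' : ∀ y, 0 ≤ m' y := fun y => (hm y).trans (hmm y)
  induction n generalizing x y with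
  | zero => simp
  | succ n ih =>
    rw [pow_succ', pow_succ', Module.End.mul_apply, Module.End.mul_apply]
    refine (Tm_mono hP hm ih x y).trans ?_
    rw [Tm_apply, Tm_apply]
    refine Finset.sum_le_sum fun x' _ => mul_le_mul_of_nonneg_left ?_ (hP _ _)
    exact mul_le_mul_of_nonneg_right (hmm _) (Tm_pow_nonneg hP hm' H _ _ _)

lemma Tm_pow_smul_le (hP : ∀ x x', 0 ≤ P x x') {m : ℝ → ℝ} (hm : ∀ y, 0 ≤ m y) (A : Set ℝ)
    (hA : ∀ y, m y ≠ 0 → y ∈ A) {g h : X → ℝ → ℝ} (c : ℝ)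
    (H : ∀ x, ∀ y ∈ A, g x y ≤ c * h x y) (n : ℕ) :
    ∀ x, ∀ y ∈ A, (Tm P w m ^ n) g x y ≤ c * (Tm P w m ^ n) h x y := by
  intro x y hy
  have := Tm_pow_mono_on (w := w) hP hm A hA (g := g) (h := c • h) (by simpa using H) n x y hy
  simpa using this

lemma Tm_pow_abs_le (hP : ∀ x x', 0 ≤ P x x') {m : ℝ → ℝ} (hm : ∀ y, 0 ≤ m y) (A : Set ℝ)
    (hA : ∀ y, m y ≠ 0 → y ∈ A) {g h : X → ℝ → ℝ} (c : ℝ)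
    (H : ∀ x, ∀ y ∈ A, |g x y| ≤ c * h x y) (n : ℕ) :
    ∀ x, ∀ y ∈ A, |(Tm P w m ^ n) g x y| ≤ c * (Tm P w m ^ n) h x y := by
  intro x y hy
  rw [abs_le]
  constructor
  · have := Tm_pow_smul_le (w := w) hP hm A hA (g := -g) (h := h) c
      (fun x y hy => (neg_le_abs _).trans (H x y hy)) n x y hy
    simp only [map_neg, Pi.neg_apply] at this
    linarith
  · exact Tm_pow_smul_le (w := w) hP hm A hA c (fun x y hy => (le_abs_self _).trans (H x y hy))
      n x y hy

/-- Dynkin type inequality. -/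
lemma dynkin (hP : ∀ x x', 0 ≤ P x x') {m m' : ℝ → ℝ} (hm : ∀ y, 0 ≤ m y) (A : Set ℝ)
    (hA : ∀ y, m y ≠ 0 → y ∈ A) (hmm : ∀ y, mone y = m y + m' y)
    {G r : X → ℝ → ℝ} (H : ∀ x, ∀ y ∈ A, Tm P w mone G x y + r x y ≤ G x y) (n : ℕ) :
    ∀ x, ∀ y ∈ A, (Tm P w m ^ n) G x y +
      ∑ k ∈ Finset.range n, (Tm P w m ^ k) (r + Tm P w m' G) x y ≤ G x y := by
  induction n with
  | zero => intro x y _; simp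
  | succ n ih =>
    intro x y hy
    have h1 := ih x y hy
    rw [Finset.sum_range_succ]
    have h2 : (Tm P w m ^ (n + 1)) G x y + (Tm P w m ^ n) (r + Tm P w m' G) x y ≤
        (Tm P w m ^ n) G x y := by
      rw [pow_succ, Module.End.mul_apply, ← Pi.add_apply, ← Pi.add_apply, ← map_add]
      refine Tm_pow_mono_on hP hm A hA ?_ n x y hy
      intro x y hy
      have := H x y hy
      rw [Tm_add_mask _ _ _ hmm] at this
      simp only [LinearMap.add_apply, Pi.add_apply] at this ⊢
      linarith
    linarith

end

/-- Abstract martingale data for an additive Markov walk. -/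
structure Mart [Fintype X] (P w : X → X → ℝ) (α β : X → ℝ) (s2 B : ℝ) : Prop where
  nonneg : ∀ x x', 0 ≤ P x x'
  rowSum : ∀ x, ∑ x', P x x' = 1
  hw : ∀ x x', |w x x'| ≤ B
  hα : ∀ x, |α x| ≤ B
  hβ : ∀ x, |β x| ≤ B
  hB : 1 ≤ B
  hs : 0 < s2
  e1 : ∀ x, ∑ x', P x x' * (w x x' + α x') = α x
  e2 : ∀ x, ∑ x', P x x' * (w x x' ^ 2 + 2 * w x x' * α x' + β x') = β x + s2

section
variable [Fintype X] {P w : X → X → ℝ} {α β : X → ℝ} {s2 B : ℝ}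

lemma Mart.Tlin (M : Mart P w α β s2 B) (c d : ℝ) (x : X) (y : ℝ) :
    Tm P w mone (fun x y => d * (y + α x) + c) x y = d * (y + α x) + c := by
  rw [Tm_apply]
  have : ∀ x', P x x' * (mone (y + w x x') * (d * (y + w x x' + α x') + c)) =
      P x x' * (d * y + c) + d * (P x x' * (w x x' + α x')) := fun x' => by
    unfold mone; ring
  simp only [this, Finset.sum_add_distrib, ← Finset.sum_mul, ← Finset.mul_sum, M.rowSum, M.e1]
  ring

lemma Mart.Tquad (M : Mart P w α β s2 B) (x : X) (y : ℝ) :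
    Tm P w mone (fun x y => y ^ 2 + 2 * y * α x + β x) x y =
      y ^ 2 + 2 * y * α x + β x + s2 := by
  rw [Tm_apply]
  have : ∀ x', P x x' * (mone (y + w x x') * ((y + w x x') ^ 2 + 2 * (y + w x x') * α x' + β x')) =
      P x x' * y ^ 2 + 2 * y * (P x x' * (w x x' + α x')) +
        P x x' * (w x x' ^ 2 + 2 * w x x' * α x' + β x') := fun x' => by
    unfold mone; ring
  simp only [this, Finset.sum_add_distrib, ← Finset.sum_mul, ← Finset.mul_sum, M.rowSum, M.e1,
    M.e2]
  ring

lemma Mart.Tm_zero (M : Mart P w α β s2 B) {m : ℝ → ℝ} (hm : ∀ y, m y ≠ 0 → 0 < y)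
    (g : X → ℝ → ℝ) (x : X) (y : ℝ) (hy : y ≤ -B) : Tm P w m g x y = 0 := by
  rw [Tm_apply]
  refine Finset.sum_eq_zero fun x' _ => ?_
  have h0 : m (y + w x x') = 0 := by
    by_contra h
    have := hm _ h
    have := (abs_le.mp (M.hw x x')).2
    linarith
  simp [h0]

/-- Partial exit probability through the top. -/
noncomputable def ptop (P w : X → X → ℝ) (L : ℝ) (n : ℕ) (x : X) (y : ℝ) : ℝ :=
  ∑ k ∈ Finset.range n, (Tm P w (mstrip L) ^ k) (Tm P w (mtop L) one1) x y

lemma mask3 (L : ℝ) (y : ℝ) : mone y = mstrip L y + (mtop L y + mneg y) := by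
  unfold mone mstrip mtop mneg
  by_cases h : 0 < y <;> by_cases h' : L ≤ y <;> simp [h, h', not_lt.mpr, not_le.mp]

lemma mask3_nonneg (L : ℝ) (y : ℝ) : 0 ≤ mtop L y + mneg y :=
  add_nonneg (mtop_nonneg _ _) (mneg_nonneg _)

lemma mask3_ne {L : ℝ} (hL : 0 < L) (y : ℝ) (h : mtop L y + mneg y ≠ 0) : L ≤ y ∨ y ≤ 0 := by
  by_contra h'
  push Not at h'
  apply h
  unfold mtop mneg
  simp [not_le.mpr h'.1, h'.2]

lemma ptop_nonneg (M : Mart P w α β s2 B) (L : ℝ) (n : ℕ) (x : X) (y : ℝ) :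
    0 ≤ ptop P w L n x y :=
  Finset.sum_nonneg fun k _ => Tm_pow_nonneg M.nonneg (mstrip_nonneg L)
    (fun x y => Tm_nonneg M.nonneg (mtop_nonneg L) (fun _ _ => zero_le_one) x y) k x y

lemma sum_strip_neg (M : Mart P w α β s2 B) {L : ℝ} (n : ℕ) (g : X → ℝ → ℝ) (x : X) (y : ℝ)
    (hy : y ≤ -B) (hg : 0 ≤ g x y) :
    ∑ k ∈ Finset.range n, (Tm P w (mstrip L) ^ k) g x y ≤ g x y := by
  cases n with
  | zero => simpa using hg
  | succ n =>
    rw [Finset.sum_range_succ']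
    have : ∀ k ∈ Finset.range n, (Tm P w (mstrip L) ^ (k + 1)) g x y = 0 := fun k _ => by
      rw [pow_succ', Module.End.mul_apply]
      exact M.Tm_zero (fun y h => (mstrip_ne L y h).1) _ _ _ hy
    rw [Finset.sum_eq_zero this]; simp

lemma ptop_le (M : Mart P w α β s2 B) {L : ℝ} (hL : 1 ≤ L) (n : ℕ) (x : X) (y : ℝ) :
    ptop P w L n x y ≤ 4 * B * (1 + max y 0) / L := by
  have hB := M.hB
  rw [le_div_iff₀ (by linarith)]
  have hmx : 0 ≤ max y 0 := le_max_right _ _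
  by_cases hy : y ≤ -B
  · have : ptop P w L n x y ≤ 0 := by
      have h0 : Tm P w (mtop L) one1 x y = 0 := M.Tm_zero (fun y h => (mtop_ne L y h).1) _ _ _ hy
      have := sum_strip_neg M (L := L) n (Tm P w (mtop L) one1) x y hy h0.ge
      unfold ptop; linarith
    have h2 : 0 ≤ 4 * B * (1 + max y 0) := by positivity
    nlinarith
  · push Not at hy
    set G : X → ℝ → ℝ := fun x y => 1 * (y + α x) + 3 * B with hG
    have hGn : ∀ x y, -(2 * B) ≤ y → 0 ≤ G x y := fun x y h => by
      have := (abs_le.mp (M.hα x)).1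
      simp only [hG]; linarith
    have key := dynkin (w := w) M.nonneg (mstrip_nonneg L) (Set.Ici (-B))
      (fun y h => by have := (mstrip_ne L y h).1; simp only [Set.mem_Ici]; linarith)
      (mask3 L) (G := G) (r := 0)
      (fun x y _ => by simp only [hG, M.Tlin]; simp) n x y (by simpa using hy.le)
    have h1 : 0 ≤ (Tm P w (mstrip L) ^ n) G x y := by
      have := Tm_pow_mono_on (w := w) M.nonneg (mstrip_nonneg L) (Set.Ici (-B))
        (fun y h => by have := (mstrip_ne L y h).1; simp only [Set.mem_Ici]; linarith)
        (g := 0) (h := G) (fun x y hy => hGn x y (by simp at hy; linarith)) n x y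
        (by simpa using hy.le)
      simpa using this
    have h2 : L * ptop P w L n x y ≤ ∑ k ∈ Finset.range n,
        (Tm P w (mstrip L) ^ k) (0 + Tm P w (fun y => mtop L y + mneg y) G) x y := by
      unfold ptop
      rw [Finset.mul_sum]
      refine Finset.sum_le_sum fun k _ => ?_
      have := Tm_pow_mono_on (w := w) M.nonneg (mstrip_nonneg L) (Set.Ici (-B))
        (fun y h => by have := (mstrip_ne L y h).1; simp only [Set.mem_Ici]; linarith)
        (g := L • Tm P w (mtop L) one1) (h := 0 + Tm P w (fun y => mtop L y + mneg y) G)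
        (fun x y hy => ?_) k x y (by simpa using hy.le)
      · simpa using this
      · rw [Tm_add_mask (mtop L) mneg (fun y => mtop L y + mneg y) (fun _ => rfl), ← map_smul]
        simp only [zero_add, LinearMap.add_apply, Pi.add_apply, Pi.zero_apply]
        have a1 : Tm P w (mtop L) (L • one1) x y ≤ Tm P w (mtop L) G x y := by
          refine Tm_le_on M.nonneg (mtop_nonneg L) x y fun x' h => ?_
          have := (mtop_ne _ _ h).2
          have h3 := (abs_le.mp (M.hα x')).1
          simp only [one1, Pi.smul_apply, smul_eq_mul, hG]; linarith
        have a2 : 0 ≤ Tm P w mneg G x y := by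
          have := Tm_le_on (w := w) M.nonneg mneg_nonneg (g := 0) (h := G) x y fun x' h => by
            apply hGn
            have := (abs_le.mp (M.hw x x')).1
            simp at hy; linarith
          simpa using this
        linarith
    have h3 : G x y ≤ 4 * B * (1 + max y 0) := by
      have := (abs_le.mp (M.hα x)).2
      have h4 : y ≤ max y 0 := le_max_left _ _
      simp only [hG]; nlinarith
    linarith

/-- Constant of the exit estimates. -/
noncomputable def cExit (s2 B : ℝ) : ℝ := 27 * B ^ 2 / s2 + 4 * B

lemma cExit_pos (M : Mart P w α β s2 B) : 0 < cExit s2 B := by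
  have := M.hB; have := M.hs; unfold cExit; positivity

lemma sum_strip_le (M : Mart P w α β s2 B) {L : ℝ} (hL : 1 ≤ L) (n : ℕ) (x : X) (y : ℝ)
    (hyL : y < L) :
    ∑ k ∈ Finset.range n, (Tm P w (mstrip L) ^ k) one1 x y ≤ cExit s2 B * (1 + max y 0) * L := by
  have hB := M.hB
  have hs := M.hs
  have hmx : 0 ≤ max y 0 := le_max_right _ _
  have hc : 4 ≤ cExit s2 B := by
    have : 0 ≤ 27 * B ^ 2 / s2 := by positivity
    unfold cExit; linarith
  have hq : 1 ≤ (1 + max y 0) * L := by nlinarith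
  by_cases hy : y ≤ -B
  · have := sum_strip_neg M (L := L) n one1 x y hy zero_le_one
    have h1 : (one1 x y : ℝ) = 1 := rfl
    nlinarith
  · push Not at hy
    set A : Set ℝ := {y | -B ≤ y ∧ y < L}
    have hA : ∀ y, mstrip L y ≠ 0 → y ∈ A := fun y h => by
      have := mstrip_ne L y h
      exact ⟨by linarith, this.2⟩
    set G : X → ℝ → ℝ := fun x y =>
      (y + α x + 3 * B) * (L + 3 * B - (y + α x)) + α x ^ 2 - β x + B with hG
    have hGeq : G = (fun x y => L * (y + α x) + (3 * B * (L + 3 * B) + B)) -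
        fun x y => y ^ 2 + 2 * y * α x + β x := by
      funext x y; simp only [hG, Pi.sub_apply]; ring
    have hGn : ∀ x y, -(2 * B) ≤ y → y ≤ L + B → 0 ≤ G x y := fun x y h h' => by
      have h1 := abs_le.mp (M.hα x)
      have h2 := abs_le.mp (M.hβ x)
      have : 0 ≤ (y + α x + 3 * B) * (L + 3 * B - (y + α x)) :=
        mul_nonneg (by linarith) (by linarith)
      simp only [hG]; nlinarith [sq_nonneg (α x)]
    have key := dynkin (w := w) M.nonneg (mstrip_nonneg L) A hA (mask3 L) (G := G)
      (r := s2 • one1)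
      (fun x y _ => by
        rw [hGeq, map_sub]
        simp only [Pi.sub_apply, M.Tlin, M.Tquad, Pi.smul_apply, one1, smul_eq_mul]
        linarith) n x y ⟨hy.le, hyL⟩
    have h1 : 0 ≤ (Tm P w (mstrip L) ^ n) G x y := by
      have := Tm_pow_mono_on (w := w) M.nonneg (mstrip_nonneg L) A hA
        (g := 0) (h := G) (fun x y hy => hGn x y (by linarith [hy.1]) (by linarith [hy.2])) n x y
        ⟨hy.le, hyL⟩
      simpa using this
    have h2 : s2 * ∑ k ∈ Finset.range n, (Tm P w (mstrip L) ^ k) one1 x y ≤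
        ∑ k ∈ Finset.range n,
        (Tm P w (mstrip L) ^ k) (s2 • one1 + Tm P w (fun y => mtop L y + mneg y) G) x y := by
      rw [Finset.mul_sum]
      refine Finset.sum_le_sum fun k _ => ?_
      have := Tm_pow_mono_on (w := w) M.nonneg (mstrip_nonneg L) A hA
        (g := s2 • one1) (h := s2 • one1 + Tm P w (fun y => mtop L y + mneg y) G)
        (fun x y hy => ?_) k x y ⟨hy.le, hyL⟩
      · simpa using this
      · have := Tm_le_on (w := w) M.nonneg (mask3_nonneg L) (g := 0) (h := G) x y fun x' h => by
          have h5 := abs_le.mp (M.hw x x')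
          exact hGn _ _ (by linarith [hy.1]) (by linarith [hy.2])
        simp only [map_zero, Pi.zero_apply] at this
        simpa using this
    have h3 : G x y ≤ 27 * B ^ 2 * ((1 + max y 0) * L) := by
      have h1 := abs_le.mp (M.hα x)
      have h2 := abs_le.mp (M.hβ x)
      have h4 : y ≤ max y 0 := le_max_left _ _
      have h5 : (y + α x + 3 * B) ≤ 4 * B * (1 + max y 0) := by nlinarith
      have h6 : L + 3 * B - (y + α x) ≤ 6 * B * L := by nlinarith
      have h7 : (y + α x + 3 * B) * (L + 3 * B - (y + α x)) ≤
          (4 * B * (1 + max y 0)) * (6 * B * L) :=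
        mul_le_mul h5 h6 (by linarith) (by positivity)
      have h8 : α x ^ 2 ≤ B ^ 2 := sq_le_sq' h1.1 h1.2
      have h9 : B ≤ B ^ 2 := by nlinarith
      have h10 : 3 * B ^ 2 ≤ 3 * B ^ 2 * ((1 + max y 0) * L) :=
        le_mul_of_one_le_right (by positivity) hq
      simp only [hG]; nlinarith
    have h11 : s2 * ∑ k ∈ Finset.range n, (Tm P w (mstrip L) ^ k) one1 x y ≤
        27 * B ^ 2 * ((1 + max y 0) * L) := by linarith
    have h12 : ∑ k ∈ Finset.range n, (Tm P w (mstrip L) ^ k) one1 x y ≤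
        27 * B ^ 2 / s2 * ((1 + max y 0) * L) := by
      rw [div_mul_eq_mul_div, le_div_iff₀ hs]; linarith
    have h13 : 27 * B ^ 2 / s2 * ((1 + max y 0) * L) ≤ cExit s2 B * ((1 + max y 0) * L) := by
      refine mul_le_mul_of_nonneg_right ?_ (by linarith)
      unfold cExit; linarith
    linarith

lemma strip_le (M : Mart P w α β s2 B) {L : ℝ} (hL : 1 ≤ L) {n : ℕ} (hn : 1 ≤ n) (x : X) (y : ℝ)
    (hyL : y < L) :
    (Tm P w (mstrip L) ^ n) one1 x y ≤ cExit s2 B * (1 + max y 0) * L / n := by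
  have hn' : (0 : ℝ) < n := by exact_mod_cast hn
  rw [le_div_iff₀ hn']
  refine le_trans ?_ (sum_strip_le M hL n x y hyL)
  have : ∑ k ∈ Finset.range n, (Tm P w (mstrip L) ^ n) one1 x y ≤
      ∑ k ∈ Finset.range n, (Tm P w (mstrip L) ^ k) one1 x y :=
    Finset.sum_le_sum fun k hk => Tm_pow_one_antitone M.nonneg M.rowSum (mstrip_nonneg L)
      (mstrip_le_one L) x y (Finset.mem_range.mp hk).le
  simp only [Finset.sum_const, Finset.card_range, nsmul_eq_mul] at this
  linarith

lemma survive_le (M : Mart P w α β s2 B) {n : ℕ} (hn : 1 ≤ n) (x : X) (y : ℝ) :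
    (Tm P w mpos ^ n) one1 x y ≤ 2 * cExit s2 B * (1 + max y 0) / √n := by
  have hn' : (1 : ℝ) ≤ n := by exact_mod_cast hn
  have hsq : (1 : ℝ) ≤ √n := by rw [Real.one_le_sqrt]; exact hn'
  have hB := M.hB
  have hs := M.hs
  have hmx : 0 ≤ max y 0 := le_max_right _ _
  have hc : 4 * B ≤ cExit s2 B := by
    have : 0 ≤ 27 * B ^ 2 / s2 := by positivity
    unfold cExit; linarith
  by_cases hy : √n ≤ y
  · refine (Tm_pow_one_le M.nonneg M.rowSum mpos_nonneg mpos_le_one n x y).trans ?_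
    rw [le_div_iff₀ (by linarith)]
    have : y ≤ max y 0 := le_max_left _ _
    nlinarith
  · push Not at hy
    have h := pow_decomp (Tm P w (mstrip √n)) (Tm P w (mtop √n)) 0 n
    rw [← Tm_pos_eq, add_zero, pow_zero, mul_one] at h
    rw [h]
    simp only [LinearMap.add_apply, Pi.add_apply, LinearMap.sum_apply, Finset.sum_apply]
    have h1 := strip_le M hsq hn x y hy
    have h2 : cExit s2 B * (1 + max y 0) * √n / n = cExit s2 B * (1 + max y 0) / √n := by
      have : (n : ℝ) = √n * √n := (Real.mul_self_sqrt (by linarith)).symm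
      rw [div_eq_div_iff (by linarith) (by linarith)]
      rw [mul_assoc, ← this]
    have h3 : ∑ k ∈ Finset.range n, ((Tm P w (mstrip √n)) ^ k * Tm P w (mtop √n) *
        Tm P w mpos ^ (n - 1 - k)) one1 x y ≤ ptop P w (√n) n x y := by
      unfold ptop
      refine Finset.sum_le_sum fun k _ => ?_
      rw [Module.End.mul_apply, Module.End.mul_apply]
      refine Tm_pow_mono M.nonneg (mstrip_nonneg _) (fun x y => ?_) k x y
      exact Tm_mono M.nonneg (mtop_nonneg _) (fun x y =>
        Tm_pow_one_le M.nonneg M.rowSum mpos_nonneg mpos_le_one _ x y) x y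
    have h4 := ptop_le M hsq n x y
    have h5 : 4 * B * (1 + max y 0) / √n ≤ cExit s2 B * (1 + max y 0) / √n := by gcongr
    have h6 : 2 * cExit s2 B * (1 + max y 0) / √n =
      cExit s2 B * (1 + max y 0) / √n + cExit s2 B * (1 + max y 0) / √n := by ring
    linarith

lemma ptop_lin (M : Mart P w α β s2 B) {L : ℝ} (hL : B ≤ L) (n : ℕ) (x : X) (y : ℝ)
    (hy0 : 0 < y) (hyL : y < L) :
    |L * ptop P w L n x y - y| ≤ 3 * B + 2 * L * (Tm P w (mstrip L) ^ n) one1 x y := by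
  have hB := M.hB
  have hs := M.hs
  set A : Set ℝ := {y | 0 < y ∧ y < L}
  have hA : ∀ y, mstrip L y ≠ 0 → y ∈ A := fun y h => mstrip_ne L y h
  set h : X → ℝ → ℝ := fun x y => 1 * (y + α x) + 0 with hh
  have k1 := dynkin (w := w) M.nonneg (mstrip_nonneg L) A hA (mask3 L) (G := h) (r := 0)
      (fun x y _ => by simp only [hh, M.Tlin]; simp) n x y ⟨hy0, hyL⟩
  have k2 := dynkin (w := w) M.nonneg (mstrip_nonneg L) A hA (mask3 L) (G := -h) (r := 0)
      (fun x y _ => by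
        rw [map_neg]; simp only [hh, M.Tlin, Pi.neg_apply]; simp) n x y ⟨hy0, hyL⟩
  have k3 := dynkin (w := w) M.nonneg (mstrip_nonneg L) A hA (mask3 L) (G := one1) (r := 0)
      (fun x y _ => by
        have := Tm_one_le (w := w) M.nonneg M.rowSum (m := mone) (fun y => le_refl _) x y
        simpa [one1] using this) n x y ⟨hy0, hyL⟩
  simp only [map_neg, Pi.neg_apply, zero_add, Finset.sum_neg_distrib] at k1 k2 k3
  set R := ∑ k ∈ Finset.range n,
    (Tm P w (mstrip L) ^ k) (Tm P w (fun y => mtop L y + mneg y) h) x y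
  set R1 := ∑ k ∈ Finset.range n,
    (Tm P w (mstrip L) ^ k) (Tm P w (fun y => mtop L y + mneg y) one1) x y
  have a1 : |(Tm P w (mstrip L) ^ n) h x y| ≤ (2 * L) * (Tm P w (mstrip L) ^ n) one1 x y := by
    refine Tm_pow_abs_le M.nonneg (mstrip_nonneg L) A hA (2 * L) (fun x y hy => ?_) n x y
      ⟨hy0, hyL⟩
    have h1 := abs_le.mp (M.hα x)
    simp only [hh, one1, abs_le]
    constructor <;> linarith [hy.1, hy.2]
  have a2 : |R - L * ptop P w L n x y| ≤ 2 * B * R1 := by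
    have : R - L * ptop P w L n x y = ∑ k ∈ Finset.range n, (Tm P w (mstrip L) ^ k)
        (Tm P w (fun y => mtop L y + mneg y) h - L • Tm P w (mtop L) one1) x y := by
      simp only [R, ptop, Finset.mul_sum, ← Finset.sum_sub_distrib, map_sub, map_smul,
        Pi.sub_apply, Pi.smul_apply, smul_eq_mul]
    rw [this, Finset.mul_sum]
    refine (Finset.abs_sum_le_sum_abs _ _).trans (Finset.sum_le_sum fun k _ => ?_)
    refine Tm_pow_abs_le M.nonneg (mstrip_nonneg L) A hA (2 * B) (fun x y hy => ?_) k x y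
      ⟨hy0, hyL⟩
    have e : Tm P w (fun y => mtop L y + mneg y) h - L • Tm P w (mtop L) one1 =
        Tm P w (mtop L) (h - L • one1) + Tm P w mneg h := by
      rw [Tm_add_mask (mtop L) mneg (fun y => mtop L y + mneg y) (fun _ => rfl), map_sub, map_smul,
        LinearMap.add_apply]
      abel
    rw [e, Tm_add_mask (mtop L) mneg (fun y => mtop L y + mneg y) (fun _ => rfl)]
    simp only [LinearMap.add_apply, Pi.add_apply, mul_add]
    refine (abs_add_le _ _).trans (add_le_add ?_ ?_)
    · rw [Tm_apply, Tm_apply, Finset.mul_sum]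
      refine (Finset.abs_sum_le_sum_abs _ _).trans (Finset.sum_le_sum fun x' _ => ?_)
      rw [abs_mul, abs_mul, abs_of_nonneg (M.nonneg _ _), abs_of_nonneg (mtop_nonneg _ _)]
      by_cases h0 : mtop L (y + w x x') = 0
      · simp [h0]
      have h1 := abs_le.mp (M.hα x')
      have h2 := abs_le.mp (M.hw x x')
      have h3 := mtop_ne _ _ h0
      have h4 : |(h - L • (one1 : X → ℝ → ℝ)) x' (y + w x x')| ≤ 2 * B := by
        simp only [hh, one1, Pi.sub_apply, Pi.smul_apply, smul_eq_mul, abs_le]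
        constructor <;> linarith [hy.1, hy.2]
      have h5 := mul_le_mul_of_nonneg_left h4
        (mul_nonneg (M.nonneg x x') (mtop_nonneg L (y + w x x')))
      simp only [one1]; linarith
    · rw [Tm_apply, Tm_apply, Finset.mul_sum]
      refine (Finset.abs_sum_le_sum_abs _ _).trans (Finset.sum_le_sum fun x' _ => ?_)
      rw [abs_mul, abs_mul, abs_of_nonneg (M.nonneg _ _), abs_of_nonneg (mneg_nonneg _)]
      by_cases h0 : mneg (y + w x x') = 0
      · simp [h0]
      have h1 := abs_le.mp (M.hα x')
      have h2 := abs_le.mp (M.hw x x')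
      have h3 := mneg_ne _ h0
      have h4 : |h x' (y + w x x')| ≤ 2 * B := by
        simp only [hh, abs_le]
        constructor <;> linarith [hy.1, hy.2]
      have h5 := mul_le_mul_of_nonneg_left h4
        (mul_nonneg (M.nonneg x x') (mneg_nonneg (y + w x x')))
      simp only [one1]; linarith
  have a3 : 0 ≤ (Tm P w (mstrip L) ^ n) one1 x y :=
    Tm_pow_nonneg M.nonneg (mstrip_nonneg L) (fun _ _ => zero_le_one) n x y
  have a4 : R1 ≤ 1 := by
    have : (one1 x y : ℝ) = 1 := rfl
    linarith
  have a5 : h x y = y + α x := by simp [hh]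
  have a6 := abs_le.mp (M.hα x)
  rw [abs_le] at a1 a2 ⊢
  constructor <;> nlinarith

end

section
variable [Fintype X] [DecidableEq X] {P : X → X → ℝ} {ν : X → ℝ}

lemma kpow_eq (P : X → X → ℝ) (n : ℕ) (x x' : X) :
    kpow P n x x' = ((Matrix.of P) ^ n) x x' := by
  induction n generalizing x x' with
  | zero => simp [kpow, Matrix.one_apply]
  | succ n ih =>
    rw [pow_succ', Matrix.mul_apply]
    simp only [kpow, ih, Matrix.of_apply]

lemma kpow_succ' (P : X → X → ℝ) (n : ℕ) (x x' : X) :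
    kpow P (n + 1) x x' = ∑ y, kpow P n x y * P y x' := by
  rw [kpow_eq, pow_succ, Matrix.mul_apply]
  simp only [kpow_eq, Matrix.of_apply]

lemma kpow_add (P : X → X → ℝ) (m n : ℕ) (x x' : X) :
    kpow P (m + n) x x' = ∑ y, kpow P m x y * kpow P n y x' := by
  rw [kpow_eq, pow_add, Matrix.mul_apply]
  simp only [kpow_eq]

lemma Pop_iter (P : X → X → ℝ) (n : ℕ) (g : X → ℝ) (x : X) :
    (Pop P)^[n] g x = ∑ x', kpow P n x x' * g x' := by
  induction n generalizing x with
  | zero => simp [kpow]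
  | succ n ih =>
    rw [Function.iterate_succ_apply']
    unfold Pop at *
    simp only [ih, kpow, Finset.mul_sum, Finset.sum_mul]
    rw [Finset.sum_comm]
    refine Finset.sum_congr rfl fun _ _ => Finset.sum_congr rfl fun _ _ => by ring

lemma kpow_nonneg (hS : IsStochastic P ν) (n : ℕ) (x x' : X) : 0 ≤ kpow P n x x' := by
  induction n generalizing x with
  | zero => unfold kpow; split_ifs <;> norm_num
  | succ n ih => exact Finset.sum_nonneg fun y _ => mul_nonneg (hS.nonneg _ _) (ih _)

lemma kpow_row (hS : IsStochastic P ν) (n : ℕ) (x : X) : ∑ x', kpow P n x x' = 1 := by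
  induction n generalizing x with
  | zero => simp [kpow]
  | succ n ih =>
    simp only [kpow]
    rw [Finset.sum_comm]
    simp only [← Finset.mul_sum, ih, mul_one, hS.rowSum]

lemma kpow_inv (hS : IsStochastic P ν) (n : ℕ) (x' : X) : ∑ x, ν x * kpow P n x x' = ν x' := by
  induction n generalizing x' with
  | zero => simp [kpow]
  | succ n ih =>
    simp only [kpow_succ', Finset.mul_sum]
    rw [Finset.sum_comm]
    simp only [← mul_assoc, ← Finset.sum_mul, ih, hS.nuInv]

lemma nu_le_one (hS : IsStochastic P ν) (x : X) : ν x ≤ 1 := by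
  rw [← hS.nuSum]
  exact Finset.single_le_sum (f := ν) (fun i _ => (hS.nuPos i).le) (Finset.mem_univ x)

lemma gap_aux (hS : IsStochastic P ν) {k₀ : ℕ} {η : ℝ} (hη : ∀ x x', η ≤ kpow P k₀ x x')
    (hη0 : 0 ≤ η) (g : X → ℝ) (hg : ∑ x, g x * ν x = 0) (M : ℝ) (hM : ∀ x, |g x| ≤ M) (x : X) :
    |∑ x', kpow P k₀ x x' * g x'| ≤ (1 - η) * M := by
  have e : ∑ x', kpow P k₀ x x' * g x' = ∑ x', (kpow P k₀ x x' - η * ν x') * g x' := by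
    have : ∑ x', (kpow P k₀ x x' - η * ν x') * g x' =
        ∑ x', kpow P k₀ x x' * g x' - η * ∑ x', g x' * ν x' := by
      rw [Finset.mul_sum, ← Finset.sum_sub_distrib]
      refine Finset.sum_congr rfl fun _ _ => by ring
    rw [this, hg]; ring
  rw [e]
  have e2 : (1 - η) * M = ∑ x', (kpow P k₀ x x' - η * ν x') * M := by
    rw [← Finset.sum_mul, Finset.sum_sub_distrib, kpow_row hS, ← Finset.mul_sum, hS.nuSum, mul_one]
  rw [e2]
  refine (Finset.abs_sum_le_sum_abs _ _).trans (Finset.sum_le_sum fun x' _ => ?_)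
  have h0 : 0 ≤ kpow P k₀ x x' - η * ν x' := by
    have := hη x x'
    have := mul_le_mul_of_nonneg_left (nu_le_one hS x') hη0
    linarith
  rw [abs_mul, abs_of_nonneg h0]
  exact mul_le_mul_of_nonneg_left (hM x') h0

lemma gap_aux2 (hS : IsStochastic P ν) {k₀ : ℕ} {η : ℝ} (hη : ∀ x x', η ≤ kpow P k₀ x x')
    (hη0 : 0 ≤ η) (g : X → ℝ) (hg : ∑ x, g x * ν x = 0) (M : ℝ) (hM : ∀ x, |g x| ≤ M)
    (r q : ℕ) (x : X) :
    |∑ x', kpow P (q * k₀ + r) x x' * g x'| ≤ (1 - η) ^ q * M := by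
  induction q generalizing x with
  | zero =>
    simp only [zero_mul, zero_add, pow_zero, one_mul]
    calc |∑ x', kpow P r x x' * g x'| ≤ ∑ x', kpow P r x x' * M := by
          refine (Finset.abs_sum_le_sum_abs _ _).trans (Finset.sum_le_sum fun x' _ => ?_)
          rw [abs_mul, abs_of_nonneg (kpow_nonneg hS _ _ _)]
          exact mul_le_mul_of_nonneg_left (hM x') (kpow_nonneg hS _ _ _)
      _ = M := by rw [← Finset.sum_mul, kpow_row hS, one_mul]
  | succ q ih =>
    have e : ∑ x', kpow P ((q + 1) * k₀ + r) x x' * g x' =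
        ∑ z, kpow P k₀ x z * ∑ x', kpow P (q * k₀ + r) z x' * g x' := by
      rw [show (q + 1) * k₀ + r = k₀ + (q * k₀ + r) by ring]
      simp only [kpow_add P k₀, Finset.sum_mul, Finset.mul_sum]
      rw [Finset.sum_comm]
      refine Finset.sum_congr rfl fun _ _ => Finset.sum_congr rfl fun _ _ => by ring
    rw [e]
    refine (gap_aux hS hη hη0 (fun z => ∑ x', kpow P (q * k₀ + r) z x' * g x') ?_ _ ih x).trans
      (le_of_eq (by ring))
    simp only [Finset.sum_mul]
    rw [Finset.sum_comm]
    rw [← hg]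
    refine Finset.sum_congr rfl fun x' _ => ?_
    rw [← kpow_inv hS (q * k₀ + r) x', Finset.mul_sum]
    refine Finset.sum_congr rfl fun _ _ => by ring

/-- spectral gap -/
lemma gap (hS : IsStochastic P ν) (h1 : Primitive P) :
    ∃ C ρ : ℝ, 0 < C ∧ 0 < ρ ∧ ρ < 1 ∧ ∀ (g : X → ℝ), ∑ x, g x * ν x = 0 → ∀ M : ℝ,
      (∀ x, |g x| ≤ M) → ∀ (n : ℕ) (x : X), |∑ x', kpow P n x x' * g x'| ≤ C * ρ ^ n * M := by
  obtain ⟨k₀, hk, hpos⟩ := h1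
  obtain ⟨η, hη0, hη1, hη⟩ : ∃ η : ℝ, 0 < η ∧ η ≤ 1 / 2 ∧ ∀ x x', η ≤ kpow P k₀ x x' := by
    by_cases hX : Nonempty X
    · obtain ⟨p, hp⟩ := Finite.exists_min (fun p : X × X => kpow P k₀ p.1 p.2)
      exact ⟨min (1 / 2) (kpow P k₀ p.1 p.2), lt_min (by norm_num) (hpos _ _), min_le_left _ _,
        fun x x' => (min_le_right _ _).trans (hp (x, x'))⟩
    · exact ⟨1 / 2, by norm_num, le_rfl, fun x => (hX ⟨x⟩).elim⟩
  have hk' : (0 : ℝ) < k₀ := by exact_mod_cast hk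
  have hb : (0 : ℝ) < 1 - η := by linarith
  refine ⟨(1 - η)⁻¹, (1 - η) ^ ((k₀ : ℝ)⁻¹), by positivity, by positivity,
    Real.rpow_lt_one hb.le (by linarith) (by positivity), ?_⟩
  intro g hg M hM n x
  have h := gap_aux2 hS hη hη0.le g hg M hM (n % k₀) (n / k₀) x
  rw [Nat.div_add_mod'] at h
  refine h.trans (mul_le_mul_of_nonneg_right ?_ ((abs_nonneg _).trans (hM x)))
  rw [← Real.rpow_natCast (x := (1 - η) ^ _) , ← Real.rpow_mul hb.le, ← Real.rpow_natCast,
    ← Real.rpow_neg_one (1 - η), ← Real.rpow_add hb]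
  refine Real.rpow_le_rpow_of_exponent_ge hb (by linarith) ?_
  have := Nat.lt_div_mul_add hk (a := n)
  have h3 : (n : ℝ) < (n / k₀ : ℕ) * k₀ + k₀ := by exact_mod_cast this
  have h4 : (n : ℝ) / k₀ ≤ (n / k₀ : ℕ) + 1 := by
    rw [div_le_iff₀ hk']; nlinarith
  rw [inv_mul_eq_div]; linarith

/-- solution of the Poisson equation -/
noncomputable def pois (P : X → X → ℝ) (g : X → ℝ) (x : X) : ℝ := ∑' k : ℕ, (Pop P)^[k] g x

lemma gap_summable (hS : IsStochastic P ν) (h1 : Primitive P) (g : X → ℝ)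
    (hg : ∑ x, g x * ν x = 0) (x : X) : Summable fun k : ℕ => (Pop P)^[k] g x := by
  obtain ⟨C, ρ, hC, hρ, hρ1, h⟩ := gap hS h1
  obtain ⟨M, hM⟩ : ∃ M, ∀ x, |g x| ≤ M := by
    obtain ⟨p, hp⟩ := @Finite.exists_max X ℝ _ ⟨x⟩ _ (fun x => |g x|)
    exact ⟨_, hp⟩
  refine Summable.of_norm_bounded (g := fun k => C * ρ ^ k * M)
    (((summable_geometric_of_lt_one hρ.le hρ1).mul_left C).mul_right M) fun k => ?_
  rw [Pop_iter, Real.norm_eq_abs]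
  exact h g hg M hM k x

lemma pois_eq (hS : IsStochastic P ν) (h1 : Primitive P) (g : X → ℝ)
    (hg : ∑ x, g x * ν x = 0) (x : X) : ∑ x', P x x' * pois P g x' = pois P g x - g x := by
  unfold pois
  rw [(gap_summable hS h1 g hg x).tsum_eq_zero_add]
  simp only [Function.iterate_succ_apply', Function.iterate_zero, id]
  rw [add_sub_cancel_left]
  simp only [← tsum_mul_left]
  rw [← Summable.tsum_finsetSum]
  · rfl
  · exact fun i _ => (gap_summable hS h1 g hg i).mul_left _

lemma nu_Pop (hS : IsStochastic P ν) (g : X → ℝ) :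
    ∑ x, (∑ x', P x x' * g x') * ν x = ∑ x, g x * ν x := by
  simp only [Finset.sum_mul]
  rw [Finset.sum_comm]
  refine Finset.sum_congr rfl fun x' _ => ?_
  rw [← hS.nuInv x', Finset.mul_sum]
  refine Finset.sum_congr rfl fun _ _ => by ring

lemma exists_mart (hS : IsStochastic P ν) (h1 : Primitive P) (w : X → X → ℝ)
    (hw : ∑ x, (∑ x', P x x' * w x x') * ν x = 0)
    (hco : ∀ γ : X → ℝ, ∃ x x', 0 < P x x' ∧ w x x' ≠ γ x - γ x') :
    ∃ α β s2 B, Mart P w α β s2 B ∧ α = pois P (fun x => ∑ x', P x x' * w x x') ∧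
      s2 = ∑ x, (∑ x', P x x' * (w x x' ^ 2 + 2 * w x x' * α x')) * ν x := by
  classical
  set p : X → ℝ := fun x => ∑ x', P x x' * w x x' with hp
  set α := pois P p with hα
  have hα1 : ∀ x, ∑ x', P x x' * α x' = α x - p x := pois_eq hS h1 p hw
  set q : X → ℝ := fun x => ∑ x', P x x' * (w x x' ^ 2 + 2 * w x x' * α x') with hq
  set s2 := ∑ x, q x * ν x with hs2
  have hν0 : ∑ x, (q x - s2) * ν x = 0 := by
    simp only [sub_mul, Finset.sum_sub_distrib, ← Finset.mul_sum, hS.nuSum]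
    linarith
  set β := pois P (fun x => q x - s2) with hβ
  have hβ1 : ∀ x, ∑ x', P x x' * β x' = β x - (q x - s2) := pois_eq hS h1 _ hν0
  have hpos : 0 < s2 := by
    have e : s2 = ∑ x, ∑ x', ν x * P x x' * (w x x' + α x' - α x) ^ 2 := by
      have e1 : ∀ x, ∑ x', ν x * P x x' * (w x x' + α x' - α x) ^ 2 =
          q x * ν x + (∑ x', P x x' * α x' ^ 2) * ν x - α x ^ 2 * ν x := by
        intro x
        have : ∀ x', ν x * P x x' * (w x x' + α x' - α x) ^ 2 =
          ν x * (P x x' * (w x x' ^ 2 + 2 * w x x' * α x')) + ν x * (P x x' * α x' ^ 2)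
          - 2 * ν x * α x * (P x x' * w x x') - 2 * ν x * α x * (P x x' * α x')
          + ν x * α x ^ 2 * P x x' := fun x' => by ring
        simp only [this, Finset.sum_add_distrib, Finset.sum_sub_distrib, ← Finset.mul_sum, hα1,
          hS.rowSum]
        simp only [hp, hq]
        ring
      simp only [e1, Finset.sum_add_distrib, Finset.sum_sub_distrib]
      rw [nu_Pop hS (fun x => α x ^ 2)]
      ring
    have hnn : ∀ x x', 0 ≤ ν x * P x x' * (w x x' + α x' - α x) ^ 2 := fun x x' =>
      mul_nonneg (mul_nonneg (hS.nuPos x).le (hS.nonneg x x')) (sq_nonneg _)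
    obtain ⟨x, x', h0, hne⟩ := hco α
    rw [e]
    refine Finset.sum_pos' (fun x _ => Finset.sum_nonneg fun x' _ => hnn x x')
      ⟨x, Finset.mem_univ _, Finset.sum_pos' (fun x' _ => hnn x x')
        ⟨x', Finset.mem_univ _, ?_⟩⟩
    have : w x x' + α x' - α x ≠ 0 := fun h => hne (by linarith)
    have := hS.nuPos x
    positivity
  set B := 1 + ∑ x, ∑ x', |w x x'| + ∑ x, |α x| + ∑ x, |β x| with hB
  have b1 : 0 ≤ ∑ x, ∑ x', |w x x'| :=
    Finset.sum_nonneg fun _ _ => Finset.sum_nonneg fun _ _ => abs_nonneg _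
  have b2 : 0 ≤ ∑ x, |α x| := Finset.sum_nonneg fun _ _ => abs_nonneg _
  have b3 : 0 ≤ ∑ x, |β x| := Finset.sum_nonneg fun _ _ => abs_nonneg _
  refine ⟨α, β, s2, B, ⟨hS.nonneg, hS.rowSum, ?_, ?_, ?_, by linarith, hpos, ?_, ?_⟩, rfl, rfl⟩
  · intro x x'
    have c1 := Finset.single_le_sum (f := fun x' => |w x x'|) (fun _ _ => abs_nonneg _)
      (Finset.mem_univ x')
    have c2 := Finset.single_le_sum (f := fun x => ∑ x', |w x x'|)
      (fun _ _ => Finset.sum_nonneg fun _ _ => abs_nonneg _) (Finset.mem_univ x)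
    linarith
  · intro x
    have c2 := Finset.single_le_sum (f := fun x => |α x|)
      (fun _ _ => abs_nonneg _) (Finset.mem_univ x)
    linarith
  · intro x
    have c2 := Finset.single_le_sum (f := fun x => |β x|)
      (fun _ _ => abs_nonneg _) (Finset.mem_univ x)
    linarith
  · intro x
    simp only [mul_add, Finset.sum_add_distrib, hα1]
    simp only [hp]; ring
  · intro x
    have : ∀ x', P x x' * (w x x' ^ 2 + 2 * w x x' * α x' + β x') =
      P x x' * (w x x' ^ 2 + 2 * w x x' * α x') + P x x' * β x' := fun x' => by ring
    simp only [this, Finset.sum_add_distrib, hβ1]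
    simp only [hq]; ring

lemma dual_stoch (hS : IsStochastic P ν) : IsStochastic (dualK P ν) ν where
  nonneg x x' := div_nonneg (mul_nonneg (hS.nuPos _).le (hS.nonneg _ _)) (hS.nuPos _).le
  rowSum x := by
    unfold dualK
    rw [← Finset.sum_div, hS.nuInv, div_self (hS.nuPos x).ne']
  nuPos := hS.nuPos
  nuSum := hS.nuSum
  nuInv x' := by
    have : ∀ x, ν x * dualK P ν x x' = ν x' * P x' x := fun x => by
      unfold dualK
      have := (hS.nuPos x).ne'
      field_simp
    simp only [this, ← Finset.mul_sum, hS.rowSum, mul_one]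

lemma dual_kpow (hS : IsStochastic P ν) (n : ℕ) (x x' : X) :
    kpow (dualK P ν) n x x' = ν x' * kpow P n x' x / ν x := by
  induction n generalizing x with
  | zero =>
    simp only [kpow]
    by_cases h : x = x'
    · subst h; simp [(hS.nuPos x).ne']
    · simp [h, Ne.symm h]
  | succ n ih =>
    rw [kpow_succ' P]
    simp only [kpow, ih]
    rw [Finset.mul_sum, Finset.sum_div]
    refine Finset.sum_congr rfl fun y _ => ?_
    unfold dualK
    have := (hS.nuPos x).ne'
    have := (hS.nuPos y).ne'
    field_simp

lemma dual_prim (hS : IsStochastic P ν) (h1 : Primitive P) : Primitive (dualK P ν) := by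
  obtain ⟨k, hk, h⟩ := h1
  refine ⟨k, hk, fun x x' => ?_⟩
  rw [dual_kpow hS]
  have := h x' x
  have := hS.nuPos x
  have := hS.nuPos x'
  positivity

lemma cyc_sum {n : ℕ} (F : Fin (n + 1) → ℝ) : ∑ i, F (i + 1) = ∑ i, F i :=
  Equiv.sum_comp (Equiv.addRight (1 : Fin (n + 1))) F

lemma nonlattice_edge (hS : IsStochastic P ν) {f : X → ℝ} (h3 : NonLattice P f) (γ : X → ℝ) :
    ∃ x x', 0 < P x x' ∧ f x' ≠ γ x - γ x' := by
  by_contra hcon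
  push Not at hcon
  obtain ⟨n, g, hp, hm⟩ := h3 0 0
  have hpi : ∀ i, 0 < P (g i) (g (i + 1)) := by
    intro i
    refine lt_of_le_of_ne (hS.nonneg _ _) fun h => hp.ne' ?_
    exact Finset.prod_eq_zero (Finset.mem_univ i) h.symm
  apply hm 0
  have : ∑ i, f (g i) = ∑ i, (γ (g i) - γ (g (i + 1))) := by
    rw [← cyc_sum]
    exact Finset.sum_congr rfl fun i _ => hcon _ _ (hpi i)
  rw [this, Finset.sum_sub_distrib, cyc_sum (fun i => γ (g i))]
  simp

lemma fwd_mart (hS : IsStochastic P ν) (h1 : Primitive P) {f : X → ℝ}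
    (h2 : ∑ x, f x * ν x = 0) (h3 : NonLattice P f) :
    ∃ α β B, Mart P (fun _ x' => f x') α β (sigma2 P ν f) B := by
  obtain ⟨α, β, s2, B, M, hα, hs⟩ := exists_mart hS h1 (fun _ x' => f x')
    (by rw [nu_Pop hS]; exact h2) (nonlattice_edge hS h3)
  refine ⟨α, β, B, ?_⟩
  have : s2 = sigma2 P ν f := by
    rw [hs, nu_Pop hS (fun x' => f x' ^ 2 + 2 * f x' * α x')]
    unfold sigma2
    simp only [add_mul, Finset.sum_add_distrib]
    congr 1
    have hsum := gap_summable hS h1 (Pop P f) (by unfold Pop; rw [nu_Pop hS]; exact h2)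
    have e : ∀ x, α x = ∑' n : ℕ, (Pop P)^[n + 1] f x := fun x => by
      rw [hα]; rfl
    rw [Summable.tsum_finsetSum, Finset.mul_sum]
    · refine Finset.sum_congr rfl fun x _ => ?_
      rw [tsum_mul_right, tsum_mul_left, ← e]; ring
    · intro x _
      exact ((hsum x).mul_left _).mul_right _
  rw [← this]; exact M

lemma dual_mart (hS : IsStochastic P ν) (h1 : Primitive P) {f : X → ℝ}
    (h2 : ∑ x, f x * ν x = 0) (h3 : NonLattice P f) :
    ∃ α β s2 B, Mart (dualK P ν) (fun x _ => - f x) α β s2 B := by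
  have hD := dual_stoch hS
  have hco : ∀ γ : X → ℝ, ∃ x x', 0 < dualK P ν x x' ∧ - f x ≠ γ x - γ x' := by
    intro γ
    obtain ⟨x, x', h, hne⟩ := nonlattice_edge hS h3 γ
    refine ⟨x', x, ?_, fun h => hne (by linarith)⟩
    unfold dualK
    have := hS.nuPos x
    have := hS.nuPos x'
    positivity
  obtain ⟨α, β, s2, B, M, -, -⟩ := exists_mart hD (dual_prim hS h1) (fun x _ => - f x)
    (by simp only [← Finset.sum_mul, hD.rowSum, one_mul, neg_mul, Finset.sum_neg_distrib, h2,
          neg_zero]) hco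
  exact ⟨α, β, s2, B, M⟩

end

section
variable [Fintype X] [DecidableEq X] {P : X → X → ℝ} {ν f : X → ℝ}

/-- Fourier operator -/
noncomputable def At (P : X → X → ℝ) (f : X → ℝ) (t : ℝ) : (X → ℂ) →L[ℂ] (X → ℂ) :=
  toCLM (Pmat P f t)

lemma At_apply (t : ℝ) (φ : X → ℂ) (x : X) :
    At P f t φ x = ∑ x', (P x x' : ℂ) * Complex.exp (Complex.I * (t : ℂ) * (f x' : ℂ)) * φ x' := by
  simp [At, toCLM, Pmat, Matrix.mulVec, dotProduct]

lemma norm_expI (t u : ℝ) : ‖Complex.exp (Complex.I * (t : ℂ) * (u : ℂ))‖ = 1 := by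
  have : Complex.I * (t : ℂ) * (u : ℂ) = ((t * u : ℝ) : ℂ) * Complex.I := by push_cast; ring
  rw [this, Complex.norm_exp_ofReal_mul_I]

lemma At_norm_apply (hP : ∀ x x', 0 ≤ P x x') (t : ℝ) (φ : X → ℂ) (x : X) :
    ‖At P f t φ x‖ ≤ ∑ x', P x x' * ‖φ x'‖ := by
  rw [At_apply]
  refine (norm_sum_le _ _).trans (Finset.sum_le_sum fun x' _ => ?_)
  rw [norm_mul, norm_mul, norm_expI, mul_one, Complex.norm_real, Real.norm_eq_abs,
    abs_of_nonneg (hP _ _)]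

lemma At_norm (hP : ∀ x x', 0 ≤ P x x') (hP1 : ∀ x, ∑ x', P x x' = 1) (t : ℝ) :
    ‖At P f t‖ ≤ 1 := by
  refine ContinuousLinearMap.opNorm_le_bound _ zero_le_one fun φ => ?_
  rw [one_mul, pi_norm_le_iff_of_nonneg (norm_nonneg _)]
  intro x
  refine (At_norm_apply hP t φ x).trans ?_
  rw [← one_mul ‖φ‖, ← hP1 x, Finset.sum_mul]
  exact Finset.sum_le_sum fun x' _ => mul_le_mul_of_nonneg_left (norm_le_pi_norm _ _) (hP _ _)

lemma At_pow_norm (hP : ∀ x x', 0 ≤ P x x') (hP1 : ∀ x, ∑ x', P x x' = 1) (t : ℝ) (n : ℕ) :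
    ‖At P f t ^ n‖ ≤ 1 := by
  induction n with
  | zero =>
    rw [pow_zero]
    refine ContinuousLinearMap.opNorm_le_bound _ zero_le_one fun φ => ?_
    simp
  | succ n ih =>
    rw [pow_succ]
    exact (norm_mul_le _ _).trans (mul_le_one₀ ih (norm_nonneg _) (At_norm hP hP1 t))

/-- Action of the free walk on characters. -/
lemma Tm_char (t : ℝ) (n : ℕ) (φ : X → ℂ) (x : X) (y : ℝ) :
    (Tm P (fun _ x' => f x') mone ^ n)
      (fun x' u => (Complex.exp (Complex.I * (t : ℂ) * (u : ℂ)) * φ x').re) x y =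
    (Complex.exp (Complex.I * (t : ℂ) * (y : ℂ)) * (At P f t ^ n) φ x).re := by
  induction n generalizing φ with
  | zero => simp
  | succ n ih =>
    rw [pow_succ, Module.End.mul_apply, pow_succ, mul_apply_eq_comp, ← ih]
    refine congrFun (congrFun (congrArg (Tm P (fun _ x' => f x') mone ^ n) ?_) x) y
    funext x y
    simp only [Tm_apply, mone, one_mul, At_apply, Finset.mul_sum, Complex.re_sum]
    refine Finset.sum_congr rfl fun x' _ => ?_
    rw [← Complex.re_ofReal_mul]
    congr 1
    push_cast
    rw [mul_add, Complex.exp_add]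
    ring

lemma At_zero_pow (n : ℕ) (φ : X → ℂ) (x : X) :
    (At P f 0 ^ n) φ x = ∑ x', (kpow P n x x' : ℂ) * φ x' := by
  induction n generalizing x with
  | zero =>
    have : ∀ x', ((if x = x' then 1 else 0 : ℝ) : ℂ) = if x = x' then 1 else 0 := fun x' => by
      split_ifs <;> simp
    simp [kpow, this]
  | succ n ih =>
    rw [pow_succ', mul_apply_eq_comp, At_apply]
    simp only [ih, kpow, Finset.mul_sum, Complex.ofReal_sum, Finset.sum_mul]
    rw [Finset.sum_comm]
    refine Finset.sum_congr rfl fun _ _ => Finset.sum_congr rfl fun _ _ => ?_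
    push_cast
    simp
    ring

lemma expI_bound {θ : ℝ} (h : |θ| ≤ 1) :
    ‖Complex.exp (Complex.I * θ) - (1 + Complex.I * θ - (θ : ℂ) ^ 2 / 2)‖ ≤ |θ| ^ 3 := by
  have hn : ‖Complex.I * (θ : ℂ)‖ = |θ| := by simp
  have := Complex.exp_bound (x := Complex.I * θ) (by rw [hn]; exact h) (n := 3) (by norm_num)
  rw [hn] at this
  have e : ∑ m ∈ Finset.range 3, (Complex.I * (θ : ℂ)) ^ m / (m.factorial : ℂ) =
      1 + Complex.I * θ - (θ : ℂ) ^ 2 / 2 := by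
    simp [Finset.sum_range_succ, Nat.factorial, mul_pow]
    ring
  rw [e] at this
  refine this.trans ?_
  have : (0 : ℝ) ≤ |θ| ^ 3 := by positivity
  norm_num [Nat.factorial]
  linarith

lemma exp_neg_bound {x : ℝ} (h0 : 0 ≤ x) : |Real.exp (-x) - (1 - x)| ≤ x ^ 2 := by
  have h1 : 1 - x ≤ Real.exp (-x) := by have := Real.add_one_le_exp (-x); linarith
  rw [abs_of_nonneg (by linarith)]
  have h2 : Real.exp (-x) ≤ 1 / (1 + x) := by
    rw [Real.exp_neg, ← one_div]
    exact one_div_le_one_div_of_le (by linarith) (by have := Real.add_one_le_exp x; linarith)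
  have h3 : 1 / (1 + x) ≤ 1 - x + x ^ 2 := by
    rw [div_le_iff₀ (by linarith)]
    have : 0 ≤ x ^ 3 := by positivity
    nlinarith
  linarith

/-- approximate eigenfunction -/
noncomputable def phit (α β : X → ℝ) (t : ℝ) (x : X) : ℂ :=
  1 + Complex.I * t * α x - (t : ℂ) ^ 2 / 2 * β x

lemma exp_prod_bound {B t w a b : ℝ} (hB : 1 ≤ B) (ht : |t| ≤ 1 / B) (hw : |w| ≤ B)
    (ha : |a| ≤ B) (hb : |b| ≤ B) :
    ‖Complex.exp (Complex.I * (t : ℂ) * (w : ℂ)) * (1 + Complex.I * t * a - (t : ℂ) ^ 2 / 2 * b)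
      - (1 + Complex.I * t * (w + a) - (t : ℂ) ^ 2 / 2 * (w ^ 2 + 2 * w * a + b))‖
      ≤ 5 * B ^ 3 * |t| ^ 3 := by
  have hB0 : 0 < B := by linarith
  have htB : |t| * B ≤ 1 := by rwa [le_div_iff₀ hB0] at ht
  have ht1 : |t| ≤ 1 := ht.trans (by rw [div_le_one hB0]; exact hB)
  have ht0 := abs_nonneg t
  have htw : |t * w| ≤ |t| * B := by
    rw [abs_mul]; exact mul_le_mul_of_nonneg_left hw ht0
  have h1 := expI_bound (htw.trans htB)
  set r := Complex.exp (Complex.I * ((t * w : ℝ) : ℂ)) -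
    (1 + Complex.I * ((t * w : ℝ) : ℂ) - ((t * w : ℝ) : ℂ) ^ 2 / 2) with hr
  have e : Complex.exp (Complex.I * (t : ℂ) * (w : ℂ)) = r +
    (1 + Complex.I * ((t * w : ℝ) : ℂ) - ((t * w : ℝ) : ℂ) ^ 2 / 2) := by
    rw [hr]; push_cast; rw [mul_assoc]; ring
  have e2 : Complex.exp (Complex.I * (t : ℂ) * (w : ℂ)) *
      (1 + Complex.I * t * a - (t : ℂ) ^ 2 / 2 * b)
      - (1 + Complex.I * t * (w + a) - (t : ℂ) ^ 2 / 2 * (w ^ 2 + 2 * w * a + b))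
      = r * (1 + Complex.I * t * a - (t : ℂ) ^ 2 / 2 * b)
        + (-(Complex.I * ((t ^ 3 * w * b / 2 + t ^ 3 * w ^ 2 * a / 2 : ℝ) : ℂ))
          + ((t ^ 4 * w ^ 2 * b / 4 : ℝ) : ℂ)) := by
    rw [e]
    push_cast
    linear_combination (w * a * t ^ 2 : ℂ) * Complex.I_sq
  rw [e2]
  have hta : |t| * |a| ≤ 1 := (mul_le_mul_of_nonneg_left ha ht0).trans htB
  have htb : |t| ^ 2 * |b| ≤ 1 := by
    have : |t| * |b| ≤ 1 := (mul_le_mul_of_nonneg_left hb ht0).trans htB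
    nlinarith [abs_nonneg b]
  have n1 : ‖(1 + Complex.I * t * a - (t : ℂ) ^ 2 / 2 * b)‖ ≤ 3 := by
    refine (norm_sub_le _ _).trans ?_
    have := norm_add_le (1 : ℂ) (Complex.I * t * a)
    simp only [norm_mul, norm_div, norm_pow, Complex.norm_I, Complex.norm_real, Real.norm_eq_abs,
      norm_one, one_mul, Complex.norm_ofNat] at this ⊢
    linarith
  have n2 : ‖r‖ ≤ B ^ 3 * |t| ^ 3 := by
    refine h1.trans ?_
    calc |t * w| ^ 3 ≤ (|t| * B) ^ 3 := by gcongr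
      _ = _ := by ring
  have n3 : |t ^ 3 * w * b / 2 + t ^ 3 * w ^ 2 * a / 2| ≤ B ^ 3 * |t| ^ 3 := by
    refine (abs_add_le _ _).trans ?_
    simp only [abs_div, abs_mul, abs_pow, abs_two]
    have c1 : |t| ^ 3 * |w| * |b| ≤ |t| ^ 3 * B * B := by gcongr
    have c2 : |t| ^ 3 * |w| ^ 2 * |a| ≤ |t| ^ 3 * B ^ 2 * B := by gcongr
    have c3 : |t| ^ 3 * B * B ≤ |t| ^ 3 * B ^ 2 * B := by
      have : 0 ≤ |t| ^ 3 * B * B := by positivity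
      nlinarith
    nlinarith
  have n4 : |t ^ 4 * w ^ 2 * b / 4| ≤ B ^ 3 * |t| ^ 3 := by
    simp only [abs_div, abs_mul, abs_pow]
    have c1 : |t| ^ 4 * |w| ^ 2 * |b| ≤ |t| ^ 4 * B ^ 2 * B := by gcongr
    have c2 : |t| ^ 4 ≤ |t| ^ 3 := pow_le_pow_of_le_one ht0 ht1 (by norm_num)
    have c3 : |t| ^ 4 * B ^ 2 * B ≤ |t| ^ 3 * B ^ 2 * B := by gcongr
    have c4 : 0 ≤ |t| ^ 4 * |w| ^ 2 * |b| := by positivity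
    have c5 : |(4 : ℝ)| = 4 := by norm_num
    rw [c5]
    nlinarith
  calc _ ≤ ‖r‖ * ‖(1 + Complex.I * t * a - (t : ℂ) ^ 2 / 2 * b)‖ + (B ^ 3 * |t| ^ 3
        + B ^ 3 * |t| ^ 3) := by
        refine (norm_add_le _ _).trans (add_le_add (norm_mul_le _ _) ?_)
        refine (norm_add_le _ _).trans (add_le_add ?_ ?_)
        · rw [norm_neg, norm_mul, Complex.norm_I, one_mul, Complex.norm_real]; exact n3
        · rw [Complex.norm_real]; exact n4
    _ ≤ B ^ 3 * |t| ^ 3 * 3 + (B ^ 3 * |t| ^ 3 + B ^ 3 * |t| ^ 3) := by gcongr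
    _ = _ := by ring

end

section
variable [Fintype X] [DecidableEq X] {P : X → X → ℝ} {ν f : X → ℝ} {α β : X → ℝ} {s2 B : ℝ}

lemma phit_one (M : Mart P (fun _ x' => f x') α β s2 B) {t : ℝ} (ht : |t| ≤ 1 / B) :
    ‖phit α β t - fun _ => 1‖ ≤ 2 * B * |t| := by
  have hB := M.hB
  rw [pi_norm_le_iff_of_nonneg (by positivity)]
  intro x
  have e : (phit α β t - (fun _ => 1 : X → ℂ)) x = Complex.I * t * α x - (t : ℂ) ^ 2 / 2 * β x := by
    simp only [Pi.sub_apply, phit]; ring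
  rw [e]
  refine (norm_sub_le _ _).trans ?_
  simp only [norm_mul, norm_div, norm_pow, Complex.norm_I, Complex.norm_real, Real.norm_eq_abs,
      one_mul, Complex.norm_ofNat]
  have h1 := mul_le_mul_of_nonneg_left (M.hα x) (abs_nonneg t)
  have ht1 : |t| ≤ 1 := ht.trans (by rw [div_le_one (by linarith)]; exact hB)
  have h2 : |t| ^ 2 / 2 * |β x| ≤ |t| * B := by
    have : |t| ^ 2 / 2 ≤ |t| := by nlinarith [abs_nonneg t]
    exact mul_le_mul this (M.hβ x) (abs_nonneg _) (abs_nonneg _)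
  linarith

lemma phit_step (M : Mart P (fun _ x' => f x') α β s2 B) {t : ℝ} (ht : |t| ≤ 1 / B) :
    ‖At P f t (phit α β t) - (Real.exp (-(s2 * t ^ 2 / 2)) : ℂ) • phit α β t‖ ≤
      (5 * B ^ 3 + B * s2 + s2 ^ 2) * |t| ^ 3 := by
  have hB := M.hB
  have hs := M.hs
  have ht0 := abs_nonneg t
  have ht1 : |t| ≤ 1 := ht.trans (by rw [div_le_one (by linarith)]; exact hB)
  rw [pi_norm_le_iff_of_nonneg (by positivity)]
  intro x
  set w : X → ℝ := f
  -- main expansion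
  have h1 : ‖At P f t (phit α β t) x -
      (1 + Complex.I * t * α x - (t : ℂ) ^ 2 / 2 * (β x + s2))‖ ≤ 5 * B ^ 3 * |t| ^ 3 := by
    have e1 : (1 + Complex.I * t * α x - (t : ℂ) ^ 2 / 2 * (β x + s2) : ℂ) =
        ∑ x', (P x x' : ℂ) * (1 + Complex.I * t * (f x' + α x') -
          (t : ℂ) ^ 2 / 2 * (f x' ^ 2 + 2 * f x' * α x' + β x')) := by
      have a1 := congrArg (fun r : ℝ => (r : ℂ)) (M.e1 x)
      have a2 := congrArg (fun r : ℝ => (r : ℂ)) (M.e2 x)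
      have a0 := congrArg (fun r : ℝ => (r : ℂ)) (M.rowSum x)
      push_cast at a0 a1 a2
      rw [← a2, ← a1]
      nth_rewrite 1 [← a0]
      rw [Finset.mul_sum, Finset.mul_sum, ← Finset.sum_add_distrib, ← Finset.sum_sub_distrib]
      refine Finset.sum_congr rfl fun x' _ => by ring
    rw [e1, At_apply, ← Finset.sum_sub_distrib]
    have e2 : 5 * B ^ 3 * |t| ^ 3 = ∑ x', P x x' * (5 * B ^ 3 * |t| ^ 3) := by
      rw [← Finset.sum_mul, M.rowSum, one_mul]
    rw [e2]
    refine (norm_sum_le _ _).trans (Finset.sum_le_sum fun x' _ => ?_)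
    rw [mul_assoc, ← mul_sub, norm_mul, Complex.norm_real, Real.norm_eq_abs,
      abs_of_nonneg (M.nonneg _ _)]
    exact mul_le_mul_of_nonneg_left (exp_prod_bound hB ht (M.hw x x') (M.hα x') (M.hβ x'))
      (M.nonneg _ _)
  have hph : ‖phit α β t x - 1‖ ≤ 2 * B * |t| :=
    (norm_le_pi_norm (phit α β t - fun _ => 1) x).trans (phit_one M ht)
  -- second
  have h2 : ‖(1 + Complex.I * t * α x - (t : ℂ) ^ 2 / 2 * (β x + s2)) -
      ((1 - s2 * t ^ 2 / 2 : ℝ) : ℂ) * phit α β t x‖ ≤ B * s2 * |t| ^ 3 := by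
    have : (1 + Complex.I * t * α x - (t : ℂ) ^ 2 / 2 * (β x + s2)) -
      ((1 - s2 * t ^ 2 / 2 : ℝ) : ℂ) * phit α β t x =
        ((s2 * t ^ 2 / 2 : ℝ) : ℂ) * (phit α β t x - 1) := by
      simp only [phit]; push_cast; ring
    rw [this, norm_mul, Complex.norm_real, Real.norm_eq_abs, abs_of_nonneg (by positivity)]
    calc s2 * t ^ 2 / 2 * ‖phit α β t x - 1‖ ≤ s2 * t ^ 2 / 2 * (2 * B * |t|) := by gcongr
      _ = _ := by rw [← sq_abs t]; ring
  have h3 : ‖((1 - s2 * t ^ 2 / 2 : ℝ) : ℂ) * phit α β t x -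
      (Real.exp (-(s2 * t ^ 2 / 2)) : ℂ) * phit α β t x‖ ≤ s2 ^ 2 * |t| ^ 3 := by
    rw [← sub_mul, norm_mul, ← Complex.ofReal_sub, Complex.norm_real, Real.norm_eq_abs,
      abs_sub_comm]
    have a := exp_neg_bound (x := s2 * t ^ 2 / 2) (by positivity)
    have b : ‖phit α β t x‖ ≤ 3 := by
      have := norm_add_le (phit α β t x - 1) 1
      rw [sub_add_cancel, norm_one] at this
      have : B * |t| ≤ 1 := by rw [mul_comm]; rwa [le_div_iff₀ (by linarith)] at ht
      linarith
    calc _ ≤ (s2 * t ^ 2 / 2) ^ 2 * 3 := by gcongr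
      _ = s2 ^ 2 * (3 / 4 * (|t| ^ 3 * |t|)) := by rw [← sq_abs t]; ring
      _ ≤ s2 ^ 2 * |t| ^ 3 := by
        have : 0 ≤ |t| ^ 3 := by positivity
        gcongr
        nlinarith
  have := norm_add₃_le (a := At P f t (phit α β t) x -
      (1 + Complex.I * t * α x - (t : ℂ) ^ 2 / 2 * (β x + s2)))
      (b := (1 + Complex.I * t * α x - (t : ℂ) ^ 2 / 2 * (β x + s2)) -
      ((1 - s2 * t ^ 2 / 2 : ℝ) : ℂ) * phit α β t x)
      (c := ((1 - s2 * t ^ 2 / 2 : ℝ) : ℂ) * phit α β t x -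
      (Real.exp (-(s2 * t ^ 2 / 2)) : ℂ) * phit α β t x)
  simp only [sub_add_sub_cancel] at this
  simp only [Pi.sub_apply, Pi.smul_apply, smul_eq_mul]
  linarith

lemma At_one (M : Mart P (fun _ x' => f x') α β s2 B) {t : ℝ} (ht : |t| ≤ 1 / B) (n : ℕ) :
    ‖(At P f t ^ n) (fun _ => 1) - (Real.exp (-(s2 * t ^ 2 / 2)) ^ n : ℂ) • (fun _ => 1 : X → ℂ)‖ ≤
      4 * B * |t| + n * ((5 * B ^ 3 + B * s2 + s2 ^ 2) * |t| ^ 3) := by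
  set E : ℝ := Real.exp (-(s2 * t ^ 2 / 2)) with hE
  have hE1 : ‖(E : ℂ)‖ ≤ 1 := by
    rw [Complex.norm_real, Real.norm_eq_abs, abs_of_pos (Real.exp_pos _)]
    rw [Real.exp_le_one_iff]
    have := M.hs
    have : 0 ≤ s2 * t ^ 2 / 2 := by positivity
    linarith
  set K := (5 * B ^ 3 + B * s2 + s2 ^ 2) * |t| ^ 3
  have hstep := phit_step M ht
  have h1 : ‖(At P f t ^ n) (phit α β t) - (E ^ n : ℂ) • phit α β t‖ ≤ n * K := by
    induction n with
    | zero => simp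
    | succ n ih =>
      have e : (At P f t ^ (n + 1)) (phit α β t) - (E ^ (n + 1) : ℂ) • phit α β t =
          (At P f t ^ n) (At P f t (phit α β t) - (E : ℂ) • phit α β t) +
          (E : ℂ) • ((At P f t ^ n) (phit α β t) - (E ^ n : ℂ) • phit α β t) := by
        rw [pow_succ, mul_apply_eq_comp, map_sub, map_smul, smul_sub, smul_smul, pow_succ' (E : ℂ)]
        abel
      rw [e]
      refine (norm_add_le _ _).trans ?_
      have a1 : ‖(At P f t ^ n) (At P f t (phit α β t) - (E : ℂ) • phit α β t)‖ ≤ K := by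
        refine (ContinuousLinearMap.le_opNorm _ _).trans ?_
        have := At_pow_norm (f := f) M.nonneg M.rowSum t n
        calc _ ≤ 1 * K := by gcongr
          _ = K := one_mul _
      have a2 : ‖(E : ℂ) • ((At P f t ^ n) (phit α β t) - (E ^ n : ℂ) • phit α β t)‖ ≤ n * K := by
        rw [norm_smul]
        calc _ ≤ 1 * (n * K) := by gcongr
          _ = _ := one_mul _
      have e5 : ((n + 1 : ℕ) : ℝ) * K = n * K + K := by push_cast; ring
      rw [e5]; linarith
  have hp := phit_one M ht
  have e : (At P f t ^ n) (fun _ => 1) - (E ^ n : ℂ) • (fun _ => 1 : X → ℂ) =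
      ((At P f t ^ n) (phit α β t) - (E ^ n : ℂ) • phit α β t) +
      ((E ^ n : ℂ) • (phit α β t - fun _ => 1) - (At P f t ^ n) (phit α β t - fun _ => 1)) := by
    rw [map_sub, smul_sub]; abel
  rw [e]
  refine (norm_add_le _ _).trans ?_
  have a1 : ‖(E ^ n : ℂ) • (phit α β t - fun _ => 1)‖ ≤ 2 * B * |t| := by
    rw [norm_smul, norm_pow]
    calc _ ≤ 1 * (2 * B * |t|) := by
          gcongr
          exact pow_le_one₀ (norm_nonneg _) hE1
      _ = _ := one_mul _
  have a2 : ‖(At P f t ^ n) (phit α β t - fun _ => 1)‖ ≤ 2 * B * |t| := by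
    refine (ContinuousLinearMap.le_opNorm _ _).trans ?_
    have := At_pow_norm (f := f) M.nonneg M.rowSum t n
    calc _ ≤ 1 * (2 * B * |t|) := by gcongr
      _ = _ := one_mul _
  have := norm_sub_le ((E ^ n : ℂ) • (phit α β t - fun _ => 1))
    ((At P f t ^ n) (phit α β t - fun _ => 1))
  linarith

lemma At_diff (M : Mart P (fun _ x' => f x') α β s2 B) (t : ℝ) (k : ℕ) :
    ‖At P f t ^ k - At P f 0 ^ k‖ ≤ k * (B * |t|) := by
  have h1 : ‖At P f t - At P f 0‖ ≤ B * |t| := by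
    have := M.hB
    refine ContinuousLinearMap.opNorm_le_bound _ (by positivity) fun φ => ?_
    rw [pi_norm_le_iff_of_nonneg (by positivity)]
    intro x
    rw [sub_apply, Pi.sub_apply, At_apply, At_apply, ← Finset.sum_sub_distrib]
    have e2 : B * |t| * ‖φ‖ = ∑ x', P x x' * (B * |t| * ‖φ‖) := by
      rw [← Finset.sum_mul, M.rowSum, one_mul]
    rw [e2]
    refine (norm_sum_le _ _).trans (Finset.sum_le_sum fun x' _ => ?_)
    rw [← sub_mul, ← mul_sub, norm_mul, norm_mul, Complex.norm_real, Real.norm_eq_abs,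
      abs_of_nonneg (M.nonneg _ _), mul_assoc]
    refine mul_le_mul_of_nonneg_left ?_ (M.nonneg _ _)
    have h2 : ‖Complex.exp (Complex.I * (t : ℂ) * (f x' : ℂ)) -
        Complex.exp (Complex.I * ((0 : ℝ) : ℂ) * (f x' : ℂ))‖ ≤ B * |t| := by
      have := Real.norm_exp_I_mul_ofReal_sub_one_le (x := t * f x')
      have e3 : Complex.I * (t : ℂ) * (f x' : ℂ) = Complex.I * ((t * f x' : ℝ) : ℂ) := by
        push_cast; ring
      rw [e3]
      simp only [Complex.ofReal_zero, mul_zero, zero_mul, Complex.exp_zero]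
      refine this.trans ?_
      rw [Real.norm_eq_abs, abs_mul, mul_comm]
      exact mul_le_mul_of_nonneg_right (M.hw x' x') (abs_nonneg _)
    exact mul_le_mul h2 (norm_le_pi_norm _ _) (norm_nonneg _) (by positivity)
  induction k with
  | zero => simp
  | succ k ih =>
    have e : At P f t ^ (k + 1) - At P f 0 ^ (k + 1) =
        (At P f t ^ k - At P f 0 ^ k) * At P f t + At P f 0 ^ k * (At P f t - At P f 0) := by
      rw [pow_succ, pow_succ, sub_mul, mul_sub]; abel
    rw [e]
    have a := At_norm (f := f) M.nonneg M.rowSum t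
    have b := At_pow_norm (f := f) M.nonneg M.rowSum 0 k
    calc _ ≤ ‖At P f t ^ k - At P f 0 ^ k‖ * ‖At P f t‖ +
          ‖At P f 0 ^ k‖ * ‖At P f t - At P f 0‖ :=
          (norm_add_le _ _).trans (add_le_add (norm_mul_le _ _) (norm_mul_le _ _))
      _ ≤ (k * (B * |t|)) * 1 + 1 * (B * |t|) := by
          have := M.hB
          gcongr
      _ = _ := by push_cast; ring

/-- Main small-frequency estimate. -/
lemma At_main (hS : IsStochastic P ν) (h1 : Primitive P)
    (M : Mart P (fun _ x' => f x') α β s2 B) :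
    ∃ C ρ : ℝ, 0 < C ∧ 0 < ρ ∧ ρ < 1 ∧ ∀ t : ℝ, |t| ≤ 1 / B → ∀ (n k : ℕ) (ψ : X → ℂ),
      ‖(At P f t ^ (n + k)) ψ -
        ((Real.exp (-(s2 * t ^ 2 / 2)) ^ n : ℂ) * ∑ x, ψ x * ν x) • (fun _ => 1 : X → ℂ)‖ ≤
      C * (ρ ^ k + k * |t| + |t| + n * |t| ^ 3) * ‖ψ‖ := by
  obtain ⟨C, ρ, hC, hρ, hρ1, hg⟩ := gap hS h1
  have hB := M.hB
  have hs := M.hs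
  set D := 5 * B ^ 3 + B * s2 + s2 ^ 2 with hD
  have hD0 : 0 < D := by positivity
  refine ⟨Fintype.card X * C + 4 * B + D, ρ, by positivity, hρ, hρ1, fun t ht n k ψ => ?_⟩
  have ht0 := abs_nonneg t
  set E : ℝ := Real.exp (-(s2 * t ^ 2 / 2)) with hE
  set m : ℂ := ∑ x, ψ x * ν x with hm
  have hm1 : ‖m‖ ≤ ‖ψ‖ := by
    have : ‖ψ‖ = ∑ x, ‖ψ‖ * ν x := by rw [← Finset.mul_sum, hS.nuSum, mul_one]
    rw [this]
    refine (norm_sum_le _ _).trans (Finset.sum_le_sum fun x' _ => ?_)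
    rw [norm_mul, Complex.norm_real, Real.norm_eq_abs, abs_of_pos (hS.nuPos _)]
    exact mul_le_mul_of_nonneg_right (norm_le_pi_norm _ _) (hS.nuPos _).le
  have b1 : ‖(At P f t ^ k) ψ - (At P f 0 ^ k) ψ‖ ≤ k * (B * |t|) * ‖ψ‖ := by
    rw [← sub_apply]
    exact (ContinuousLinearMap.le_opNorm _ _).trans
      (mul_le_mul_of_nonneg_right (At_diff M t k) (norm_nonneg _))
  have b2 : ‖(At P f 0 ^ k) ψ - m • (fun _ => 1 : X → ℂ)‖ ≤
      Fintype.card X * C * ρ ^ k * ‖ψ‖ := by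
    rw [pi_norm_le_iff_of_nonneg (by positivity)]
    intro x
    have e : ((At P f 0 ^ k) ψ - m • (fun _ => 1 : X → ℂ)) x =
        ∑ x', ((kpow P k x x' - ν x' : ℝ) : ℂ) * ψ x' := by
      simp only [Pi.sub_apply, Pi.smul_apply, smul_eq_mul, mul_one, At_zero_pow, hm]
      rw [← Finset.sum_sub_distrib]
      refine Finset.sum_congr rfl fun _ _ => by push_cast; ring
    rw [e]
    have e2 : Fintype.card X * C * ρ ^ k * ‖ψ‖ = ∑ _x' : X, (C * ρ ^ k * 1) * ‖ψ‖ := by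
      rw [Finset.sum_const, Finset.card_univ, nsmul_eq_mul]; ring
    rw [e2]
    refine (norm_sum_le _ _).trans (Finset.sum_le_sum fun x' _ => ?_)
    rw [norm_mul, Complex.norm_real, Real.norm_eq_abs]
    refine mul_le_mul ?_ (norm_le_pi_norm _ _) (norm_nonneg _) (by positivity)
    have := hg (fun z => (if z = x' then 1 else 0) - ν x') ?_ 1 ?_ k x
    · simp only [mul_sub, Finset.sum_sub_distrib, ← Finset.sum_mul, kpow_row hS] at this
      simpa using this
    · simp only [sub_mul, Finset.sum_sub_distrib, ← Finset.mul_sum, hS.nuSum]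
      simp
    · intro z
      have h1 := nu_le_one hS x'
      have h2 := (hS.nuPos x').le
      split_ifs <;> rw [abs_le] <;> constructor <;> linarith
  have b3 := At_one M ht n
  have e : (At P f t ^ (n + k)) ψ - ((E ^ n : ℂ) * m) • (fun _ => 1 : X → ℂ) =
      (At P f t ^ n) (((At P f t ^ k) ψ - (At P f 0 ^ k) ψ) +
        ((At P f 0 ^ k) ψ - m • (fun _ => 1 : X → ℂ))) +
      m • ((At P f t ^ n) (fun _ => 1) - (E ^ n : ℂ) • (fun _ => 1 : X → ℂ)) := by
    rw [sub_add_sub_cancel, map_sub, map_smul, smul_sub, smul_smul, pow_add, mul_apply_eq_comp,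
      mul_comm m]
    abel
  rw [e]
  have a := At_pow_norm (f := f) M.nonneg M.rowSum t n
  calc _ ≤ 1 * (k * (B * |t|) * ‖ψ‖ + Fintype.card X * C * ρ ^ k * ‖ψ‖) +
        ‖ψ‖ * (4 * B * |t| + n * (D * |t| ^ 3)) := by
        refine (norm_add_le _ _).trans (add_le_add ?_ ?_)
        · refine (ContinuousLinearMap.le_opNorm _ _).trans ?_
          gcongr
          exact (norm_add_le _ _).trans (add_le_add b1 b2)
        · rw [norm_smul]; gcongr
    _ = (Fintype.card X * C * ρ ^ k + B * (k * |t|) + 4 * B * |t| + D * (n * |t| ^ 3)) * ‖ψ‖ := by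
        ring
    _ ≤ _ := by
        refine mul_le_mul_of_nonneg_right ?_ (norm_nonneg _)
        have c1 : (0 : ℝ) ≤ Fintype.card X * C := by positivity
        have c2 : 0 ≤ ρ ^ k := by positivity
        have c3 : 0 ≤ k * |t| := by positivity
        have c4 : 0 ≤ n * |t| ^ 3 := by positivity
        have c5 : 0 ≤ B := by linarith
        nlinarith [mul_nonneg c1 c3, mul_nonneg c1 ht0, mul_nonneg c1 c4, mul_nonneg c5 c2,
          mul_nonneg c5 c3, mul_nonneg c5 c4, mul_nonneg hD0.le c2, mul_nonneg hD0.le c3,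
          mul_nonneg hD0.le ht0]

end

section
variable [Fintype X] [DecidableEq X] {P : X → X → ℝ} {ν f : X → ℝ} {α β : X → ℝ} {s2 B : ℝ}

lemma exists_eigen [Nonempty X] (a : (X → ℂ) →L[ℂ] (X → ℂ)) {k : ℂ} (hk : k ∈ spectrum ℂ a) :
    ∃ φ : X → ℂ, φ ≠ 0 ∧ a φ = k • φ := by
  by_contra hcon
  push Not at hcon
  apply hk
  rw [spectrum.mem_resolventSet_iff, ContinuousLinearMap.isUnit_iff_bijective]
  have inj : Function.Injective (algebraMap ℂ ((X → ℂ) →L[ℂ] (X → ℂ)) k - a) := by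
    rw [injective_iff_map_eq_zero]
    intro φ h
    by_contra h0
    apply hcon φ h0
    rw [sub_apply, sub_eq_zero] at h
    rw [← h]; simp [Algebra.algebraMap_eq_smul_one]
  refine ⟨inj, ?_⟩
  exact (LinearMap.injective_iff_surjective
    (f := ((algebraMap ℂ ((X → ℂ) →L[ℂ] (X → ℂ)) k - a : (X → ℂ) →L[ℂ] (X → ℂ)) :
      (X → ℂ) →ₗ[ℂ] (X → ℂ)))).mp inj

lemma At_pow_norm_apply (hS : IsStochastic P ν) (t : ℝ) (n : ℕ) (φ : X → ℂ) (x : X) :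
    ‖(At P f t ^ n) φ x‖ ≤ ∑ x', kpow P n x x' * ‖φ x'‖ := by
  induction n generalizing x with
  | zero => simp [kpow]
  | succ n ih =>
    rw [pow_succ', mul_apply_eq_comp]
    refine (At_norm_apply hS.nonneg t _ x).trans ?_
    simp only [kpow, Finset.sum_mul]
    rw [Finset.sum_comm]
    refine Finset.sum_le_sum fun y _ => ?_
    refine (mul_le_mul_of_nonneg_left (ih y) (hS.nonneg x y)).trans (le_of_eq ?_)
    rw [Finset.mul_sum]
    refine Finset.sum_congr rfl fun _ _ => by ring

/-- no unimodular eigenvalue away from zero -/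
lemma eigen_contra [Nonempty X] (hS : IsStochastic P ν) (h1 : Primitive P) (h3 : NonLattice P f)
    {t : ℝ} (ht : t ≠ 0) {φ : X → ℂ} (hφ : φ ≠ 0) {k : ℂ} (hk : 1 ≤ ‖k‖)
    (he : At P f t φ = k • φ) : False := by
  obtain ⟨k₀, hk₀, hpos⟩ := h1
  obtain ⟨x₀, hx₀⟩ := Finite.exists_max (fun x => ‖φ x‖)
  have hc : 0 < ‖φ x₀‖ := by
    obtain ⟨x, hx⟩ := Function.ne_iff.mp hφ
    exact lt_of_lt_of_le (norm_pos_iff.mpr hx) (hx₀ x)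
  have hpow : ∀ n, (At P f t ^ n) φ = k ^ n • φ := by
    intro n
    induction n with
    | zero => simp
    | succ n ih => rw [pow_succ, mul_apply_eq_comp, he, map_smul, ih, smul_smul, pow_succ']
  have hall : ∀ x, ‖φ x‖ = ‖φ x₀‖ := by
    by_contra hcon
    push Not at hcon
    obtain ⟨x₁, hx₁⟩ := hcon
    have h := At_pow_norm_apply (f := f) hS t k₀ φ x₀
    rw [hpow, Pi.smul_apply, norm_smul, norm_pow] at h
    have h2 : ∑ x', kpow P k₀ x₀ x' * ‖φ x'‖ < ∑ x', kpow P k₀ x₀ x' * ‖φ x₀‖ := by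
      refine Finset.sum_lt_sum (fun x' _ => mul_le_mul_of_nonneg_left (hx₀ x') (hpos _ _).le)
        ⟨x₁, Finset.mem_univ _, mul_lt_mul_of_pos_left (lt_of_le_of_ne (hx₀ x₁) hx₁) (hpos _ _)⟩
    rw [← Finset.sum_mul, kpow_row hS, one_mul] at h2
    have h4 : 1 ≤ ‖k‖ ^ k₀ := one_le_pow₀ hk
    nlinarith
  have hk1 : ‖k‖ = 1 := by
    refine le_antisymm ?_ hk
    have h := At_norm_apply (f := f) hS.nonneg t φ x₀
    rw [he, Pi.smul_apply, norm_smul] at h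
    simp only [hall, ← Finset.sum_mul, hS.rowSum] at h
    nlinarith
  have hφne : ∀ x, φ x ≠ 0 := fun x => by rw [← norm_pos_iff, hall]; exact hc
  have hkne : k ≠ 0 := by rw [← norm_pos_iff, hk1]; exact one_pos
  have hedge : ∀ x x', 0 < P x x' →
      Complex.exp (Complex.I * (t : ℂ) * (f x' : ℂ)) * φ x' = k * φ x := by
    intro x x' hp
    set z : X → ℂ := fun x' => Complex.exp (Complex.I * (t : ℂ) * (f x' : ℂ)) * φ x' / (k * φ x)
      with hz
    have hzn : ∀ x', ‖z x'‖ = 1 := fun x' => by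
      rw [hz]; simp only [norm_div, norm_mul, norm_expI, hk1, hall, one_mul]
      exact div_self hc.ne'
    have hsum : ∑ x', (P x x' : ℂ) * z x' = 1 := by
      have := congrFun he x
      rw [At_apply, Pi.smul_apply, smul_eq_mul] at this
      simp only [hz, ← mul_div_assoc, ← Finset.sum_div, ← mul_assoc]
      rw [this, div_self (mul_ne_zero hkne (hφne x))]
    have hre : ∑ x', P x x' * (1 - (z x').re) = 0 := by
      have := congrArg Complex.re hsum
      simp only [Complex.re_sum, Complex.re_ofReal_mul, Complex.one_re] at this
      simp only [mul_sub, Finset.sum_sub_distrib, this, mul_one, hS.rowSum, sub_self]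
    have hle : ∀ x', (z x').re ≤ 1 := fun x' => (Complex.re_le_norm _).trans (hzn x').le
    have h0 := (Finset.sum_eq_zero_iff_of_nonneg (fun x' _ =>
      mul_nonneg (hS.nonneg x x') (sub_nonneg.mpr (hle x')))).mp hre x' (Finset.mem_univ _)
    have hre1 : (z x').re = 1 := by
      rcases mul_eq_zero.mp h0 with h | h
      · exact absurd h hp.ne'
      · linarith
    have hz1 : z x' = 1 := by
      have hn := hzn x'
      have h5 : ‖z x'‖ ^ 2 = (z x').re * (z x').re + (z x').im * (z x').im := by
        rw [Complex.sq_norm, Complex.normSq_apply]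
      rw [hn, hre1] at h5
      have him : (z x').im = 0 := by nlinarith
      exact Complex.ext (by simpa using hre1) (by simpa using him)
    rw [hz] at hz1
    simp only at hz1
    rwa [div_eq_one_iff_eq (mul_ne_zero hkne (hφne x))] at hz1
  obtain ⟨n, g, hp, hm⟩ := h3 (Complex.arg k / t) (2 * π / t)
  have hpi : ∀ i, 0 < P (g i) (g (i + 1)) := by
    intro i
    refine lt_of_le_of_ne (hS.nonneg _ _) fun h => hp.ne' ?_
    exact Finset.prod_eq_zero (Finset.mem_univ i) h.symm
  have hprod : ∏ i, (Complex.exp (Complex.I * (t : ℂ) * (f (g (i + 1)) : ℂ)) * φ (g (i + 1))) =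
      ∏ i, (k * φ (g i)) := Finset.prod_congr rfl fun i _ => hedge _ _ (hpi i)
  have hcyc : ∀ F : Fin (n + 1) → ℂ, ∏ i, F (i + 1) = ∏ i, F i := fun F =>
    Equiv.prod_comp (Equiv.addRight (1 : Fin (n + 1))) F
  rw [hcyc (fun i => Complex.exp (Complex.I * (t : ℂ) * (f (g i) : ℂ)) * φ (g i)),
    Finset.prod_mul_distrib, Finset.prod_mul_distrib,
    mul_left_inj' (Finset.prod_ne_zero_iff.mpr fun i _ => hφne _), Finset.prod_const,
    Finset.card_univ, Fintype.card_fin, ← Complex.exp_sum, ← Finset.mul_sum] at hprod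
  have hk' : k ^ (n + 1) = Complex.exp ((n + 1 : ℂ) * (Complex.arg k * Complex.I)) := by
    have : k = Complex.exp (Complex.arg k * Complex.I) := by
      have := Complex.norm_mul_exp_arg_mul_I k
      rw [hk1, Complex.ofReal_one, one_mul] at this
      exact this.symm
    conv_lhs => rw [this]
    rw [← Complex.exp_nat_mul]
    push_cast; rfl
  rw [hk', Complex.exp_eq_exp_iff_exists_int] at hprod
  obtain ⟨j, hj⟩ := hprod
  apply hm j
  have hj2 : t * ∑ i, f (g i) = (n + 1) * Complex.arg k + j * (2 * π) := by
    have h6 : Complex.I * ((t * ∑ i, f (g i) : ℝ) : ℂ) =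
        Complex.I * (((n + 1) * Complex.arg k + j * (2 * π) : ℝ) : ℂ) := by
      push_cast
      rw [← mul_assoc, hj]; ring
    exact_mod_cast mul_left_cancel₀ Complex.I_ne_zero h6
  field_simp
  linarith

lemma At_decay_pt [Nonempty X] (hS : IsStochastic P ν) (h1 : Primitive P) (h3 : NonLattice P f)
    {t : ℝ} (ht : t ≠ 0) : ∃ n : ℕ, 1 ≤ n ∧ ‖At P f t ^ n‖ < 1 / 2 := by
  set a := At P f t with ha
  have hsr : spectralRadius ℂ a < 1 := by
    by_contra hcon
    push Not at hcon
    obtain ⟨k, hk, hk2⟩ := spectrum.exists_nnnorm_eq_spectralRadius a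
    rw [← hk2] at hcon
    obtain ⟨φ, h0, he⟩ := exists_eigen a hk
    exact eigen_contra hS h1 h3 ht h0 (by exact_mod_cast hcon) he
  obtain ⟨r, hr1, hr2⟩ := ENNReal.lt_iff_exists_nnreal_btwn.mp hsr
  have hr2' : (r : ℝ) < 1 := by exact_mod_cast hr2
  have ev := (spectrum.pow_nnnorm_pow_one_div_tendsto_nhds_spectralRadius a).eventually_lt_const hr1
  have ev2 := (tendsto_pow_atTop_nhds_zero_of_lt_one r.2 hr2').eventually_lt_const
    (show (0 : ℝ) < 1 / 2 by norm_num)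
  obtain ⟨n, hn1, hn2, hn3⟩ := (ev.and (ev2.and (eventually_ge_atTop 1))).exists
  refine ⟨n, hn3, lt_of_le_of_lt ?_ hn2⟩
  have hn0 : (0 : ℝ) < n := by exact_mod_cast hn3
  have := ENNReal.rpow_le_rpow hn1.le hn0.le
  rw [← ENNReal.rpow_mul, one_div_mul_cancel hn0.ne', ENNReal.rpow_one, ENNReal.rpow_natCast] at this
  exact_mod_cast this

lemma At_continuous (n : ℕ) : Continuous fun t => At P f t ^ n := by
  refine Continuous.pow ?_ n
  let L : Matrix X X ℂ →ₗ[ℂ] ((X → ℂ) →L[ℂ] (X → ℂ)) :=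
    { toFun := toCLM
      map_add' := fun A B => by ext; simp [toCLM]
      map_smul' := fun c A => by ext; simp [toCLM] }
  have hL : Continuous L := L.continuous_of_finiteDimensional
  have : Continuous fun t : ℝ => Pmat P f t := by
    refine continuous_matrix fun i j => ?_
    simp only [Pmat, Matrix.of_apply]
    fun_prop
  exact hL.comp this

end

section
variable [Fintype X] [DecidableEq X] {P : X → X → ℝ} {ν f : X → ℝ} {α β : X → ℝ} {s2 B : ℝ}

lemma At_decay_small (hS : IsStochastic P ν) (h1 : Primitive P)
    (M : Mart P (fun _ x' => f x') α β s2 B) :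
    ∃ A t0 : ℝ, 0 < A ∧ 0 < t0 ∧ ∀ t : ℝ, t ≠ 0 → |t| ≤ t0 →
      ∃ n : ℕ, 1 ≤ n ∧ (n : ℝ) ≤ A / t ^ 2 ∧ ‖At P f t ^ n‖ ≤ 1 / 2 := by
  obtain ⟨C, ρ, hC, hρ, hρ1, H⟩ := At_main hS h1 M
  obtain ⟨k, hk⟩ := exists_pow_lt_of_lt_one (show (0:ℝ) < 1 / (16 * C) by positivity) hρ1
  have hB := M.hB
  have hs := M.hs
  set a : ℝ := 6 / s2 with ha
  have ha0 : 0 < a := by positivity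
  refine ⟨a + 1 + k, min (min 1 (1 / B)) (min (1 / (16 * C * (k + 1))) (1 / (16 * C * (a + 1)))),
    by positivity, by positivity, ?_⟩
  intro t ht0 ht
  have hb1 : |t| ≤ 1 := ht.trans ((min_le_left _ _).trans (min_le_left _ _))
  have hb2 : |t| ≤ 1 / B := ht.trans ((min_le_left _ _).trans (min_le_right _ _))
  have hb3 : |t| ≤ 1 / (16 * C * (k + 1)) := ht.trans ((min_le_right _ _).trans (min_le_left _ _))
  have hb4 : |t| ≤ 1 / (16 * C * (a + 1)) := ht.trans ((min_le_right _ _).trans (min_le_right _ _))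
  have ht2 : 0 < t ^ 2 := by positivity
  have ht21 : t ^ 2 ≤ 1 := by rw [← sq_abs]; exact pow_le_one₀ (abs_nonneg _) hb1
  set n := ⌈a / t ^ 2⌉₊ with hn
  have hn1 : a / t ^ 2 ≤ n := Nat.le_ceil _
  have hn2 : (n : ℝ) ≤ a / t ^ 2 + 1 := (Nat.ceil_lt_add_one (by positivity)).le
  have hn3 : (n : ℝ) ≤ (a + 1) / t ^ 2 := by
    rw [add_div]
    have : 1 ≤ 1 / t ^ 2 := by rw [le_div_iff₀ ht2]; linarith
    linarith
  have hnpos : 1 ≤ n := Nat.one_le_ceil_iff.mpr (by positivity)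
  refine ⟨n + k, by omega, ?_, ?_⟩
  · push_cast
    have : (k : ℝ) ≤ k / t ^ 2 := by
      rw [le_div_iff₀ ht2]; nlinarith [(Nat.cast_nonneg k : (0:ℝ) ≤ k)]
    rw [add_div]; linarith
  refine ContinuousLinearMap.opNorm_le_bound _ (by norm_num) fun ψ => ?_
  have h := H t hb2 n k ψ
  have hnu : ‖((Real.exp (-(s2 * t ^ 2 / 2)) ^ n : ℂ) * ∑ x, ψ x * ν x) • (fun _ : X => (1:ℂ))‖
      ≤ 1 / 4 * ‖ψ‖ := by
    rw [norm_smul, norm_mul]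
    have e1 : ‖(Real.exp (-(s2 * t ^ 2 / 2)) ^ n : ℂ)‖ ≤ 1 / 4 := by
      rw [norm_pow, Complex.norm_real, Real.norm_of_nonneg (Real.exp_pos _).le, ← Real.exp_nat_mul]
      have : (n : ℝ) * -(s2 * t ^ 2 / 2) ≤ -3 := by
        have h5 : a / t ^ 2 * (s2 * t ^ 2 / 2) = 3 := by rw [ha]; field_simp; norm_num
        have := mul_le_mul_of_nonneg_right hn1 (show 0 ≤ s2 * t ^ 2 / 2 by positivity)
        linarith
      refine (Real.exp_le_exp.mpr this).trans ?_
      rw [Real.exp_neg, inv_eq_one_div]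
      refine one_div_le_one_div_of_le (by norm_num) ?_
      have := Real.add_one_le_exp 3; linarith
    have e2 : ‖∑ x, ψ x * (ν x : ℂ)‖ ≤ ‖ψ‖ := by
      refine (norm_sum_le _ _).trans ?_
      calc ∑ x, ‖ψ x * (ν x : ℂ)‖ ≤ ∑ x, ‖ψ‖ * ν x := by
            refine Finset.sum_le_sum fun x _ => ?_
            rw [norm_mul, Complex.norm_real, Real.norm_of_nonneg (hS.nuPos x).le]
            exact mul_le_mul_of_nonneg_right (norm_le_pi_norm ψ x) (hS.nuPos x).le
        _ = ‖ψ‖ := by rw [← Finset.mul_sum, hS.nuSum, mul_one]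
    have e3 : ‖(fun _ : X => (1:ℂ))‖ ≤ 1 := by
      rw [pi_norm_le_iff_of_nonneg (by norm_num)]; intro; simp
    calc _ ≤ 1 / 4 * ‖ψ‖ * 1 := by gcongr
      _ = _ := by ring
  have e4 : C * (ρ ^ k + k * |t| + |t| + n * |t| ^ 3) ≤ 3 / 16 := by
    have c1 : C * ρ ^ k ≤ 1 / 16 := by
      have := mul_le_mul_of_nonneg_left hk.le hC.le
      refine this.trans (le_of_eq ?_); field_simp
    have c2 : C * ((k + 1) * |t|) ≤ 1 / 16 := by
      have := mul_le_mul_of_nonneg_left hb3 (show 0 ≤ C * (k + 1) by positivity)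
      rw [← mul_assoc]; refine this.trans (le_of_eq ?_); field_simp
    have c3 : C * (n * |t| ^ 3) ≤ 1 / 16 := by
      have d1 : (n : ℝ) * |t| ^ 3 ≤ (a + 1) * |t| := by
        have := mul_le_mul_of_nonneg_right hn3 (show 0 ≤ |t| ^ 3 by positivity)
        refine this.trans (le_of_eq ?_)
        rw [← sq_abs t]
        have : 0 < |t| := by positivity
        field_simp
      have := mul_le_mul_of_nonneg_left hb4 (show 0 ≤ C * (a + 1) by positivity)
      calc C * (n * |t| ^ 3) ≤ C * ((a + 1) * |t|) := by gcongr
        _ = C * (a + 1) * |t| := by ring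
        _ ≤ _ := this
        _ = _ := by field_simp
    linarith
  have h6 := mul_le_mul_of_nonneg_right e4 (norm_nonneg ψ)
  have h7 := norm_le_norm_add_norm_sub' ((At P f t ^ (n + k)) ψ)
    (((Real.exp (-(s2 * t ^ 2 / 2)) ^ n : ℂ) * ∑ x, ψ x * ν x) • (fun _ : X => (1:ℂ)))
  have := norm_nonneg ψ
  linarith

lemma At_decay [Nonempty X] (hS : IsStochastic P ν) (h1 : Primitive P) (h3 : NonLattice P f)
    (M : Mart P (fun _ x' => f x') α β s2 B) (lam : ℝ) :
    ∃ c : ℝ, 0 < c ∧ ∀ t : ℝ, |t| ≤ lam → ∀ n : ℕ,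
      ‖At P f t ^ n‖ ≤ 2 * Real.exp (-(c * n * t ^ 2)) := by
  obtain ⟨A, t0, hA, ht0, HA⟩ := At_decay_small hS h1 M
  -- compactness
  have hcomp : IsCompact {t : ℝ | t0 ≤ |t| ∧ |t| ≤ lam} := by
    have : {t : ℝ | t0 ≤ |t| ∧ |t| ≤ lam} = Set.Icc (-lam) lam ∩ {t : ℝ | t0 ≤ |t|} := by
      ext t; simp [abs_le, and_comm]
    rw [this]
    exact isCompact_Icc.inter_right (isClosed_le continuous_const continuous_abs)
  have hpt : ∀ t : ℝ, ∃ n : ℕ, t ≠ 0 → 1 ≤ n ∧ ‖At P f t ^ n‖ < 1 / 2 := by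
    intro t
    by_cases ht : t = 0
    · exact ⟨0, fun h => absurd ht h⟩
    · obtain ⟨n, hn⟩ := At_decay_pt hS h1 h3 ht
      exact ⟨n, fun _ => hn⟩
  choose N hN using hpt
  obtain ⟨S, hSs, hcov⟩ := hcomp.elim_nhds_subcover
    (fun t => {s : ℝ | t ≠ 0 → ‖At P f s ^ (N t)‖ < 1 / 2}) (by
      intro t _
      by_cases ht : t = 0
      · simp [ht]
      · have : {s : ℝ | t ≠ 0 → ‖At P f s ^ (N t)‖ < 1 / 2} =
            {s : ℝ | ‖At P f s ^ (N t)‖ < 1 / 2} := by ext s; simp [ht]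
        rw [this]
        exact (isOpen_lt (At_continuous (N t)).norm continuous_const).mem_nhds (hN t ht).2)
  set Nm : ℕ := ∑ t ∈ S, N t
  have hall : ∀ t : ℝ, t ≠ 0 → |t| ≤ lam → ∃ n : ℕ, 1 ≤ n ∧
      (n : ℝ) ≤ (A + Nm * lam ^ 2) / t ^ 2 ∧ ‖At P f t ^ n‖ ≤ 1 / 2 := by
    intro t ht htl
    have ht2 : 0 < t ^ 2 := by positivity
    rcases le_or_gt |t| t0 with h | h
    · obtain ⟨n, a, b, c⟩ := HA t ht h
      refine ⟨n, a, b.trans ?_, c⟩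
      gcongr; have : (0:ℝ) ≤ Nm * lam ^ 2 := by positivity
      linarith
    · have hm := hcov (show t ∈ {t : ℝ | t0 ≤ |t| ∧ |t| ≤ lam} from ⟨h.le, htl⟩)
      simp only [Set.mem_iUnion] at hm
      obtain ⟨s, hs, hts⟩ := hm
      have hs0 : s ≠ 0 := by
        have := (hSs s hs).1
        intro h; rw [h, abs_zero] at this; linarith
      refine ⟨N s, (hN s hs0).1, ?_, (hts hs0).le⟩
      have : (N s : ℝ) ≤ Nm := by
        exact_mod_cast Finset.single_le_sum (fun _ _ => Nat.zero_le _) hs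
      rw [le_div_iff₀ ht2]
      have : t ^ 2 ≤ lam ^ 2 := by rw [← sq_abs]; gcongr
      calc (N s : ℝ) * t ^ 2 ≤ Nm * lam ^ 2 := by gcongr
        _ ≤ _ := by linarith
  set A' := A + Nm * lam ^ 2
  have hA' : 0 < A' := by positivity
  refine ⟨Real.log 2 / A', div_pos (Real.log_pos (by norm_num)) hA', ?_⟩
  intro t ht n
  by_cases ht0 : t = 0
  · subst ht0
    have := At_pow_norm (f := f) hS.nonneg hS.rowSum 0 n
    simp; linarith
  obtain ⟨m, hm1, hm2, hm3⟩ := hall t ht0 ht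
  have ht2 : 0 < t ^ 2 := by positivity
  have key : ‖At P f t ^ n‖ ≤ (1 / 2) ^ (n / m) := by
    conv_lhs => rw [← Nat.div_add_mod n m, pow_add, pow_mul]
    refine (norm_mul_le _ _).trans ?_
    have a1 : ‖(At P f t ^ m) ^ (n / m)‖ ≤ (1 / 2) ^ (n / m) := by
      rcases Nat.eq_zero_or_pos (n / m) with h | h
      · rw [h]; simp only [pow_zero]
        have := At_pow_norm (f := f) hS.nonneg hS.rowSum t 0
        simpa using this
      · refine (norm_pow_le' _ h).trans ?_
        gcongr
    have a2 := At_pow_norm (f := f) hS.nonneg hS.rowSum t (n % m)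
    exact (mul_le_mul a1 a2 (norm_nonneg _) (by positivity)).trans (mul_one _).le
  refine key.trans ?_
  have hq : (n : ℝ) / m - 1 ≤ ((n / m : ℕ) : ℝ) := by
    have := Nat.lt_div_mul_add (a := n) (b := m) (by omega)
    have h' : (n : ℝ) < (n / m : ℕ) * m + m := by exact_mod_cast this
    have hm0 : (0:ℝ) < m := by exact_mod_cast hm1
    rw [sub_le_iff_le_add, div_le_iff₀ hm0]; linarith
  have hq2 : (n : ℝ) * t ^ 2 / A' ≤ n / m := by
    have hm0 : (0:ℝ) < m := by exact_mod_cast hm1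
    rw [le_div_iff₀ ht2] at hm2
    rw [div_le_div_iff₀ hA' hm0]
    nlinarith [(Nat.cast_nonneg n : (0:ℝ) ≤ n)]
  have hl : 0 < Real.log 2 := Real.log_pos (by norm_num)
  have e : ((1:ℝ) / 2) ^ (n / m) = Real.exp (-(Real.log 2 * (n / m : ℕ))) := by
    rw [mul_comm, ← mul_neg, Real.exp_nat_mul, Real.exp_neg, Real.exp_log (by norm_num)]; norm_num
  rw [e]
  have e2 : 2 * Real.exp (-(Real.log 2 / A' * n * t ^ 2)) =
      Real.exp (Real.log 2 + -(Real.log 2 / A' * n * t ^ 2)) := by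
    rw [Real.exp_add, Real.exp_log (by norm_num)]
  rw [e2]
  apply Real.exp_le_exp.mpr
  have : Real.log 2 / A' * n * t ^ 2 = Real.log 2 * (n * t ^ 2 / A') := by ring
  rw [this]
  nlinarith [mul_le_mul_of_nonneg_left (hq2.trans (sub_le_iff_le_add.mp hq)) hl.le]

end

section
variable [Fintype X] [DecidableEq X] {P : X → X → ℝ} {ν f : X → ℝ} {α β : X → ℝ} {s2 B : ℝ}

lemma At_lim (hS : IsStochastic P ν) (h1 : Primitive P)
    (M : Mart P (fun _ x' => f x') α β s2 B) (ψ : X → ℂ) (x : X) (s : ℝ) :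
    Tendsto (fun n : ℕ => (At P f (s / √(n:ℝ)) ^ n) ψ x) atTop
      (𝓝 ((Real.exp (-(s2 * s ^ 2 / 2)) : ℂ) * ∑ x, ψ x * ν x)) := by
  obtain ⟨C, ρ, hC, hρ, hρ1, H⟩ := At_main hS h1 M
  have hB := M.hB
  set m : ℂ := ∑ x, ψ x * ν x
  have hsq : Tendsto (fun n : ℕ => √(n:ℝ)) atTop atTop :=
    Real.tendsto_sqrt_atTop.comp tendsto_natCast_atTop_atTop
  have hinv : Tendsto (fun n : ℕ => (√(n:ℝ))⁻¹) atTop (𝓝 0) := tendsto_inv_atTop_zero.comp hsq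
  have ht : Tendsto (fun n : ℕ => |s / √(n:ℝ)|) atTop (𝓝 0) := by
    have := (hinv.const_mul s).abs
    simpa [div_eq_mul_inv] using this
  have ht3 : Tendsto (fun n : ℕ => (n:ℝ) * |s / √(n:ℝ)| ^ 3) atTop (𝓝 0) := by
    have : Tendsto (fun n : ℕ => |s| ^ 3 * (√(n:ℝ))⁻¹) atTop (𝓝 0) := by
      simpa using hinv.const_mul (|s| ^ 3)
    refine this.congr' ?_
    filter_upwards [eventually_gt_atTop 0] with n hn
    have hn' : (0:ℝ) < n := by exact_mod_cast hn
    have h2 : 0 < √(n:ℝ) := Real.sqrt_pos.mpr hn'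
    rw [abs_div, abs_of_pos h2]
    have := Real.sq_sqrt hn'.le
    nth_rewrite 2 [← this]
    field_simp
  rw [tendsto_iff_norm_sub_tendsto_zero, Metric.tendsto_atTop']
  intro ε hε
  obtain ⟨k, hk⟩ := exists_pow_lt_of_lt_one
    (show (0:ℝ) < ε / (C * (‖ψ‖ + 1)) by positivity) hρ1
  have he : Tendsto (fun n : ℕ => (n:ℝ)⁻¹) atTop (𝓝 0) := tendsto_inv_atTop_nhds_zero_nat
  have hexp : Tendsto (fun n : ℕ => Real.exp (-(s2 * s ^ 2 / 2) * (1 - k * (n:ℝ)⁻¹)) -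
      Real.exp (-(s2 * s ^ 2 / 2))) atTop (𝓝 0) := by
    have h1 : Tendsto (fun n : ℕ => -(s2 * s ^ 2 / 2) * (1 - k * (n:ℝ)⁻¹)) atTop
        (𝓝 (-(s2 * s ^ 2 / 2) * (1 - k * 0))) :=
      ((he.const_mul _).const_sub _).const_mul _
    have := ((Real.continuous_exp.tendsto _).comp h1).sub_const (Real.exp (-(s2 * s ^ 2 / 2)))
    simpa using this
  have hb : Tendsto (fun n : ℕ => C * (ρ ^ k + k * |s / √(n:ℝ)| + |s / √(n:ℝ)| +
      (n:ℝ) * |s / √(n:ℝ)| ^ 3) * ‖ψ‖ + |Real.exp (-(s2 * s ^ 2 / 2) * (1 - k * (n:ℝ)⁻¹)) -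
      Real.exp (-(s2 * s ^ 2 / 2))| * ‖m‖) atTop (𝓝 (C * ρ ^ k * ‖ψ‖)) := by
    have a1 := (((((ht.const_mul (k:ℝ)).const_add (ρ ^ k)).add ht).add ht3).const_mul C).mul_const ‖ψ‖
    have := a1.add (hexp.abs.mul_const ‖m‖)
    simpa using this
  have hlt : C * ρ ^ k * ‖ψ‖ < ε := by
    have h0 := norm_nonneg ψ
    rw [lt_div_iff₀ (by positivity)] at hk
    have : 0 < ρ ^ k * C := by positivity
    nlinarith
  have hev := (hb.eventually_lt_const hlt)
  have hev2 : ∀ᶠ n : ℕ in atTop, |s / √(n:ℝ)| ≤ 1 / B :=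
    (ht.eventually_lt_const (show (0:ℝ) < 1 / B by positivity)).mono fun _ h => h.le
  have hall := (hev.and hev2).and (eventually_ge_atTop (k + 1))
  obtain ⟨N, hN⟩ := eventually_atTop.mp hall
  refine ⟨N, fun n hn => ?_⟩
  obtain ⟨⟨h4, h5⟩, h6⟩ := hN n hn.le
  rw [Real.dist_eq, sub_zero, abs_of_nonneg (norm_nonneg _)]
  refine lt_of_le_of_lt ?_ h4
  have hn0 : (0:ℝ) < n := by exact_mod_cast (by omega : 0 < n)
  have h7 := H _ h5 (n - k) k ψ
  rw [Nat.sub_add_cancel (by omega)] at h7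
  have h8 := norm_le_pi_norm ((At P f (s / √(n:ℝ)) ^ n) ψ -
        ((Real.exp (-(s2 * (s / √(n:ℝ)) ^ 2 / 2)) ^ (n - k) : ℂ) * m) • (fun _ => 1 : X → ℂ)) x
  have h9 := h8.trans h7
  simp only [Pi.sub_apply, Pi.smul_apply, smul_eq_mul, mul_one] at h9
  have hexpE : Real.exp (-(s2 * (s / √(n:ℝ)) ^ 2 / 2)) ^ (n - k) =
      Real.exp (-(s2 * s ^ 2 / 2) * (1 - k * (n:ℝ)⁻¹)) := by
    rw [← Real.exp_nat_mul, div_pow, Real.sq_sqrt hn0.le, Nat.cast_sub (by omega)]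
    congr 1; field_simp
  have h10 : ‖((Real.exp (-(s2 * (s / √(n:ℝ)) ^ 2 / 2)) ^ (n - k) : ℂ) * m) -
      (Real.exp (-(s2 * s ^ 2 / 2)) : ℂ) * m‖ ≤
      |Real.exp (-(s2 * s ^ 2 / 2) * (1 - k * (n:ℝ)⁻¹)) - Real.exp (-(s2 * s ^ 2 / 2))| * ‖m‖ := by
    rw [← sub_mul, norm_mul, ← Complex.ofReal_pow, hexpE, ← Complex.ofReal_sub, Complex.norm_real,
      Real.norm_eq_abs]
  refine (norm_sub_le_norm_sub_add_norm_sub _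
    ((Real.exp (-(s2 * (s / √(n:ℝ)) ^ 2 / 2)) ^ (n - k) : ℂ) * m) _).trans ?_
  refine add_le_add (h9.trans ?_) h10
  have : ((n - k : ℕ) : ℝ) ≤ n := by exact_mod_cast Nat.sub_le _ _
  gcongr

/-- L1 convergence of rescaled, truncated characteristic functions. -/
lemma At_L1 [Nonempty X] (hS : IsStochastic P ν) (h1 : Primitive P) (h3 : NonLattice P f)
    (M : Mart P (fun _ x' => f x') α β s2 B) (ψ : X → ℂ) (x : X) {lam : ℝ} (hl : 0 < lam) :
    Tendsto (fun n : ℕ => ∫ s : ℝ,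
      ‖((max (1 - |s / √(n:ℝ)| / lam) 0 : ℝ) : ℂ) * (At P f (s / √(n:ℝ)) ^ n) ψ x -
        (Real.exp (-(s2 * s ^ 2 / 2)) : ℂ) * ∑ x, ψ x * ν x‖) atTop (𝓝 0) := by
  obtain ⟨c, hc, hdec⟩ := At_decay hS h1 h3 M lam
  have hs := M.hs
  set m : ℂ := ∑ x, ψ x * ν x
  have hsq : Tendsto (fun n : ℕ => √(n:ℝ)) atTop atTop :=
    Real.tendsto_sqrt_atTop.comp tendsto_natCast_atTop_atTop
  have hinv : Tendsto (fun n : ℕ => (√(n:ℝ))⁻¹) atTop (𝓝 0) := tendsto_inv_atTop_zero.comp hsq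
  refine Tendsto.mono_right (y := 𝓝 (∫ _ : ℝ, (0:ℝ))) ?_ (by simp)
  refine tendsto_integral_filter_of_dominated_convergence
    (fun s => 2 * ‖ψ‖ * Real.exp (-c * s ^ 2) + ‖m‖ * Real.exp (-(s2 / 2) * s ^ 2)) ?_ ?_ ?_ ?_
  · refine Eventually.of_forall fun n => ?_
    refine Continuous.aestronglyMeasurable ?_
    refine Continuous.norm ?_
    have e1 : Continuous fun s : ℝ => (At P f (s / √(n:ℝ)) ^ n) ψ x := by
      have := (At_continuous (P := P) (f := f) n).comp (continuous_id.div_const (√(n:ℝ)))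
      exact (continuous_apply x).comp (this.clm_apply continuous_const)
    have e2 : Continuous fun s : ℝ => (((max (1 - |s / √(n:ℝ)| / lam) 0 : ℝ)) : ℂ) := by fun_prop
    exact (e2.mul e1).sub (Continuous.mul (Complex.continuous_ofReal.comp (by fun_prop)) continuous_const)
  · filter_upwards [eventually_gt_atTop 0] with n hn
    refine Eventually.of_forall fun s => ?_
    have hn0 : (0:ℝ) < n := by exact_mod_cast hn
    rw [norm_norm]
    refine (norm_sub_le _ _).trans (add_le_add ?_ ?_)
    · rw [norm_mul, Complex.norm_real, Real.norm_of_nonneg (le_max_right _ _)]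
      have hx := norm_le_pi_norm ((At P f (s / √(n:ℝ)) ^ n) ψ) x
      have hop := (At P f (s / √(n:ℝ)) ^ n).le_opNorm ψ
      rcases le_or_gt |s / √(n:ℝ)| lam with h | h
      · have h5 := hdec _ h n
        have h6 : max (1 - |s / √(n:ℝ)| / lam) 0 ≤ 1 := by
          apply max_le _ (by norm_num)
          have : 0 ≤ |s / √(n:ℝ)| / lam := by positivity
          linarith
        have h7 : c * n * (s / √(n:ℝ)) ^ 2 = c * s ^ 2 := by
          rw [div_pow, Real.sq_sqrt hn0.le]; field_simp
        rw [h7] at h5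
        calc max (1 - |s / √(n:ℝ)| / lam) 0 * ‖(At P f (s / √(n:ℝ)) ^ n) ψ x‖
            ≤ 1 * ‖(At P f (s / √(n:ℝ)) ^ n) ψ x‖ := by gcongr
          _ ≤ ‖At P f (s / √(n:ℝ)) ^ n‖ * ‖ψ‖ := by rw [one_mul]; exact hx.trans hop
          _ ≤ 2 * Real.exp (-(c * s ^ 2)) * ‖ψ‖ := by gcongr
          _ = _ := by rw [neg_mul]; ring
      · have : 1 - |s / √(n:ℝ)| / lam ≤ 0 := by
          rw [sub_nonpos, le_div_iff₀ hl]; linarith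
        rw [max_eq_right this, zero_mul]; positivity
    · rw [norm_mul, Complex.norm_real, Real.norm_of_nonneg (Real.exp_pos _).le, mul_comm]
      apply le_of_eq; congr 2; ring
  · exact ((integrable_exp_neg_mul_sq hc).const_mul _).add
      ((integrable_exp_neg_mul_sq (by positivity)).const_mul _)
  · refine Eventually.of_forall fun s => ?_
    have h5 := At_lim hS h1 M ψ x s
    have h6 : Tendsto (fun n : ℕ => ((max (1 - |s / √(n:ℝ)| / lam) 0 : ℝ) : ℂ)) atTop (𝓝 1) := by
      have a1 : Tendsto (fun n : ℕ => max (1 - |s / √(n:ℝ)| / lam) 0) atTop (𝓝 1) := by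
        have a2 : Tendsto (fun n : ℕ => |s / √(n:ℝ)|) atTop (𝓝 0) := by
          have := (hinv.const_mul s).abs
          simpa [div_eq_mul_inv] using this
        have := ((a2.div_const lam).const_sub 1).max (tendsto_const_nhds (x := (0:ℝ)))
        simpa using this
      have := (Complex.continuous_ofReal.tendsto _).comp a1
      rw [Complex.ofReal_one] at this
      exact this
    have h7 := ((h6.mul h5).sub_const ((Real.exp (-(s2 * s ^ 2 / 2)) : ℂ) * m)).norm
    rw [one_mul, sub_self, norm_zero] at h7
    exact h7

end

section
variable [Fintype X] {P : X → X → ℝ} {w : X → X → ℝ} {mk : ℝ → ℝ}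

lemma Tm_pow_integral {S : Type*} [MeasurableSpace S] (μ : Measure S) (F : S → X → ℝ → ℝ)
    (hF : ∀ x u, Integrable (fun s => F s x u) μ) (n : ℕ) (x : X) (y : ℝ) :
    Integrable (fun s => (Tm P w mk ^ n) (F s) x y) μ ∧
    (Tm P w mk ^ n) (fun x u => ∫ s, F s x u ∂μ) x y = ∫ s, (Tm P w mk ^ n) (F s) x y ∂μ := by
  induction n generalizing x y with
  | zero => exact ⟨by simpa using hF x y, by simp⟩
  | succ n ih =>
    simp only [pow_succ', Module.End.mul_apply, Tm_apply]
    constructor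
    · exact integrable_finsetSum _ fun x' _ => (((ih x' _).1.const_mul _).const_mul _)
    · rw [integral_finsetSum _ fun x' _ => (((ih x' _).1.const_mul _).const_mul _)]
      refine Finset.sum_congr rfl fun x' _ => ?_
      rw [integral_const_mul, integral_const_mul, (ih x' _).2]

lemma Tm_pow_shift (g : X → ℝ → ℝ) (v : ℝ) (n : ℕ) (x : X) (y : ℝ) :
    (Tm P w mone ^ n) (fun x u => g x (u - v)) x y = (Tm P w mone ^ n) g x (y - v) := by
  induction n generalizing x y with
  | zero => simp
  | succ n ih =>
    simp only [pow_succ', Module.End.mul_apply, Tm_apply]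
    refine Finset.sum_congr rfl fun x' _ => ?_
    rw [ih]
    simp only [mone]
    rw [show y + w x x' - v = y - v + w x x' by ring]

end

section

noncomputable def tri (l t : ℝ) : ℝ := max (1 - |t| / l) 0
noncomputable def fej (l u : ℝ) : ℝ := ∫ t : ℝ, tri l t * Real.cos (t * u)

variable {l : ℝ}

lemma tri_cont : Continuous (tri l) := by unfold tri; fun_prop

lemma tri_nonneg (t : ℝ) : 0 ≤ tri l t := le_max_right _ _

lemma tri_zero (hl : 0 < l) {t : ℝ} (ht : l ≤ |t|) : tri l t = 0 := by
  unfold tri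
  apply max_eq_right
  rw [sub_nonpos, le_div_iff₀ hl]; linarith

lemma tri_le (hl : 0 < l) (t : ℝ) : tri l t ≤ 1 := by
  unfold tri
  apply max_le _ (by norm_num)
  have : 0 ≤ |t| / l := by positivity
  linarith

lemma tri_supp (hl : 0 < l) : HasCompactSupport (tri l) := by
  refine HasCompactSupport.intro (isCompact_Icc (a := -l) (b := l)) fun t ht => tri_zero hl ?_
  by_contra h
  exact ht (by rw [Set.mem_Icc, ← abs_le]; linarith)

lemma tri_int (hl : 0 < l) : Integrable (tri l) := tri_cont.integrable_of_hasCompactSupport (tri_supp hl)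

lemma tri_mul_int (hl : 0 < l) {g : ℝ → ℝ} (hg : Continuous g) : Integrable (fun t => tri l t * g t) :=
  (tri_cont.mul hg).integrable_of_hasCompactSupport (tri_supp hl).mul_right

lemma fej_half (hl : 0 < l) (u : ℝ) :
    fej l u = 2 * ∫ t in (0:ℝ)..l, (1 - t / l) * Real.cos (t * u) := by
  have h1 : fej l u = ∫ t : ℝ, (fun s => max (1 - s / l) 0 * Real.cos (s * u)) |t| := by
    unfold fej tri
    congr 1; ext t
    simp only
    congr 1
    rcases abs_cases t with h | h
    · rw [h.1]
    · rw [h.1, neg_mul, Real.cos_neg]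
  rw [h1, integral_comp_abs (f := fun s => max (1 - s / l) 0 * Real.cos (s * u))]
  congr 1
  rw [intervalIntegral.integral_of_le hl.le]
  rw [setIntegral_eq_of_subset_of_forall_diff_eq_zero measurableSet_Ioi
    (s := Set.Ioc 0 l) (fun x hx => hx.1)]
  · refine setIntegral_congr_fun measurableSet_Ioc fun t ht => ?_
    rw [max_eq_left]
    rw [sub_nonneg, div_le_one hl]; exact ht.2
  · intro t ht
    have : l < t := by
      by_contra h
      exact ht.2 ⟨ht.1, by linarith⟩
    rw [max_eq_right, zero_mul]
    rw [sub_nonpos, le_div_iff₀ hl]; linarith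

lemma fej_eq (hl : 0 < l) {u : ℝ} (hu : u ≠ 0) :
    fej l u = 2 * (1 - Real.cos (l * u)) / (l * u ^ 2) := by
  rw [fej_half hl]
  have : ∫ t in (0:ℝ)..l, (1 - t / l) * Real.cos (t * u) =
      ((1 - l / l) * Real.sin (l * u) / u - Real.cos (l * u) / (l * u ^ 2)) -
      ((1 - 0 / l) * Real.sin (0 * u) / u - Real.cos (0 * u) / (l * u ^ 2)) := by
    refine intervalIntegral.integral_eq_sub_of_hasDerivAt
      (f := fun t => (1 - t / l) * Real.sin (t * u) / u - Real.cos (t * u) / (l * u ^ 2)) ?_ ?_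
    · intro t _
      have a1 : HasDerivAt (fun t : ℝ => t * u) u t := by simpa using (hasDerivAt_id t).mul_const u
      have a2 : HasDerivAt (fun t : ℝ => 1 - t / l) (-(1 / l)) t := by
        simpa using ((hasDerivAt_id t).div_const l).const_sub 1
      have := ((a2.mul a1.sin).div_const u).sub (a1.cos.div_const (l * u ^ 2))
      refine this.congr_deriv ?_
      field_simp
      ring
    · exact (by fun_prop : Continuous fun t : ℝ => (1 - t / l) * Real.cos (t * u)).intervalIntegrable _ _
  rw [this]
  simp
  field_simp
  ring

lemma fej_zero (hl : 0 < l) : fej l 0 = l := by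
  rw [fej_half hl]
  simp only [mul_zero, Real.cos_zero, mul_one]
  rw [intervalIntegral.integral_sub (by simp) (by
    exact (by fun_prop : Continuous fun t : ℝ => t / l).intervalIntegrable _ _)]
  simp
  field_simp
  ring

lemma fej_nonneg (hl : 0 < l) (u : ℝ) : 0 ≤ fej l u := by
  rcases eq_or_ne u 0 with rfl | hu
  · rw [fej_zero hl]; exact hl.le
  · rw [fej_eq hl hu]
    have := Real.cos_le_one (l * u)
    apply div_nonneg <;> [linarith; positivity]

lemma fej_le (hl : 0 < l) {u : ℝ} (hu : u ≠ 0) : fej l u ≤ 4 / (l * u ^ 2) := by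
  rw [fej_eq hl hu]
  have := Real.neg_one_le_cos (l * u)
  gcongr; linarith

lemma fej_le_l (hl : 0 < l) (u : ℝ) : fej l u ≤ l := by
  refine le_trans ?_ (fej_zero hl).le
  unfold fej
  refine integral_mono (tri_mul_int hl (g := fun t => Real.cos (t * u)) (by fun_prop))
    (tri_mul_int hl (g := fun t => Real.cos (t * 0)) (by fun_prop)) fun t => ?_
  simp only [mul_zero, Real.cos_zero]
  exact mul_le_mul_of_nonneg_left (Real.cos_le_one _) (tri_nonneg t)

lemma fej_cont (hl : 0 < l) : Continuous (fej l) := by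
  unfold fej
  refine continuous_of_dominated (bound := tri l) ?_ ?_ (tri_int hl) ?_
  · intro u
    exact (tri_cont.mul (Real.continuous_cos.comp (continuous_mul_const u))).aestronglyMeasurable
  · intro u; refine Eventually.of_forall fun t => ?_
    rw [norm_mul, Real.norm_of_nonneg (tri_nonneg t)]
    exact mul_le_of_le_one_right (tri_nonneg t) (Real.abs_cos_le_one _)
  · refine Eventually.of_forall fun t => ?_
    fun_prop

lemma fej_le2 (hl : 0 < l) (u : ℝ) : fej l u ≤ (l + 4 / l) * (1 + u ^ 2)⁻¹ := by
  rw [← div_eq_mul_inv, le_div_iff₀ (by positivity)]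
  have h1 := fej_le_l hl u
  have h2 : fej l u * u ^ 2 ≤ 4 / l := by
    rcases eq_or_ne u 0 with rfl | hu
    · simp; positivity
    · have := mul_le_mul_of_nonneg_right (fej_le hl hu) (sq_nonneg u)
      refine this.trans (le_of_eq ?_); field_simp
  linarith

lemma fej_int (hl : 0 < l) : Integrable (fej l) := by
  refine (integrable_inv_one_add_sq.const_mul (l + 4 / l)).mono' (fej_cont hl).aestronglyMeasurable ?_
  refine Eventually.of_forall fun u => ?_
  rw [Real.norm_of_nonneg (fej_nonneg hl u)]
  exact fej_le2 hl u

open FourierTransform in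
lemma fej_fourier (hl : 0 < l) (v : ℝ) :
    𝓕 (fun t : ℝ => (tri l t : ℂ)) v = (fej l (2 * π * v) : ℂ) := by
  rw [Real.fourier_real_eq_integral_exp_smul]
  have h1 : ∀ t : ℝ, Complex.exp (↑(-2 * π * t * v) * Complex.I) • (tri l t : ℂ) =
      ((tri l t * Real.cos (t * (2 * π * v)) : ℝ) : ℂ) -
        ((tri l t * Real.sin (t * (2 * π * v)) : ℝ) : ℂ) * Complex.I := by
    intro t
    rw [smul_eq_mul, Complex.exp_mul_I, ← Complex.ofReal_cos, ← Complex.ofReal_sin,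
      show -2 * π * t * v = -(t * (2 * π * v)) by ring, Real.cos_neg, Real.sin_neg]
    push_cast; ring
  simp_rw [h1]
  rw [integral_sub (tri_mul_int hl (by fun_prop)).ofReal
    ((tri_mul_int hl (by fun_prop)).ofReal.mul_const _)]
  rw [integral_mul_const, integral_complex_ofReal, integral_complex_ofReal]
  have h2 : ∫ t : ℝ, tri l t * Real.sin (t * (2 * π * v)) = 0 := by
    have h3 := integral_neg_eq_self (fun t : ℝ => tri l t * Real.sin (t * (2 * π * v))) volume
    have h4 : ∀ t : ℝ, tri l (-t) * Real.sin (-t * (2 * π * v)) =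
        -(tri l t * Real.sin (t * (2 * π * v))) := by
      intro t; rw [neg_mul, Real.sin_neg]; simp [tri]
    simp_rw [h4] at h3
    rw [integral_neg] at h3
    linarith
  rw [h2]
  simp [fej]

open FourierTransform in
lemma fej_integral (hl : 0 < l) : ∫ u, fej l u = 2 * π := by
  have h1 : 𝓕 (fun t : ℝ => (tri l t : ℂ)) = fun v => (fej l (2 * π * v) : ℂ) := by
    ext v; exact fej_fourier hl v
  have hIntg : Integrable (fun v => (fej l (2 * π * v) : ℂ)) :=
    ((fej_int hl).comp_mul_left' (by positivity)).ofReal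
  have h2 := congrFun (Continuous.fourierInv_fourier_eq (f := fun t : ℝ => (tri l t : ℂ))
    (Complex.continuous_ofReal.comp tri_cont) (tri_int hl).ofReal (by rw [h1]; exact hIntg)) 0
  rw [h1, Real.fourierInv_eq'] at h2
  simp only [inner_zero_right, mul_zero, Complex.ofReal_zero, zero_mul, Complex.exp_zero,
    one_smul] at h2
  have h3 : ∫ v, fej l (2 * π * v) = tri l 0 := by
    rw [integral_complex_ofReal] at h2
    exact Complex.ofReal_injective h2
  rw [Measure.integral_comp_mul_left (fej l)] at h3
  simp [tri] at h3
  rw [abs_of_pos Real.pi_pos] at h3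
  field_simp at h3
  linarith

end

noncomputable def gam (s2 u : ℝ) : ℝ := Real.exp (-(u ^ 2 / (2 * s2))) / √(2 * π * s2)

lemma gauss_ft {s2 : ℝ} (hs : 0 < s2) (v : ℝ) :
    ∫ s : ℝ, Complex.exp (Complex.I * (s : ℂ) * (v : ℂ)) * (Real.exp (-(s2 * s ^ 2 / 2)) : ℂ) =
      ((2 * π * gam s2 v : ℝ) : ℂ) := by
  have h := fourierIntegral_gaussian (b := ((s2 / 2 : ℝ) : ℂ)) (by simpa using hs) (v : ℂ)
  have e : ∀ s : ℝ, Complex.exp (Complex.I * (s : ℂ) * (v : ℂ)) * (Real.exp (-(s2 * s ^ 2 / 2)) : ℂ)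
      = Complex.exp (Complex.I * v * s) * Complex.exp (-((s2 / 2 : ℝ) : ℂ) * s ^ 2) := by
    intro s
    push_cast
    congr 2 <;> ring
  simp_rw [e]
  rw [h]
  have e1 : ((π : ℂ) / ((s2 / 2 : ℝ) : ℂ)) ^ (1 / 2 : ℂ) = ((√(π / (s2 / 2)) : ℝ) : ℂ) := by
    rw [Real.sqrt_eq_rpow, Complex.ofReal_cpow (by positivity)]
    push_cast; rfl
  rw [e1]
  have e2 : Complex.exp (-(v : ℂ) ^ 2 / (4 * ((s2 / 2 : ℝ) : ℂ))) =
      ((Real.exp (-(v ^ 2 / (2 * s2))) : ℝ) : ℂ) := by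
    push_cast; congr 1; field_simp; ring
  rw [e2, ← Complex.ofReal_mul]
  congr 1
  unfold gam
  have e3 : √(π / (s2 / 2)) = 2 * π / √(2 * π * s2) := by
    rw [eq_div_iff (by positivity), ← Real.sqrt_mul (by positivity)]
    rw [show π / (s2 / 2) * (2 * π * s2) = (2 * π) ^ 2 by field_simp]
    rw [Real.sqrt_sq (by positivity)]
  rw [e3]; ring

section
variable [Fintype X] [DecidableEq X] {P : X → X → ℝ} {ν f : X → ℝ} {α β : X → ℝ} {s2 B : ℝ}

lemma Tm_fej {lam : ℝ} (hl : 0 < lam) (ψ : X → ℝ) (n : ℕ) (x : X) (y : ℝ) :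
    (Tm P (fun _ x' => f x') mone ^ n) (fun x u => ψ x * fej lam u) x y =
    ∫ t : ℝ, tri lam t * (Complex.exp (Complex.I * (t : ℂ) * (y : ℂ)) *
      (At P f t ^ n) (fun x => (ψ x : ℂ)) x).re := by
  have e0 : ∀ (x : X) (t u : ℝ), tri lam t * (Complex.exp (Complex.I * (t : ℂ) * (u : ℂ)) * (ψ x : ℂ)).re
      = ψ x * (tri lam t * Real.cos (t * u)) := by
    intro x t u
    have : Complex.exp (Complex.I * (t : ℂ) * (u : ℂ)) =
        Complex.exp (((t * u : ℝ) : ℂ) * Complex.I) := by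
      congr 1; push_cast; ring
    rw [this, Complex.re_mul_ofReal, Complex.exp_ofReal_mul_I_re]
    ring
  have h := Tm_pow_integral (P := P) (w := fun _ x' => f x') (mk := mone) volume
    (fun t => tri lam t • (fun (x' : X) (u : ℝ) =>
      (Complex.exp (Complex.I * (t : ℂ) * (u : ℂ)) * (ψ x' : ℂ)).re)) (by
      intro x u
      simp only [Pi.smul_apply, smul_eq_mul, e0]
      exact (tri_mul_int hl (by fun_prop)).const_mul _) n x y
  have e1 : (fun (x : X) (u : ℝ) => ψ x * fej lam u) = fun x u => ∫ t, (tri lam t •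
      (fun (x' : X) (u : ℝ) => (Complex.exp (Complex.I * (t : ℂ) * (u : ℂ)) * (ψ x' : ℂ)).re)) x u := by
    funext x u
    simp only [Pi.smul_apply, smul_eq_mul, e0]
    rw [integral_const_mul]; rfl
  rw [e1, h.2]
  congr 1; ext t
  rw [map_smul]
  simp only [Pi.smul_apply, smul_eq_mul]
  rw [Tm_char]

lemma llt_fej [Nonempty X] (hS : IsStochastic P ν) (h1 : Primitive P) (h3 : NonLattice P f)
    (M : Mart P (fun _ x' => f x') α β s2 B) (ψ : X → ℝ) {lam : ℝ} (hl : 0 < lam)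
    {ε : ℝ} (hε : 0 < ε) : ∃ N : ℕ, ∀ n : ℕ, N ≤ n → ∀ (x : X) (y : ℝ),
      |√(n:ℝ) * (Tm P (fun _ x' => f x') mone ^ n) (fun x u => ψ x * fej lam u) x y
        - 2 * π * (∑ b, ψ b * ν b) * gam s2 (y / √(n:ℝ))| ≤ ε := by
  have hev : ∀ᶠ n : ℕ in atTop, ∀ x : X, ∫ s : ℝ,
      ‖((max (1 - |s / √(n:ℝ)| / lam) 0 : ℝ) : ℂ) *
        (At P f (s / √(n:ℝ)) ^ n) (fun x => (ψ x : ℂ)) x -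
        (Real.exp (-(s2 * s ^ 2 / 2)) : ℂ) * ∑ x, (ψ x : ℂ) * ν x‖ < ε :=
    eventually_all.2 fun x =>
      (At_L1 hS h1 h3 M (fun x => (ψ x : ℂ)) x hl).eventually_lt_const hε
  obtain ⟨N, hN⟩ := eventually_atTop.mp (hev.and (eventually_gt_atTop 0))
  refine ⟨N, fun n hn x y => ?_⟩
  obtain ⟨h5, hn0⟩ := hN n hn
  refine le_trans ?_ (h5 x).le
  have hn0' : (0:ℝ) < n := by exact_mod_cast hn0
  have hsn : 0 < √(n:ℝ) := Real.sqrt_pos.mpr hn0'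
  have hs := M.hs
  set A : ℝ → ℂ := fun t => (At P f t ^ n) (fun x => (ψ x : ℂ)) x with hA
  have hAc : Continuous A :=
    (continuous_apply x).comp ((At_continuous (P := P) (f := f) n).clm_apply continuous_const)
  set m : ℝ := ∑ b, ψ b * ν b with hm
  have hmC : (∑ x, (ψ x : ℂ) * (ν x : ℂ)) = (m : ℂ) := by rw [hm]; push_cast; rfl
  rw [hmC, Tm_fej hl]
  have hsub : √(n:ℝ) * ∫ t : ℝ, tri lam t * (Complex.exp (Complex.I * (t : ℂ) * (y : ℂ)) * A t).re
      = ∫ s : ℝ, (Complex.exp (Complex.I * (s : ℂ) * ((y / √(n:ℝ) : ℝ) : ℂ)) *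
        (((tri lam (s / √(n:ℝ)) : ℝ) : ℂ) * A (s / √(n:ℝ)))).re := by
    have := Measure.integral_comp_div
      (fun t : ℝ => tri lam t * (Complex.exp (Complex.I * (t : ℂ) * (y : ℂ)) * A t).re) (√(n:ℝ))
    rw [abs_of_pos hsn, smul_eq_mul] at this
    rw [← this]
    congr 1; ext s
    rw [← Complex.re_ofReal_mul]
    congr 1
    rw [show Complex.I * ((s / √(n:ℝ) : ℝ) : ℂ) * (y : ℂ) =
      Complex.I * (s : ℂ) * ((y / √(n:ℝ) : ℝ) : ℂ) by push_cast; ring]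
    ring
  rw [hsub]
  set v := y / √(n:ℝ)
  have hAeq : ∀ s : ℝ, (((max (1 - |s / √(n:ℝ)| / lam) 0 : ℝ)) : ℂ) = ((tri lam (s / √(n:ℝ)) : ℝ) : ℂ) :=
    fun s => rfl
  have i1 : Integrable (fun s : ℝ => ((tri lam (s / √(n:ℝ)) : ℝ) : ℂ) * A (s / √(n:ℝ))) := by
    have c1 : Continuous fun s : ℝ => ((tri lam s : ℝ) : ℂ) * A s :=
      (Complex.continuous_ofReal.comp tri_cont).mul hAc
    have : Integrable (fun s : ℝ => ((tri lam s : ℝ) : ℂ) * A s) := by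
      refine c1.integrable_of_hasCompactSupport ?_
      exact HasCompactSupport.mul_right ((tri_supp hl).comp_left (g := fun r : ℝ => (r : ℂ)) (by simp))
    exact this.comp_div hsn.ne'
  have i2 : Integrable (fun s : ℝ => (Real.exp (-(s2 * s ^ 2 / 2)) : ℂ) * (m : ℂ)) := by
    have := (integrable_exp_neg_mul_sq (show 0 < s2 / 2 by positivity)).ofReal (𝕜 := ℂ)
    refine (this.mul_const (m : ℂ)).congr (Eventually.of_forall fun s => ?_)
    simp only
    rw [show -(s2 * s ^ 2 / 2) = -(s2 / 2) * s ^ 2 by ring]; rfl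
  have hcis : ∀ s : ℝ, ‖Complex.exp (Complex.I * (s : ℂ) * (v : ℂ))‖ = 1 := fun s => norm_expI s v
  have hcc : Continuous fun s : ℝ => Complex.exp (Complex.I * (s : ℂ) * (v : ℂ)) := by fun_prop
  have j1 : Integrable (fun s : ℝ => Complex.exp (Complex.I * (s : ℂ) * (v : ℂ)) *
      (((tri lam (s / √(n:ℝ)) : ℝ) : ℂ) * A (s / √(n:ℝ)))) :=
    i1.bdd_mul hcc.aestronglyMeasurable (c := 1) (Eventually.of_forall fun s => (hcis s).le)
  have j2 : Integrable (fun s : ℝ => Complex.exp (Complex.I * (s : ℂ) * (v : ℂ)) *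
      ((Real.exp (-(s2 * s ^ 2 / 2)) : ℂ) * (m : ℂ))) :=
    i2.bdd_mul hcc.aestronglyMeasurable (c := 1) (Eventually.of_forall fun s => (hcis s).le)
  have hg : 2 * π * m * gam s2 v = ∫ s : ℝ, (Complex.exp (Complex.I * (s : ℂ) * (v : ℂ)) *
      ((Real.exp (-(s2 * s ^ 2 / 2)) : ℂ) * (m : ℂ))).re := by
    have h6 := gauss_ft hs v
    have h7 : ∫ s : ℝ, (Complex.exp (Complex.I * (s : ℂ) * (v : ℂ)) *
        ((Real.exp (-(s2 * s ^ 2 / 2)) : ℂ) * (m : ℂ))) = ((2 * π * m * gam s2 v : ℝ) : ℂ) := by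
      simp_rw [← mul_assoc]
      rw [integral_mul_const, h6]
      push_cast; ring
    have h8 := integral_re j2
    simp only [RCLike.re_eq_complex_re] at h8
    rw [h8, h7, Complex.ofReal_re]
  have k1 : Integrable (fun s : ℝ => (Complex.exp (Complex.I * (s : ℂ) * (v : ℂ)) *
      (((tri lam (s / √(n:ℝ)) : ℝ) : ℂ) * A (s / √(n:ℝ)))).re) := j1.re
  have k2 : Integrable (fun s : ℝ => (Complex.exp (Complex.I * (s : ℂ) * (v : ℂ)) *
      ((Real.exp (-(s2 * s ^ 2 / 2)) : ℂ) * (m : ℂ))).re) := j2.re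
  rw [hg, ← integral_sub k1 k2, ← Real.norm_eq_abs]
  refine (norm_integral_le_integral_norm _).trans ?_
  refine integral_mono_of_nonneg (Eventually.of_forall fun s => norm_nonneg _)
    ((i1.sub i2).norm) (Eventually.of_forall fun s => ?_)
  simp only [Pi.sub_apply]
  rw [← Complex.sub_re, ← mul_sub, Real.norm_eq_abs]
  refine (Complex.abs_re_le_norm _).trans ?_
  rw [norm_mul, hcis, one_mul]
  exact le_of_eq rfl
end

section
variable {s2 : ℝ}

lemma gam_nonneg (u : ℝ) : 0 ≤ gam s2 u := by unfold gam; positivity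

lemma gam_le (hs : 0 < s2) (u : ℝ) : gam s2 u ≤ gam s2 0 := by
  unfold gam
  refine div_le_div_of_nonneg_right (Real.exp_le_exp.mpr ?_) (Real.sqrt_nonneg _)
  have : 0 ≤ u ^ 2 / (2 * s2) := by positivity
  norm_num
  exact this

lemma gam_neg (u : ℝ) : gam s2 (-u) = gam s2 u := by unfold gam; simp

lemma mul_exp_le (t : ℝ) : |t| * Real.exp (-(t ^ 2 / 2)) ≤ 1 := by
  rw [Real.exp_neg, ← div_eq_mul_inv, div_le_one (Real.exp_pos _)]
  have := Real.add_one_le_exp (t ^ 2 / 2)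
  nlinarith [sq_nonneg (|t| - 1), sq_abs t]

lemma gam_deriv (hs : 0 < s2) (u : ℝ) : HasDerivAt (gam s2) (-(u / s2) * gam s2 u) u := by
  unfold gam
  have h1 : HasDerivAt (fun u : ℝ => -(u ^ 2 / (2 * s2))) (-(u / s2)) u := by
    have := ((hasDerivAt_pow 2 u).div_const (2 * s2)).neg
    refine this.congr_deriv ?_
    field_simp; push_cast; ring
  refine (h1.exp.div_const _).congr_deriv ?_
  ring

noncomputable def gLip (s2 : ℝ) : ℝ := gam s2 0 / √s2

lemma gLip_pos (hs : 0 < s2) : 0 < gLip s2 := by unfold gLip gam; positivity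

lemma gam_lip (hs : 0 < s2) (u v : ℝ) : |gam s2 u - gam s2 v| ≤ gLip s2 * |u - v| := by
  have := Convex.norm_image_sub_le_of_norm_hasDerivWithin_le (f := gam s2)
    (f' := fun u => -(u / s2) * gam s2 u) (C := gLip s2) (s := Set.univ) (x := v) (y := u)
    (fun x _ => (gam_deriv hs x).hasDerivWithinAt) ?_ convex_univ trivial trivial
  · simpa using this
  · intro x _
    have hq : 0 < √s2 := Real.sqrt_pos.mpr hs
    have h := mul_exp_le (x / √s2)
    have e1 : x / s2 = x / √s2 / √s2 := by
      rw [div_div, Real.mul_self_sqrt hs.le]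
    have e2 : gam s2 x = gam s2 0 * Real.exp (-((x / √s2) ^ 2 / 2)) := by
      unfold gam
      rw [div_pow, Real.sq_sqrt hs.le]
      simp
      rw [show x ^ 2 / (2 * s2) = x ^ 2 / s2 / 2 by field_simp]
      ring
    rw [norm_mul, norm_neg, Real.norm_eq_abs, Real.norm_eq_abs, abs_of_nonneg (gam_nonneg _), e1, e2,
      abs_div, abs_of_pos hq]
    unfold gLip
    have g0 : 0 ≤ gam s2 0 := gam_nonneg 0
    calc |x / √s2| / √s2 * (gam s2 0 * Real.exp (-((x / √s2) ^ 2 / 2)))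
        = (|x / √s2| * Real.exp (-((x / √s2) ^ 2 / 2))) * (gam s2 0 / √s2) := by ring
      _ ≤ 1 * (gam s2 0 / √s2) := by gcongr
      _ = _ := one_mul _

end

section
variable {l : ℝ}

lemma fej_even (u : ℝ) : fej l (-u) = fej l u := by
  unfold fej; congr 1; ext t; rw [mul_neg, Real.cos_neg]

lemma fej_tail (hl : 0 < l) {η : ℝ} (hη : 0 < η) : ∫ s in Set.Ioi η, fej l s ≤ 4 / (l * η) := by
  have h1 := integral_Ioi_rpow_of_lt (a := -2) (by norm_num) hη
  have i1 := integrableOn_Ioi_rpow_of_lt (a := -2) (by norm_num) hη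
  have : ∫ s in Set.Ioi η, fej l s ≤ ∫ s in Set.Ioi η, (4 / l) * s ^ (-2 : ℝ) := by
    refine setIntegral_mono_on (fej_int hl).integrableOn (i1.const_mul _) measurableSet_Ioi ?_
    intro s hs
    have hs0 : 0 < s := hη.trans hs
    refine (fej_le hl hs0.ne').trans (le_of_eq ?_)
    rw [Real.rpow_neg hs0.le, show (2:ℝ) = ((2:ℕ):ℝ) by norm_num, Real.rpow_natCast]
    field_simp
  refine this.trans (le_of_eq ?_)
  rw [integral_const_mul, h1]
  rw [show (-2:ℝ) + 1 = -1 by norm_num, Real.rpow_neg_one]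
  field_simp

lemma fej_center (hl : 0 < l) {η : ℝ} (hη : 0 < η) :
    2 * π - 8 / (l * η) ≤ ∫ s in (-η)..η, fej l s := by
  have h1 := fej_tail hl hη
  have h2 : ∫ s in Set.Iic (-η), fej l s = ∫ s in Set.Ioi η, fej l s := by
    have := integral_comp_neg_Iic (-η) (fej l)
    simp only [fej_even, neg_neg] at this
    exact this
  have h3 := fej_integral hl
  have h4 := intervalIntegral.integral_Iic_sub_Iic (f := fej l) (a := -η) (b := η) (μ := volume)
    (fej_int hl).integrableOn (fej_int hl).integrableOn
  have h5 := intervalIntegral.integral_Iic_add_Ioi (f := fej l) (b := η) (μ := volume)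
    (fej_int hl).integrableOn (fej_int hl).integrableOn
  have : 8 / (l * η) = 2 * (4 / (l * η)) := by ring
  linarith

/-- smoothed indicator -/
noncomputable def Gs (l p q u : ℝ) : ℝ := ∫ v in p..q, fej l (u - v)

lemma Gs_eq (p q u : ℝ) : Gs l p q u = ∫ s in (u - q)..(u - p), fej l s := by
  unfold Gs
  rw [intervalIntegral.integral_comp_sub_left (f := fej l) u]

lemma Gs_nonneg (hl : 0 < l) {p q : ℝ} (h : p ≤ q) (u : ℝ) : 0 ≤ Gs l p q u :=
  intervalIntegral.integral_nonneg h fun _ _ => fej_nonneg hl _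

lemma Gs_le (hl : 0 < l) {p q : ℝ} (h : p ≤ q) (u : ℝ) : Gs l p q u ≤ 2 * π := by
  rw [Gs_eq, intervalIntegral.integral_of_le (by linarith), ← fej_integral hl]
  exact setIntegral_le_integral (fej_int hl) (Eventually.of_forall fun _ => fej_nonneg hl _)

noncomputable def box (z a u : ℝ) : ℝ := if z ≤ u ∧ u ≤ z + a then 1 else 0

lemma box_nonneg (z a u : ℝ) : 0 ≤ box z a u := by unfold box; split_ifs <;> norm_num
lemma box_le_one (z a u : ℝ) : box z a u ≤ 1 := by unfold box; split_ifs <;> norm_num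
lemma box_shift (z a u : ℝ) : box z a u = box 0 a (u - z) := by
  unfold box
  congr 1
  apply propext
  constructor <;> rintro ⟨h1, h2⟩ <;> constructor <;> linarith

lemma box_upper (hl : 0 < l) {a η : ℝ} (hη : 0 < η) (ha : 0 ≤ a) (u : ℝ) :
    box 0 a u ≤ (1 / (2 * π)) * Gs l (-η) (a + η) u + (2 * (1 + a ^ 2) / η / l) * (1 + u ^ 2)⁻¹ := by
  have hpi := Real.pi_gt_three
  unfold box
  split_ifs with h
  · obtain ⟨h1, h2⟩ := h
    rw [zero_add] at h2
    have c1 := fej_center hl hη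
    have c2 : ∫ s in (-η)..η, fej l s ≤ Gs l (-η) (a + η) u := by
      rw [Gs_eq]
      refine intervalIntegral.integral_mono_interval (by linarith) (by linarith) (by linarith) ?_ ?_
      · exact Eventually.of_forall fun _ => fej_nonneg hl _
      · exact (fej_cont hl).intervalIntegrable _ _
    have c3 : 1 / (1 + a ^ 2) ≤ (1 + u ^ 2)⁻¹ := by
      rw [one_div]; gcongr
    have c4 : 2 / (η * l) ≤ (2 * (1 + a ^ 2) / η / l) * (1 + u ^ 2)⁻¹ := by
      calc 2 / (η * l) = (2 * (1 + a ^ 2) / η / l) * (1 / (1 + a ^ 2)) := by field_simp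
        _ ≤ _ := by gcongr
    have c5 : (1 / (2 * π)) * (2 * π - 8 / (l * η)) ≤ (1 / (2 * π)) * Gs l (-η) (a + η) u := by
      gcongr; exact c1.trans c2
    have c6 : (1 / (2 * π)) * (2 * π - 8 / (l * η)) = 1 - (4 / π) / (η * l) := by
      field_simp; ring
    have c7 : (4 / π) / (η * l) ≤ 2 / (η * l) := by
      gcongr; rw [div_le_iff₀ (by positivity)]; linarith
    linarith
  · have e : 0 ≤ (2 * (1 + a ^ 2) / η / l) * (1 + u ^ 2)⁻¹ := by positivity
    have := Gs_nonneg hl (show -η ≤ a + η by linarith) u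
    have : 0 ≤ (1 / (2 * π)) * Gs l (-η) (a + η) u := by positivity
    linarith

lemma box_lower (hl : 0 < l) {a η : ℝ} (hη : 0 < η) (ha : 2 * η ≤ a) (u : ℝ) :
    (1 / (2 * π)) * Gs l η (a - η) u ≤
      box 0 a u + (4 * a * (2 + (1 + 2 * a ^ 2) / η ^ 2) / l) * (1 + u ^ 2)⁻¹ := by
  have hpi := Real.pi_gt_three
  have ha0 : 0 < a := by linarith
  unfold box
  split_ifs with h
  · have := Gs_le hl (show η ≤ a - η by linarith) u
    have h2 : (1 / (2 * π)) * Gs l η (a - η) u ≤ (1 / (2 * π)) * (2 * π) := by gcongr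
    have h3 : (1 / (2 * π)) * (2 * π) = 1 := by field_simp
    have e : 0 ≤ (4 * a * (2 + (1 + 2 * a ^ 2) / η ^ 2) / l) * (1 + u ^ 2)⁻¹ := by positivity
    linarith
  · rw [zero_add] at h ⊢
    set D := (4 / l) * (2 + (1 + 2 * a ^ 2) / η ^ 2) * (1 + u ^ 2)⁻¹ with hD
    have hD0 : 0 ≤ D := by positivity
    have key : ∀ v ∈ Set.Icc η (a - η), fej l (u - v) ≤ D := by
      intro v hv
      have hd : η ≤ |u - v| := by
        rcases lt_or_ge u 0 with h0 | h0
        · rw [abs_of_neg (by linarith [hv.1])]; linarith [hv.1]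
        · have : a < u := by
            by_contra hc; exact h ⟨h0, by linarith⟩
          rw [abs_of_pos (by linarith [hv.2])]; linarith [hv.2]
      have hne : u - v ≠ 0 := by
        intro h0; rw [h0, abs_zero] at hd; linarith
      refine (fej_le hl hne).trans ?_
      have hsq : η ^ 2 ≤ (u - v) ^ 2 := by rw [← sq_abs (u - v)]; gcongr
      have hw : 0 < (u - v) ^ 2 := by positivity
      have h1 : 1 + u ^ 2 ≤ (u - v) ^ 2 * (2 + (1 + 2 * a ^ 2) / η ^ 2) := by
        have h2 : u ^ 2 ≤ 2 * (u - v) ^ 2 + 2 * a ^ 2 := by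
          have : v ^ 2 ≤ a ^ 2 := by
            apply pow_le_pow_left₀ <;> linarith [hv.1, hv.2]
          nlinarith [sq_nonneg (u - 2 * v)]
        have h3 : 1 + 2 * a ^ 2 ≤ (u - v) ^ 2 * ((1 + 2 * a ^ 2) / η ^ 2) := by
          rw [mul_div_assoc', le_div_iff₀ (by positivity)]
          nlinarith [sq_nonneg a]
        linarith
      rw [hD, ← div_eq_mul_inv, div_le_div_iff₀ (by positivity) (by positivity)]
      calc 4 * (1 + u ^ 2) ≤ 4 * ((u - v) ^ 2 * (2 + (1 + 2 * a ^ 2) / η ^ 2)) := by gcongr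
        _ = _ := by field_simp
    have hG : Gs l η (a - η) u ≤ D * a := by
      have h5 : Gs l η (a - η) u ≤ ∫ v in η..(a - η), D := by
        refine intervalIntegral.integral_mono_on (by linarith)
          (((fej_cont hl).comp (by fun_prop)).intervalIntegrable _ _) (by simp) key
      rw [intervalIntegral.integral_const, smul_eq_mul] at h5
      nlinarith
    have hD1 : (4 * a * (2 + (1 + 2 * a ^ 2) / η ^ 2) / l) * (1 + u ^ 2)⁻¹ = D * a := by
      rw [hD]; ring
    rw [hD1]
    have : 1 / (2 * π) ≤ 1 := by
      rw [div_le_one (by positivity)]; linarith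
    have hg := Gs_nonneg hl (show η ≤ a - η by linarith) u
    nlinarith

lemma cauchy_le (u : ℝ) : (1 + u ^ 2)⁻¹ ≤ 10 * (fej 1 u + fej 1 (u - π)) := by
  have n1 := fej_nonneg one_pos u
  have n2 := fej_nonneg one_pos (u - π)
  rcases le_or_gt (Real.cos u) 0 with h | h
  · have hu : u ≠ 0 := by rintro rfl; norm_num at h
    have := fej_eq one_pos hu
    rw [one_mul, one_mul] at this
    have h2 : 2 / u ^ 2 ≤ fej 1 u := by rw [this]; gcongr; linarith
    have h3 : (1 + u ^ 2)⁻¹ ≤ 2 / u ^ 2 := by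
      rw [inv_eq_one_div, div_le_div_iff₀ (by positivity) (by positivity)]; nlinarith [sq_nonneg u]
    nlinarith
  · have hu : u - π ≠ 0 := by
      intro h0
      have : u = π := by linarith
      rw [this, Real.cos_pi] at h; linarith
    have := fej_eq one_pos hu
    rw [one_mul, one_mul, Real.cos_sub_pi] at this
    have h2 : 2 / (u - π) ^ 2 ≤ fej 1 (u - π) := by rw [this]; gcongr; linarith
    have h3 : (1 + u ^ 2)⁻¹ ≤ 10 * (2 / (u - π) ^ 2) := by
      rw [inv_eq_one_div, mul_div_assoc', div_le_div_iff₀ (by positivity) (by positivity)]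
      have hp : π < 3.15 := Real.pi_lt_d2
      have hp0 := Real.pi_pos
      nlinarith [sq_nonneg (u + π)]
    nlinarith

end

section
variable [Fintype X] [DecidableEq X] {P : X → X → ℝ} {ν f : X → ℝ} {α β : X → ℝ} {s2 B : ℝ}

/-- uniform local limit property of a test function -/
def Good (P : X → X → ℝ) (f ψ : X → ℝ) (s2 : ℝ) (φ : ℝ → ℝ) (c : ℝ) : Prop :=
  ∀ ε : ℝ, 0 < ε → ∃ N : ℕ, ∀ n : ℕ, N ≤ n → ∀ (x : X) (y : ℝ),
      |√(n:ℝ) * (Tm P (fun _ x' => f x') mone ^ n) (fun x u => ψ x * φ u) x y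
        - c * gam s2 (y / √(n:ℝ))| ≤ ε

lemma Good.gs {ψ : X → ℝ} {l c : ℝ} (hl : 0 < l) (hs : 0 < s2) (h : Good P f ψ s2 (fej l) c)
    {p q : ℝ} (hpq : p ≤ q) : Good P f ψ s2 (Gs l p q) ((q - p) * c) := by
  intro ε hε
  set R := |p| + |q| with hR
  have hR0 : 0 ≤ R := by positivity
  have hL := gLip_pos hs
  obtain ⟨N, hN⟩ := h (ε / (2 * (q - p + 1))) (by
    have : 0 < q - p + 1 := by linarith
    positivity)
  have hlim : Tendsto (fun n : ℕ => |c| * (gLip s2 * (R * (√(n:ℝ))⁻¹))) atTop (𝓝 0) := by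
    have hsq : Tendsto (fun n : ℕ => √(n:ℝ)) atTop atTop :=
      Real.tendsto_sqrt_atTop.comp tendsto_natCast_atTop_atTop
    have hinv : Tendsto (fun n : ℕ => (√(n:ℝ))⁻¹) atTop (𝓝 0) := tendsto_inv_atTop_zero.comp hsq
    have := ((hinv.const_mul R).const_mul (gLip s2)).const_mul |c|
    simpa using this
  have hq1 : 0 < q - p + 1 := by linarith
  obtain ⟨N2, hN2⟩ := eventually_atTop.mp
    (hlim.eventually_lt_const (show 0 < ε / (2 * (q - p + 1)) by positivity))
  refine ⟨max N N2, fun n hn x y => ?_⟩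
  have h1 := hN n (le_of_max_le_left hn)
  have h2 := hN2 n (le_of_max_le_right hn)
  set T := Tm P (fun _ x' => f x') mone ^ n
  have hI := Tm_pow_integral (P := P) (w := fun _ x' => f x') (mk := mone)
    (volume.restrict (Set.Ioc p q)) (fun v (x : X) u => ψ x * fej l (u - v)) (by
      intro x u
      exact ((continuous_const.mul ((fej_cont hl).comp (by fun_prop))).integrableOn_Ioc)) n x y
  have e1 : (fun (x : X) u => ψ x * Gs l p q u) =
      fun x u => ∫ v in Set.Ioc p q, ψ x * fej l (u - v) := by
    funext x u
    unfold Gs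
    rw [intervalIntegral.integral_of_le hpq, integral_const_mul]
  have e2 : ∀ v, T (fun (x : X) u => ψ x * fej l (u - v)) x y = T (fun x u => ψ x * fej l u) x (y - v) :=
    fun v => Tm_pow_shift (fun (x : X) u => ψ x * fej l u) v n x y
  have hi1 : Integrable (fun v => T (fun x u => ψ x * fej l u) x (y - v))
      (volume.restrict (Set.Ioc p q)) := hI.1.congr (Eventually.of_forall e2)
  have e4 : T (fun (x : X) u => ψ x * Gs l p q u) x y =
      ∫ v in Set.Ioc p q, T (fun x u => ψ x * fej l u) x (y - v) := by
    rw [e1]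
    refine hI.2.trans ?_
    exact integral_congr_ae (Eventually.of_forall e2)
  rw [e4]
  have e3 : (q - p) * c * gam s2 (y / √(n:ℝ)) =
      ∫ v in Set.Ioc p q, c * gam s2 (y / √(n:ℝ)) := by
    simp [hpq]; ring
  rw [e3, ← integral_const_mul, ← integral_sub (hi1.const_mul _) (integrable_const _)]
  have hb : ∀ v ∈ Set.Ioc p q, ‖√(n:ℝ) * T (fun x u => ψ x * fej l u) x (y - v) -
      c * gam s2 (y / √(n:ℝ))‖ ≤ ε / (q - p + 1) := by
    intro v hv
    have b1 := h1 x (y - v)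
    have b2 := gam_lip hs ((y - v) / √(n:ℝ)) (y / √(n:ℝ))
    have b3 : |(y - v) / √(n:ℝ) - y / √(n:ℝ)| ≤ R * (√(n:ℝ))⁻¹ := by
      rw [← sub_div, abs_div, abs_of_nonneg (Real.sqrt_nonneg _), div_eq_mul_inv]
      gcongr
      rw [show y - v - y = -v by ring, abs_neg]
      rw [hR]
      rcases abs_cases v with h | h <;> rcases abs_cases p with h' | h' <;>
        rcases abs_cases q with h'' | h'' <;> linarith [hv.1, hv.2]
    have b4 : |c * gam s2 ((y - v) / √(n:ℝ)) - c * gam s2 (y / √(n:ℝ))| ≤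
        |c| * (gLip s2 * (R * (√(n:ℝ))⁻¹)) := by
      rw [← mul_sub, abs_mul]
      gcongr
      exact b2.trans (by gcongr)
    have b5 : ε / (q - p + 1) = ε / (2 * (q - p + 1)) + ε / (2 * (q - p + 1)) := by field_simp; ring
    rw [Real.norm_eq_abs]
    have := abs_sub_le (√(n:ℝ) * T (fun x u => ψ x * fej l u) x (y - v))
      (c * gam s2 ((y - v) / √(n:ℝ))) (c * gam s2 (y / √(n:ℝ)))
    linarith
  have := norm_setIntegral_le_of_norm_le_const (μ := volume) (s := Set.Ioc p q) (by simp) hb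
  rw [Real.norm_eq_abs] at this
  refine this.trans ?_
  simp only [measureReal_def, Real.volume_Ioc]
  rw [ENNReal.toReal_ofReal (by linarith), div_mul_eq_mul_div, div_le_iff₀ hq1]
  nlinarith

lemma Tm_cauchy_bound {ψ : X → ℝ} (hP : ∀ x x', 0 ≤ P x x') (hψ : ∀ b, 0 ≤ ψ b) {c : ℝ} (hc : 0 ≤ c)
    (hs : 0 < s2) (h : Good P f ψ s2 (fej 1) c) :
    ∃ N : ℕ, ∀ n : ℕ, N ≤ n → ∀ (x : X) (y : ℝ),
      √(n:ℝ) * (Tm P (fun _ x' => f x') mone ^ n) (fun x u => ψ x * (1 + u ^ 2)⁻¹) x y ≤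
        20 * (c * gam s2 0 + 1) := by
  obtain ⟨N, hN⟩ := h 1 one_pos
  refine ⟨N, fun n hn x y => ?_⟩
  have a1 := (abs_le.mp (hN n hn x y)).2
  have a2 := (abs_le.mp (hN n hn x (y - π))).2
  have g1 := mul_le_mul_of_nonneg_left (gam_le hs (y / √(n:ℝ))) hc
  have g2 := mul_le_mul_of_nonneg_left (gam_le hs ((y - π) / √(n:ℝ))) hc
  have a3 : (Tm P (fun _ x' => f x') mone ^ n) (fun x u => ψ x * (1 + u ^ 2)⁻¹) x y ≤
      10 * ((Tm P (fun _ x' => f x') mone ^ n) (fun x u => ψ x * fej 1 u) x y +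
        (Tm P (fun _ x' => f x') mone ^ n) (fun x u => ψ x * fej 1 u) x (y - π)) := by
    rw [← Tm_pow_shift (fun (x : X) u => ψ x * fej 1 u) π n x y, ← Pi.add_apply, ← Pi.add_apply,
      ← map_add, ← smul_eq_mul, ← Pi.smul_apply, ← Pi.smul_apply, ← map_smul]
    refine Tm_pow_mono hP mone_nonneg ?_ n x y
    intro x u
    simp only [Pi.smul_apply, Pi.add_apply, smul_eq_mul]
    have := mul_le_mul_of_nonneg_left (cauchy_le u) (hψ x)
    linarith
  have := mul_le_mul_of_nonneg_left a3 (Real.sqrt_nonneg (n:ℝ))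
  linarith

lemma Good.box [Nonempty X] (hS : IsStochastic P ν) (h1 : Primitive P) (h3 : NonLattice P f)
    (M : Mart P (fun _ x' => f x') α β s2 B) {ψ : X → ℝ} (hψ : ∀ b, 0 ≤ ψ b) {a : ℝ} (ha : 0 < a) :
    Good P f ψ s2 (box 0 a) (a * ∑ b, ψ b * ν b) := by
  intro ε hε
  have hs := M.hs
  set m := ∑ b, ψ b * ν b with hm
  have hm0 : 0 ≤ m := Finset.sum_nonneg fun b _ => mul_nonneg (hψ b) (hS.nuPos b).le
  have hfej : ∀ l : ℝ, 0 < l → Good P f ψ s2 (fej l) (2 * π * m) := fun l hl ε hε =>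
    llt_fej hS h1 h3 M ψ hl hε
  obtain ⟨N0, hN0⟩ := Tm_cauchy_bound hS.nonneg hψ (c := 2 * π * m) (by positivity) hs (hfej 1 one_pos)
  set CE := 20 * (2 * π * m * gam s2 0 + 1) with hCE
  have g0 : 0 ≤ gam s2 0 := gam_nonneg 0
  have hCE0 : 0 < CE := by positivity
  set η := min (a / 4) (ε / (8 * (m * gam s2 0 + 1))) with hη
  have hη0 : 0 < η := by positivity
  have hηa : η ≤ a / 4 := min_le_left _ _
  have hηε : 2 * η * (m * gam s2 0) ≤ ε / 4 := by
    have : η ≤ ε / (8 * (m * gam s2 0 + 1)) := min_le_right _ _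
    rw [le_div_iff₀ (by positivity)] at this
    have h0 : 0 ≤ m * gam s2 0 := by positivity
    nlinarith
  set C1 := 2 * (1 + a ^ 2) / η + 4 * a * (2 + (1 + 2 * a ^ 2) / η ^ 2) with hC1
  have hC10 : 0 < C1 := by positivity
  set l := C1 * CE * 4 / ε with hl
  have hl0 : 0 < l := by positivity
  have hlε : C1 / l * CE = ε / 4 := by rw [hl]; field_simp
  obtain ⟨N1, hN1⟩ := (hfej l hl0).gs hl0 hs (show -η ≤ a + η by linarith) (ε / 2) (by positivity)
  obtain ⟨N2, hN2⟩ := (hfej l hl0).gs hl0 hs (show η ≤ a - η by linarith) (ε / 2) (by positivity)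
  refine ⟨max N0 (max N1 N2), fun n hn x y => ?_⟩
  have b0 := hN0 n (le_of_max_le_left hn) x y
  have b1 := hN1 n (le_of_max_le_left (le_of_max_le_right hn)) x y
  have b2 := hN2 n (le_of_max_le_right (le_of_max_le_right hn)) x y
  set T := Tm P (fun _ x' => f x') mone ^ n
  have hsn := Real.sqrt_nonneg (n:ℝ)
  have gy := gam_le hs (y / √(n:ℝ))
  have gy0 := gam_nonneg (s2 := s2) (y / √(n:ℝ))
  set g := gam s2 (y / √(n:ℝ))
  have hpi := Real.pi_gt_three
  have hmg : 2 * η * (m * g) ≤ ε / 4 := le_trans (by gcongr) hηε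
  have up : T (fun x u => ψ x * CLLT.box 0 a u) x y ≤
      (1 / (2 * π)) * T (fun x u => ψ x * Gs l (-η) (a + η) u) x y +
        C1 / l * T (fun x u => ψ x * (1 + u ^ 2)⁻¹) x y := by
    rw [← smul_eq_mul (a := 1 / (2 * π)), ← smul_eq_mul (a := C1 / l), ← Pi.smul_apply,
      ← Pi.smul_apply, ← Pi.smul_apply (C1 / l), ← Pi.smul_apply (C1 / l), ← map_smul, ← map_smul,
      ← Pi.add_apply, ← Pi.add_apply, ← map_add]
    refine Tm_pow_mono hS.nonneg mone_nonneg ?_ n x y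
    intro x u
    simp only [Pi.smul_apply, Pi.add_apply, smul_eq_mul]
    have h5 := mul_le_mul_of_nonneg_left (box_upper hl0 hη0 ha.le u) (hψ x)
    have h6 : (2 * (1 + a ^ 2) / η / l) * (1 + u ^ 2)⁻¹ ≤ C1 / l * (1 + u ^ 2)⁻¹ := by
      gcongr
      rw [hC1]
      have : 0 < 4 * a * (2 + (1 + 2 * a ^ 2) / η ^ 2) := by positivity
      linarith
    have h7 := mul_le_mul_of_nonneg_left h6 (hψ x)
    linarith
  have lo : (1 / (2 * π)) * T (fun x u => ψ x * Gs l η (a - η) u) x y ≤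
      T (fun x u => ψ x * CLLT.box 0 a u) x y +
        C1 / l * T (fun x u => ψ x * (1 + u ^ 2)⁻¹) x y := by
    rw [← smul_eq_mul (a := 1 / (2 * π)), ← smul_eq_mul (a := C1 / l), ← Pi.smul_apply,
      ← Pi.smul_apply, ← Pi.smul_apply (C1 / l), ← Pi.smul_apply (C1 / l), ← map_smul, ← map_smul,
      ← Pi.add_apply, ← Pi.add_apply, ← map_add]
    refine Tm_pow_mono hS.nonneg mone_nonneg ?_ n x y
    intro x u
    simp only [Pi.smul_apply, Pi.add_apply, smul_eq_mul]
    have h5 := mul_le_mul_of_nonneg_left (box_lower hl0 hη0 (show 2 * η ≤ a by linarith) u) (hψ x)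
    have h6 : (4 * a * (2 + (1 + 2 * a ^ 2) / η ^ 2) / l) * (1 + u ^ 2)⁻¹ ≤
        C1 / l * (1 + u ^ 2)⁻¹ := by
      gcongr
      rw [hC1]
      have : 0 < 2 * (1 + a ^ 2) / η := by positivity
      linarith
    have h7 := mul_le_mul_of_nonneg_left h6 (hψ x)
    linarith
  have up' := mul_le_mul_of_nonneg_left up hsn
  have lo' := mul_le_mul_of_nonneg_left lo hsn
  have b0' := mul_le_mul_of_nonneg_left b0 (show 0 ≤ C1 / l by positivity)
  rw [hlε] at b0'
  have b1' := mul_le_mul_of_nonneg_left (abs_le.mp b1).2 (show 0 ≤ 1 / (2 * π) by positivity)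
  have b2' := mul_le_mul_of_nonneg_left (abs_le.mp b2).1 (show 0 ≤ 1 / (2 * π) by positivity)
  have e1 : 1 / (2 * π) * (√(n:ℝ) * T (fun x u => ψ x * Gs l (-η) (a + η) u) x y -
      (a + η - -η) * (2 * π * m) * g) = √(n:ℝ) * (1 / (2 * π) *
      T (fun x u => ψ x * Gs l (-η) (a + η) u) x y) - a * m * g - 2 * η * (m * g) := by
    field_simp; ring
  have e2 : 1 / (2 * π) * (√(n:ℝ) * T (fun x u => ψ x * Gs l η (a - η) u) x y -
      (a - η - η) * (2 * π * m) * g) = √(n:ℝ) * (1 / (2 * π) *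
      T (fun x u => ψ x * Gs l η (a - η) u) x y) - a * m * g + 2 * η * (m * g) := by
    field_simp; ring
  have e3 : 1 / (2 * π) * (ε / 2) ≤ ε / 4 := by
    rw [one_div_mul_eq_div, div_le_iff₀ (by positivity)]; nlinarith
  rw [e1] at b1'
  rw [e2] at b2'
  rw [abs_le]
  constructor <;> linarith

lemma Tm_box_shift (ψ : X → ℝ) (z a : ℝ) (n : ℕ) (x : X) (y : ℝ) :
    (Tm P (fun _ x' => f x') mone ^ n) (fun x u => ψ x * box z a u) x y =
    (Tm P (fun _ x' => f x') mone ^ n) (fun x u => ψ x * box 0 a u) x (y - z) := by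
  have e : (fun (x : X) u => ψ x * box z a u) =
      fun x u => (fun (x : X) u => ψ x * box 0 a u) x (u - z) := by
    funext x u
    simp only
    rw [box_shift z]
  rw [e]
  exact Tm_pow_shift (fun (x : X) u => ψ x * box 0 a u) z n x y

/-- Uniform local limit theorem for the free walk. -/
lemma llt [Nonempty X] (hS : IsStochastic P ν) (h1 : Primitive P) (h3 : NonLattice P f)
    (M : Mart P (fun _ x' => f x') α β s2 B) {ψ : X → ℝ} (hψ : ∀ b, 0 ≤ ψ b) {a : ℝ} (ha : 0 < a)
    {ε : ℝ} (hε : 0 < ε) : ∃ N : ℕ, ∀ n : ℕ, N ≤ n → ∀ (x : X) (y z : ℝ),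
      |√(n:ℝ) * (Tm P (fun _ x' => f x') mone ^ n) (fun x u => ψ x * box z a u) x y
        - a * (∑ b, ψ b * ν b) * gam s2 ((y - z) / √(n:ℝ))| ≤ ε := by
  obtain ⟨N, hN⟩ := Good.box hS h1 h3 M hψ ha ε hε
  refine ⟨N, fun n hn x y z => ?_⟩
  rw [Tm_box_shift]
  exact hN n hn x (y - z)

/-- Uniform upper bound for the free walk. -/
lemma llt_bound [Nonempty X] (hS : IsStochastic P ν) (h1 : Primitive P) (h3 : NonLattice P f)
    (M : Mart P (fun _ x' => f x') α β s2 B) {a : ℝ} (ha : 0 < a) :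
    ∃ C : ℝ, 0 < C ∧ ∀ n : ℕ, ∀ (x : X) (y z : ℝ),
      (Tm P (fun _ x' => f x') mone ^ n) (fun _ u => box z a u) x y ≤ C / √((n:ℝ) + 1) := by
  obtain ⟨N, hN⟩ := llt hS h1 h3 M (ψ := fun _ => 1) (fun _ => zero_le_one) ha (ε := 1) one_pos
  have hs := M.hs
  have g0 : 0 ≤ gam s2 0 := gam_nonneg 0
  refine ⟨√((N:ℝ) + 1) + 2 * (a * gam s2 0 + 1), by positivity, fun n x y z => ?_⟩
  have hsn : 0 < √((n:ℝ) + 1) := by positivity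
  rw [le_div_iff₀ hsn]
  rcases lt_or_ge n (N + 1) with h | h
  · have h1 : (Tm P (fun _ x' => f x') mone ^ n) (fun _ u => box z a u) x y ≤ 1 := by
      refine le_trans (Tm_pow_mono hS.nonneg mone_nonneg (h := one1) ?_ n x y)
        (Tm_pow_one_le hS.nonneg hS.rowSum mone_nonneg (fun _ => le_refl _) n x y)
      intro x u; exact box_le_one _ _ _
    have h2 : √((n:ℝ) + 1) ≤ √((N:ℝ) + 1) := by
      apply Real.sqrt_le_sqrt
      have : (n : ℝ) ≤ N := by exact_mod_cast (by omega : n ≤ N)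
      linarith
    have h3 : 0 ≤ 2 * (a * gam s2 0 + 1) := by positivity
    have h4 : (Tm P (fun _ x' => f x') mone ^ n) (fun _ u => box z a u) x y * √((n:ℝ) + 1) ≤
        1 * √((n:ℝ) + 1) := by gcongr
    linarith
  · have h5 := (abs_le.mp (hN n (by omega) x y z)).2
    simp only [one_mul, hS.nuSum, mul_one] at h5
    have h6 := mul_le_mul_of_nonneg_left (gam_le hs ((y - z) / √(n:ℝ))) ha.le
    have h7 : √((n:ℝ) + 1) ≤ 2 * √(n:ℝ) := by
      rw [Real.sqrt_le_left (by positivity), mul_pow, Real.sq_sqrt (by positivity)]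
      have : (1:ℝ) ≤ n := by exact_mod_cast (by omega : 1 ≤ n)
      linarith
    have h8 : 0 ≤ (Tm P (fun _ x' => f x') mone ^ n) (fun _ u => box z a u) x y :=
      Tm_pow_nonneg hS.nonneg mone_nonneg (fun _ _ => box_nonneg _ _ _) n x y
    have h9 := mul_le_mul_of_nonneg_left h7 h8
    have h10 := Real.sqrt_nonneg ((N:ℝ) + 1)
    linarith

end

section
variable [Fintype X] [DecidableEq X] {P w : X → X → ℝ} {ν f : X → ℝ} {α β : X → ℝ} {s2 B : ℝ}

lemma Tm_pow_succ_mono_on (hP : ∀ x x', 0 ≤ P x x') {m : ℝ → ℝ} (hm : ∀ y, 0 ≤ m y) (A : Set ℝ)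
    (hA : ∀ y, m y ≠ 0 → y ∈ A) {g h : X → ℝ → ℝ} (H : ∀ x, ∀ y ∈ A, g x y ≤ h x y) (n : ℕ)
    (x : X) (y : ℝ) : (Tm P w m ^ (n + 1)) g x y ≤ (Tm P w m ^ (n + 1)) h x y := by
  rw [pow_succ', Module.End.mul_apply, Module.End.mul_apply]
  exact Tm_le_on hP hm x y fun x' h' => Tm_pow_mono_on hP hm A hA H n x' _ (hA _ h')

lemma mpos_meas : Measurable mpos :=
  Measurable.ite (measurableSet_Ioi) measurable_const measurable_const

lemma box_meas (z a : ℝ) : Measurable (box z a) :=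
  Measurable.ite (measurableSet_Icc (a := z) (b := z + a)) measurable_const measurable_const

lemma box_eq_ind (z a : ℝ) : box z a = Set.indicator (Set.Icc z (z + a)) (fun _ => (1:ℝ)) := by
  funext u
  unfold box
  simp [Set.indicator_apply]

lemma box_integrable (z a : ℝ) : Integrable (box z a) := by
  rw [box_eq_ind]
  exact (integrable_indicator_iff measurableSet_Icc).mpr (by
    simp)

lemma box_int (z : ℝ) {a : ℝ} (ha : 0 ≤ a) : ∫ u, box z a u = a := by
  rw [box_eq_ind, integral_indicator measurableSet_Icc]
  simp [ha]

lemma Tm_meas {m : ℝ → ℝ} (hm : Measurable m) {g : X → ℝ → ℝ} (hg : ∀ x, Measurable (g x)) (x : X) :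
    Measurable (Tm P w m g x) := by
  have : Tm P w m g x = fun y => ∑ x', P x x' * (m (y + w x x') * g x' (y + w x x')) := by
    funext y; exact Tm_apply _ _ _ _ _ _
  rw [this]
  refine Finset.measurable_fun_sum _ fun x' _ => ?_
  have := hg x'
  fun_prop

lemma Tm_pow_meas {m : ℝ → ℝ} (hm : Measurable m) {g : X → ℝ → ℝ} (hg : ∀ x, Measurable (g x))
    (n : ℕ) : ∀ x, Measurable ((Tm P w m ^ n) g x) := by
  induction n with
  | zero => simpa using hg
  | succ n ih =>
    intro x
    rw [pow_succ', Module.End.mul_apply]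
    exact Tm_meas hm ih x

lemma mpos_abs (u : ℝ) : |mpos u| ≤ 1 := by
  rw [abs_of_nonneg (mpos_nonneg u)]; exact mpos_le_one u

lemma Tm_intble {g : X → ℝ → ℝ} (hg : ∀ x, Integrable (g x)) (x : X) :
    Integrable (Tm P w mpos g x) := by
  have : Tm P w mpos g x = fun y => ∑ x', P x x' * (mpos (y + w x x') * g x' (y + w x x')) := by
    funext y; exact Tm_apply _ _ _ _ _ _
  rw [this]
  refine integrable_finsetSum _ fun x' _ => Integrable.const_mul ?_ _
  exact ((hg x').bdd_mul (c := 1) mpos_meas.aestronglyMeasurable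
    (Eventually.of_forall mpos_abs)).comp_add_right _

lemma Tm_pow_intble {g : X → ℝ → ℝ} (hg : ∀ x, Integrable (g x)) (n : ℕ) :
    ∀ x, Integrable ((Tm P w mpos ^ n) g x) := by
  induction n with
  | zero => simpa using hg
  | succ n ih =>
    intro x
    rw [pow_succ', Module.End.mul_apply]
    exact Tm_intble ih x

/-- one-step duality -/
lemma dual_step (hS : IsStochastic P ν) {g h : X → ℝ → ℝ} (hg : ∀ x, Integrable (g x))
    (hh : ∀ x, Measurable (h x)) {C : ℝ} (hb : ∀ x u, |h x u| ≤ C) :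
    ∑ x, ν x * ∫ u, h x u * Tm P (fun _ x' => f x') mpos g x u =
    ∑ x, ν x * ∫ u, mpos u * Tm (dualK P ν) (fun x _ => - f x) mone h x u * g x u := by
  have hmg : ∀ x, Integrable (fun u => mpos u * g x u) := fun x =>
    (hg x).bdd_mul (c := 1) mpos_meas.aestronglyMeasurable (Eventually.of_forall mpos_abs)
  have i1 : ∀ x x', Integrable (fun u => h x (u - f x') * (mpos u * g x' u)) := fun x x' =>
    (hmg x').bdd_mul (c := C) ((hh x).comp (measurable_id.sub_const _)).aestronglyMeasurable
      (Eventually.of_forall fun u => hb _ _)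
  have e1 : ∀ x, ∫ u, h x u * Tm P (fun _ x' => f x') mpos g x u =
      ∑ x', P x x' * ∫ u, h x (u - f x') * (mpos u * g x' u) := by
    intro x
    have i2 : ∀ x', Integrable (fun u => h x u * (mpos (u + f x') * g x' (u + f x'))) := by
      intro x'
      have := (i1 x x').comp_add_right (f x')
      simpa using this
    have e2 : ∀ u, h x u * Tm P (fun _ x' => f x') mpos g x u =
        ∑ x', P x x' * (h x u * (mpos (u + f x') * g x' (u + f x'))) := by
      intro u
      rw [Tm_apply, Finset.mul_sum]
      refine Finset.sum_congr rfl fun x' _ => by ring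
    simp_rw [e2]
    rw [integral_finsetSum _ fun x' _ => (i2 x').const_mul _]
    refine Finset.sum_congr rfl fun x' _ => ?_
    rw [integral_const_mul, ← integral_add_right_eq_self
      (fun u => h x (u - f x') * (mpos u * g x' u)) (f x')]
    simp
  have e3 : ∀ x', ∫ u, mpos u * Tm (dualK P ν) (fun x _ => - f x) mone h x' u * g x' u =
      ∑ x, dualK P ν x' x * ∫ u, h x (u - f x') * (mpos u * g x' u) := by
    intro x'
    have e2 : ∀ u, mpos u * Tm (dualK P ν) (fun x _ => - f x) mone h x' u * g x' u =
        ∑ x, dualK P ν x' x * (h x (u - f x') * (mpos u * g x' u)) := by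
      intro u
      rw [Tm_apply, Finset.mul_sum, Finset.sum_mul]
      refine Finset.sum_congr rfl fun x _ => by
        simp only [mone]; rw [← sub_eq_add_neg]; ring
    simp_rw [e2]
    rw [integral_finsetSum _ fun x _ => (i1 x x').const_mul _]
    simp_rw [integral_const_mul]
  simp_rw [e1, e3, Finset.mul_sum]
  rw [Finset.sum_comm]
  refine Finset.sum_congr rfl fun x' _ => Finset.sum_congr rfl fun x _ => ?_
  have := (hS.nuPos x').ne'
  unfold dualK
  field_simp

lemma dual_pow (hS : IsStochastic P ν) {g : X → ℝ → ℝ} (hg : ∀ x, Integrable (g x)) (n : ℕ) :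
    ∀ {h : X → ℝ → ℝ}, (∀ x, Measurable (h x)) → (∀ x u, |h x u| ≤ 1) →
    ∑ x, ν x * ∫ u, mpos u * h x u * (Tm P (fun _ x' => f x') mpos ^ n) g x u =
    ∑ x, ν x * ∫ u, mpos u * (Tm (dualK P ν) (fun x _ => - f x) mpos ^ n) h x u * g x u := by
  have hD := dual_stoch hS
  induction n with
  | zero => intro h _ _; simp
  | succ n ih =>
    intro h hh hb
    have s1 := dual_step (f := f) hS (g := (Tm P (fun _ x' => f x') mpos ^ n) g)
      (h := fun x u => mpos u * h x u)
      (Tm_pow_intble hg n) (fun x => mpos_meas.mul (hh x)) (C := 1) (by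
        intro x u
        rw [abs_mul]
        exact mul_le_one₀ (mpos_abs u) (abs_nonneg _) (hb x u))
    have e : Tm (dualK P ν) (fun x _ => - f x) mone (fun x u => mpos u * h x u) =
        Tm (dualK P ν) (fun x _ => - f x) mpos h := by
      funext x u
      simp [Tm_apply, mone]
    rw [e] at s1
    rw [pow_succ', pow_succ, Module.End.mul_apply, Module.End.mul_apply, s1]
    apply ih (Tm_meas mpos_meas hh)
    intro x u
    have := Tm_pow_abs_le (w := fun x _ => - f x) hD.nonneg mpos_nonneg Set.univ
      (fun _ _ => trivial) (g := h) (h := one1) 1 (by simpa [one1] using hb) 1 x u trivial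
    rw [pow_one, one_mul] at this
    exact this.trans (Tm_one_le hD.nonneg hD.rowSum mpos_le_one x u)

lemma dual_one (hS : IsStochastic P ν) {g : X → ℝ → ℝ} (hg : ∀ x, Integrable (g x)) (n : ℕ) :
    ∑ x, ν x * ∫ u, (Tm P (fun _ x' => f x') mpos ^ (n + 1)) g x u =
    ∑ x, ν x * ∫ u, mpos u * (Tm (dualK P ν) (fun x _ => - f x) mpos ^ n) one1 x u * g x u := by
  have hD := dual_stoch hS
  have s1 := dual_step (f := f) hS (g := (Tm P (fun _ x' => f x') mpos ^ n) g) (h := one1)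
      (Tm_pow_intble hg n) (fun x => measurable_const) (C := 1) (by simp [one1])
  have e : Tm (dualK P ν) (fun x _ => - f x) mone one1 = one1 := by
    funext x u
    simp [Tm_apply, mone, one1, hD.rowSum]
  rw [e] at s1
  have s2 := dual_pow (f := f) hS hg n (h := one1) (fun x => measurable_const) (by simp [one1])
  rw [← s2, ← s1]
  simp [one1, pow_succ']

lemma shift_mono (hP : ∀ x x', 0 ≤ P x x') {g g' : X → ℝ → ℝ} (h0 : ∀ x u, 0 ≤ g' x u)
    (H : ∀ x v u, v ≤ u → u ≤ v + 1 → g x v ≤ g' x u) (n : ℕ) :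
    ∀ x v u, v ≤ u → u ≤ v + 1 → (Tm P w mpos ^ n) g x v ≤ (Tm P w mpos ^ n) g' x u := by
  induction n with
  | zero => simpa using H
  | succ n ih =>
    intro x v u hvu huv
    rw [pow_succ', Module.End.mul_apply, Module.End.mul_apply, Tm_apply, Tm_apply]
    refine Finset.sum_le_sum fun x' _ => mul_le_mul_of_nonneg_left ?_ (hP x x')
    have h1 := ih x' (v + w x x') (u + w x x') (by linarith) (by linarith)
    have h2 := Tm_pow_nonneg (w := w) hP mpos_nonneg h0 n x' (u + w x x')
    by_cases h3 : 0 < v + w x x'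
    · have h4 : 0 < u + w x x' := by linarith
      have e3 : mpos (v + w x x') = 1 := by unfold mpos; rw [if_pos h3]
      have e4 : mpos (u + w x x') = 1 := by unfold mpos; rw [if_pos h4]
      rw [e3, e4]; simpa using h1
    · have e3 : mpos (v + w x x') = 0 := by unfold mpos; rw [if_neg h3]
      rw [e3, zero_mul]
      exact mul_nonneg (mpos_nonneg _) h2

lemma survive_le' (M : Mart P w α β s2 B) (n : ℕ) (x : X) (y : ℝ) :
    (Tm P w mpos ^ n) one1 x y ≤ 4 * cExit s2 B * (1 + max y 0) / √((n:ℝ) + 1) := by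
  have hB := M.hB
  have hs := M.hs
  have hmx : 0 ≤ max y 0 := le_max_right _ _
  have hc : 4 * B ≤ cExit s2 B := by
    have : 0 ≤ 27 * B ^ 2 / s2 := by positivity
    unfold cExit; linarith
  rcases Nat.eq_zero_or_pos n with rfl | hn
  · simp [one1]; nlinarith
  · refine (survive_le M hn x y).trans ?_
    have hn' : (1:ℝ) ≤ n := by exact_mod_cast hn
    rw [div_le_div_iff₀ (by positivity) (by positivity)]
    have : √((n:ℝ) + 1) ≤ 2 * √(n:ℝ) := by
      rw [Real.sqrt_le_left (by positivity), mul_pow, Real.sq_sqrt (by positivity)]; linarith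
    have h0 : 0 ≤ cExit s2 B * (1 + max y 0) := by
      apply mul_nonneg <;> linarith
    nlinarith

end

section
variable [Fintype X] [DecidableEq X] {P : X → X → ℝ} {ν f : X → ℝ} {α β : X → ℝ} {s2 B : ℝ}

lemma int_strip_le {α' β' : X → ℝ} {s2' B' : ℝ} (hS : IsStochastic P ν)
    (M' : Mart (dualK P ν) (fun x _ => - f x) α' β' s2' B') {c : ℝ} (hc : 0 ≤ c) (n : ℕ) :
    ∑ x, ν x * ∫ u, (Tm P (fun _ x' => f x') mpos ^ (n + 1)) (fun _ u => box 0 c u) x u ≤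
      c * (4 * cExit s2' B' * (1 + c) / √((n:ℝ) + 1)) := by
  have hD := dual_stoch hS
  rw [dual_one hS fun _ => box_integrable 0 c]
  set R := 4 * cExit s2' B' * (1 + c) / √((n:ℝ) + 1) with hR
  have hcE := cExit_pos M'
  have hR0 : 0 ≤ R := by positivity
  have key : ∀ x, ∫ u, mpos u * (Tm (dualK P ν) (fun x _ => - f x) mpos ^ n) one1 x u * box 0 c u
      ≤ c * R := by
    intro x
    have e0 : c * R = ∫ u, box 0 c u * R := by rw [integral_mul_const, box_int 0 hc]
    rw [e0]
    refine integral_mono_of_nonneg (Eventually.of_forall fun u => ?_)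
      ((box_integrable 0 c).mul_const _) (Eventually.of_forall fun u => ?_)
    · exact mul_nonneg (mul_nonneg (mpos_nonneg _) (Tm_pow_nonneg hD.nonneg mpos_nonneg
        (by simp [one1]) n x u)) (box_nonneg _ _ _)
    · simp only
      rw [mul_comm]
      by_cases hu : 0 ≤ u ∧ u ≤ c
      · refine mul_le_mul_of_nonneg_left ?_ (box_nonneg _ _ _)
        have h1 := survive_le' M' n x u
        have h0 := Tm_pow_nonneg (P := dualK P ν) (w := fun x _ => - f x) hD.nonneg mpos_nonneg
          (g := one1) (by simp [one1]) n x u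
        have h2 : (Tm (dualK P ν) (fun x _ => - f x) mpos ^ n) one1 x u ≤ R := by
          refine h1.trans ?_
          rw [hR]
          have : max u 0 ≤ c := max_le hu.2 hc
          gcongr
        calc _ ≤ 1 * (Tm (dualK P ν) (fun x _ => - f x) mpos ^ n) one1 x u :=
              mul_le_mul_of_nonneg_right (mpos_le_one u) h0
          _ ≤ R := by simpa using h2
      · have : box 0 c u = 0 := by unfold box; rw [if_neg (by simpa using hu)]
        rw [this]; simp
  calc _ ≤ ∑ x, ν x * (c * R) :=
        Finset.sum_le_sum fun x _ => mul_le_mul_of_nonneg_left (key x) (hS.nuPos x).le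
    _ = c * R := by rw [← Finset.sum_mul, hS.nuSum, one_mul]

lemma sqrt_half_inv {n k : ℕ} (q : ℕ) (hq : 0 < q) (h : n + 1 ≤ q ^ 2 * k) {C : ℝ} (hC : 0 ≤ C) :
    C / √(k:ℝ) ≤ q * C / √((n:ℝ) + 1) := by
  have hk : 0 < k := by
    rcases Nat.eq_zero_or_pos k with rfl | h'
    · simp at h
    · exact h'
  have hk' : (0:ℝ) < k := by exact_mod_cast hk
  rw [div_le_div_iff₀ (by positivity) (by positivity)]
  have h1 : √((n:ℝ) + 1) ≤ q * √(k:ℝ) := by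
    rw [Real.sqrt_le_left (by positivity), mul_pow, Real.sq_sqrt (by positivity)]
    exact_mod_cast h
  nlinarith [mul_le_mul_of_nonneg_left h1 hC]

/-- uniform `1/n` bound for surviving and ending in a bounded strip -/
lemma strip_unif [Nonempty X] (hS : IsStochastic P ν) (h1 : Primitive P) (h2 : ∑ x, f x * ν x = 0)
    (h3 : NonLattice P f) (M : Mart P (fun _ x' => f x') α β s2 B) {c : ℝ} (hc : 0 ≤ c) :
    ∃ C : ℝ, 0 < C ∧ ∀ n : ℕ, ∀ (x : X) (y : ℝ),
      (Tm P (fun _ x' => f x') mpos ^ n) (fun _ u => box 0 c u) x y ≤ C / ((n:ℝ) + 1) := by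
  obtain ⟨α', β', s2', B', M'⟩ := dual_mart hS h1 h2 h3
  obtain ⟨C1, hC1, hL⟩ := llt_bound hS h1 h3 M (a := 1) one_pos
  have hcE := cExit_pos M'
  set R := (c + 1) * (4 * cExit s2' B' * (1 + (c + 1))) with hR
  have hR0 : 0 ≤ R := by positivity
  have hQ : 0 ≤ ∑ b, (ν b)⁻¹ := Finset.sum_nonneg fun b _ => inv_nonneg.mpr (hS.nuPos b).le
  set Q := ∑ b, (ν b)⁻¹
  refine ⟨4 * C1 * Q * R + 1, by positivity, fun n x y => ?_⟩
  set K := Tm P (fun _ x' => f x') mpos with hK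
  set T := Tm P (fun _ x' => f x') mone with hT
  rcases Nat.eq_zero_or_pos n with rfl | hn
  · have := box_le_one 0 c y
    have : 0 ≤ 4 * C1 * Q * R := by positivity
    simp; linarith
  obtain ⟨l, k, rfl, hl, hk⟩ : ∃ l k, n = l + (k + 1) ∧ n + 1 ≤ 2 ^ 2 * (l + 1) ∧
      n + 1 ≤ 2 ^ 2 * (k + 1) :=
    ⟨n / 2, n - n / 2 - 1, by omega, by omega, by omega⟩
  set H : X → ℝ → ℝ := (K ^ (k + 1)) (fun _ u => box 0 (c + 1) u) with hH
  have hHi : ∀ b, Integrable (H b) := Tm_pow_intble (fun _ => box_integrable 0 (c + 1)) (k + 1)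
  have hH0 : ∀ b u, 0 ≤ H b u := fun b u =>
    Tm_pow_nonneg hS.nonneg mpos_nonneg (fun _ _ => box_nonneg _ _ _) (k + 1) b u
  have hHs : ∀ b, ∫ u, H b u ≤ (ν b)⁻¹ * (R / √((k:ℝ) + 1)) := by
    intro b
    have h4 := int_strip_le hS M' (c := c + 1) (by linarith) k
    have h5 : ν b * ∫ u, H b u ≤ ∑ x, ν x * ∫ u, H x u :=
      Finset.single_le_sum (f := fun x => ν x * ∫ u, H x u) (fun x _ => mul_nonneg (hS.nuPos x).le
        (integral_nonneg (hH0 x))) (Finset.mem_univ b)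
    have h6 : ν b * ∫ u, H b u ≤ R / √((k:ℝ) + 1) := by
      refine h5.trans (h4.trans (le_of_eq ?_))
      rw [hR, ← mul_div_assoc]
    rw [inv_mul_eq_div, le_div_iff₀ (hS.nuPos b), mul_comm]
    exact h6
  set Hs : ℝ → ℝ := fun u => ∑ b, H b u with hHs'
  have hHsi : Integrable Hs := integrable_finsetSum _ fun b _ => hHi b
  have hHs0 : ∀ u, 0 ≤ Hs u := fun u => Finset.sum_nonneg fun b _ => hH0 b u
  have hHsint : ∫ u, Hs u ≤ Q * (R / √((k:ℝ) + 1)) := by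
    rw [hHs', integral_finsetSum _ fun b _ => hHi b, Finset.sum_mul]
    exact Finset.sum_le_sum fun b _ => hHs b
  have hFi : ∀ (v : ℝ), Integrable (fun u => Hs u * box (u - 1) 1 v) := by
    intro v
    have e : ∀ u, box (u - 1) 1 v = box v 1 u := by
      intro u; unfold box; congr 1; apply propext; constructor <;> rintro ⟨a, b⟩ <;>
        constructor <;> linarith
    simp_rw [e]
    have := hHsi.bdd_mul (c := 1) (box_meas v 1).aestronglyMeasurable
      (Eventually.of_forall fun u => by
        rw [Real.norm_eq_abs, abs_of_nonneg (box_nonneg _ _ _)]; exact box_le_one _ _ _)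
    simpa [mul_comm] using this
  have hdom : ∀ (b : X) (v : ℝ), (K ^ (k + 1)) (fun _ u => box 0 c u) b v ≤
      ∫ u, Hs u * box (u - 1) 1 v := by
    intro b v
    have e : ∀ u, box (u - 1) 1 v = box v 1 u := by
      intro u; unfold box; congr 1; apply propext; constructor <;> rintro ⟨a, b⟩ <;>
        constructor <;> linarith
    have i := hFi v
    simp_rw [e] at i ⊢
    set A := (K ^ (k + 1)) (fun _ u => box 0 c u) b v with hA
    have : A = ∫ u, A * box v 1 u := by
      rw [integral_const_mul, box_int v zero_le_one, mul_one]
    rw [this]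
    refine integral_mono ((box_integrable v 1).const_mul _) i fun u => ?_
    simp only
    by_cases hu : v ≤ u ∧ u ≤ v + 1
    · refine mul_le_mul_of_nonneg_right ?_ (box_nonneg _ _ _)
      have h7 := shift_mono (w := fun _ x' => f x') hS.nonneg (g := fun (_ : X) u => box 0 c u)
        (g' := fun _ u => box 0 (c + 1) u) (fun _ _ => box_nonneg _ _ _) (by
          intro x v u h8 h9
          unfold box
          split_ifs with h10 h11 h11
          · exact le_rfl
          · exfalso; apply h11; constructor <;> linarith [h10.1, h10.2]
          · norm_num
          · norm_num) (k + 1) b v u hu.1 hu.2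
      exact h7.trans (Finset.single_le_sum (f := fun b => H b u) (fun b _ => hH0 b u)
        (Finset.mem_univ b))
    · have : box v 1 u = 0 := by unfold box; rw [if_neg hu]
      rw [this]; simp
  have hI := Tm_pow_integral (P := P) (w := fun _ x' => f x') (mk := mone) volume
    (fun u (_ : X) v => Hs u * box (u - 1) 1 v) (fun _ v => hFi v) l x y
  have hh0 : ∀ b v, 0 ≤ (K ^ (k + 1)) (fun _ u => box 0 c u) b v := fun b v =>
    Tm_pow_nonneg hS.nonneg mpos_nonneg (fun _ _ => box_nonneg _ _ _) (k + 1) b v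
  rw [pow_add, Module.End.mul_apply]
  have s1 : (K ^ l) ((K ^ (k + 1)) (fun _ u => box 0 c u)) x y ≤
      (T ^ l) (fun _ v => ∫ u, Hs u * box (u - 1) 1 v) x y :=
    (Tm_pow_mask_mono hS.nonneg mpos_nonneg mpos_le_one hh0 l x y).trans
      (Tm_pow_mono hS.nonneg (fun _ => zero_le_one) hdom l x y)
  have s2 : ∫ u, (T ^ l) (fun (_ : X) v => Hs u * box (u - 1) 1 v) x y ≤
      ∫ u, Hs u * (C1 / √((l:ℝ) + 1)) := by
    refine integral_mono hI.1 (hHsi.mul_const _) fun u => ?_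
    have e : (fun (_ : X) v => Hs u * box (u - 1) 1 v) = Hs u • (fun (_ : X) v => box (u - 1) 1 v) := by
      funext b v; simp
    simp only
    rw [e, map_smul]
    exact mul_le_mul_of_nonneg_left (hL l x y (u - 1)) (hHs0 u)
  have s3 : (T ^ l) (fun _ v => ∫ u, Hs u * box (u - 1) 1 v) x y =
    ∫ u, (T ^ l) (fun (_ : X) v => Hs u * box (u - 1) 1 v) x y := hI.2
  refine s1.trans (s3.le.trans (s2.trans ?_))
  rw [integral_mul_const]
  have b1 := sqrt_half_inv 2 (by norm_num) hl hC1.le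
  have b2 := sqrt_half_inv 2 (by norm_num) hk (mul_nonneg hQ hR0)
  push_cast at b1 b2 ⊢
  set N : ℝ := (l:ℝ) + ((k:ℝ) + 1) + 1 with hN
  have hN0 : 0 < N := by positivity
  have hH1 : ∫ u, Hs u ≤ 2 * (Q * R) / √N := by
    refine hHsint.trans (le_trans (le_of_eq ?_) b2); ring
  calc (∫ u, Hs u) * (C1 / √((l:ℝ) + 1)) ≤ (2 * (Q * R) / √N) * (2 * C1 / √N) := by
        apply mul_le_mul hH1 b1 (by positivity) (by positivity)
    _ = 4 * C1 * Q * R / N := by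
        rw [div_mul_div_comm, Real.mul_self_sqrt hN0.le]; ring
    _ ≤ _ := by gcongr; linarith

lemma kbound [Nonempty X] (hS : IsStochastic P ν) (h1 : Primitive P)
    (h3 : NonLattice P f) (M : Mart P (fun _ x' => f x') α β s2 B) {a : ℝ} (ha : 0 < a) :
    ∃ C : ℝ, 0 < C ∧ ∀ n : ℕ, ∀ (x : X) (y z : ℝ),
      (Tm P (fun _ x' => f x') mpos ^ n) (fun _ u => box z a u) x y ≤
        C * (1 + max y 0) / ((n:ℝ) + 1) := by
  obtain ⟨C1, hC1, hL⟩ := llt_bound hS h1 h3 M ha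
  have hcE := cExit_pos M
  refine ⟨4 * C1 * (4 * cExit s2 B), by positivity, fun n x y z => ?_⟩
  have hmx : 0 ≤ max y 0 := le_max_right _ _
  obtain ⟨l, k, rfl, hl, hk⟩ : ∃ l k, n = l + k ∧ n + 1 ≤ 2 ^ 2 * (l + 1) ∧
      n + 1 ≤ 2 ^ 2 * (k + 1) :=
    ⟨n / 2, n - n / 2, by omega, by omega, by omega⟩
  rw [pow_add, Module.End.mul_apply]
  have hb : ∀ (x : X) y, (Tm P (fun _ x' => f x') mpos ^ k) (fun _ u => box z a u) x y ≤
      C1 / √((k:ℝ) + 1) * one1 x y := fun x y => by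
    simp only [one1, mul_one]
    exact (Tm_pow_mask_mono hS.nonneg mpos_nonneg mpos_le_one (fun _ _ => box_nonneg _ _ _)
      k x y).trans (hL k x y z)
  have s1 := Tm_pow_smul_le (w := fun _ x' => f x') hS.nonneg mpos_nonneg Set.univ
    (fun _ _ => trivial) _ (fun x y _ => hb x y) l x y trivial
  have sv := survive_le' M l x y
  refine s1.trans ?_
  have b1 := sqrt_half_inv 2 (by norm_num) hk hC1.le
  have b2 := sqrt_half_inv 2 (by norm_num) hl
    (show 0 ≤ 4 * cExit s2 B * (1 + max y 0) by positivity)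
  push_cast at b1 b2 ⊢
  set N : ℝ := (l:ℝ) + (k:ℝ) + 1 with hN
  have hN0 : 0 < N := by positivity
  calc _ ≤ (2 * C1 / √N) * (2 * (4 * cExit s2 B * (1 + max y 0)) / √N) := by
        apply mul_le_mul b1 (sv.trans b2) (Tm_pow_nonneg hS.nonneg mpos_nonneg (by simp [one1]) l x y)
          (by positivity)
    _ = _ := by
        rw [div_mul_div_comm, Real.mul_self_sqrt hN0.le]; ring

/-- exit at time exactly `j+1` -/
lemma exit_bound [Nonempty X] (hS : IsStochastic P ν) (h1 : Primitive P) (h2 : ∑ x, f x * ν x = 0)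
    (h3 : NonLattice P f) (M : Mart P (fun _ x' => f x') α β s2 B) :
    ∃ C : ℝ, 0 < C ∧ ∀ n : ℕ, ∀ (x : X) (y : ℝ),
      (Tm P (fun _ x' => f x') mpos ^ n) (Tm P (fun _ x' => f x') mneg one1) x y ≤
        C * (1 + max y 0) / (((n:ℝ) + 1) * √((n:ℝ) + 1)) := by
  have hB := M.hB
  obtain ⟨C1, hC1, hL⟩ := strip_unif hS h1 h2 h3 M (c := B) (by linarith)
  have hcE := cExit_pos M
  refine ⟨8 * C1 * (4 * cExit s2 B) + 1, by positivity, fun n x y => ?_⟩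
  have hmx : 0 ≤ max y 0 := le_max_right _ _
  have hD1 := fun x y => Tm_one_le (w := fun _ x' => f x') hS.nonneg hS.rowSum mneg_le_one x y
  rcases Nat.eq_zero_or_pos n with rfl | hn
  · have := hD1 x y
    have : 0 ≤ 8 * C1 * (4 * cExit s2 B) := by positivity
    simp; nlinarith
  obtain ⟨n, rfl⟩ : ∃ n', n = n' + 1 := ⟨n - 1, by omega⟩
  have s0 := Tm_pow_succ_mono_on (w := fun _ x' => f x') hS.nonneg mpos_nonneg (Set.Ioi 0)
    (fun y hy => by unfold mpos at hy; by_contra h; simp only [Set.mem_Ioi] at h; simp [h] at hy)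
    (g := Tm P (fun _ x' => f x') mneg one1) (h := fun _ u => box 0 B u) (by
      intro x y hy
      by_cases hyB : y ≤ B
      · have : box 0 B y = 1 := by
          unfold box; rw [if_pos]; exact ⟨le_of_lt hy, by linarith⟩
        rw [this]; exact hD1 x y
      · refine le_trans (le_of_eq ?_) (box_nonneg _ _ _)
        rw [Tm_apply]
        refine Finset.sum_eq_zero fun x' _ => ?_
        have := M.hw x x'
        have h4 := (abs_le.mp this).1
        have : mneg (y + f x') = 0 := by unfold mneg; rw [if_pos]; linarith
        rw [this]; simp) n x y
  refine s0.trans ?_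
  obtain ⟨l, k, hlk, hl, hk⟩ : ∃ l k, n + 1 = l + k ∧ n + 1 + 1 ≤ 2 ^ 2 * (l + 1) ∧
      n + 1 + 1 ≤ 4 * (k + 1) :=
    ⟨(n + 1) / 2, (n + 1) - (n + 1) / 2, by omega, by omega, by omega⟩
  rw [hlk, pow_add, Module.End.mul_apply]
  rw [hlk] at hl hk
  have hb : ∀ (x : X) y, (Tm P (fun _ x' => f x') mpos ^ k) (fun _ u => box 0 B u) x y ≤
      C1 / ((k:ℝ) + 1) * one1 x y := fun x y => by
    simp only [one1, mul_one]
    exact hL k x y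
  have s1 := Tm_pow_smul_le (w := fun _ x' => f x') hS.nonneg mpos_nonneg Set.univ
    (fun _ _ => trivial) _ (fun x y _ => hb x y) l x y trivial
  have sv := survive_le' M l x y
  refine s1.trans ?_
  have b2 := sqrt_half_inv 2 (by norm_num) hl
    (show 0 ≤ 4 * cExit s2 B * (1 + max y 0) by positivity)
  have hk' : ((l + k : ℕ):ℝ) + 1 ≤ 4 * ((k:ℝ) + 1) := by exact_mod_cast hk
  push_cast at b2 hk' ⊢
  set N : ℝ := (l:ℝ) + (k:ℝ) + 1 with hN
  have hN0 : 0 < N := by positivity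
  have b1 : C1 / ((k:ℝ) + 1) ≤ 4 * C1 / N := by
    rw [div_le_div_iff₀ (by positivity) hN0]; nlinarith
  calc _ ≤ (4 * C1 / N) * (2 * (4 * cExit s2 B * (1 + max y 0)) / √N) := by
        apply mul_le_mul b1 (sv.trans b2) (Tm_pow_nonneg hS.nonneg mpos_nonneg (by simp [one1]) l x y)
          (by positivity)
    _ = 8 * C1 * (4 * cExit s2 B) * (1 + max y 0) / (N * √N) := by
        rw [div_mul_div_comm]; ring
    _ ≤ _ := by gcongr; linarith

end

section
variable [Fintype X] [DecidableEq X] {P : X → X → ℝ} {ν f : X → ℝ} {α β : X → ℝ} {s2 B : ℝ}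

/-- the box test function -/
noncomputable def gz (ψ : X → ℝ) (z a : ℝ) : X → ℝ → ℝ := fun x u => ψ x * box z a u

lemma gz_nonneg {ψ : X → ℝ} (hψ : ∀ b, 0 ≤ ψ b) (z a : ℝ) (x : X) (u : ℝ) : 0 ≤ gz ψ z a x u :=
  mul_nonneg (hψ x) (box_nonneg _ _ _)

lemma gz_le {ψ : X → ℝ} (hψ : ∀ b, 0 ≤ ψ b) (z a : ℝ) (x : X) (u : ℝ) :
    gz ψ z a x u ≤ (∑ b, ψ b) * box z a u :=
  mul_le_mul_of_nonneg_right (Finset.single_le_sum (f := ψ) (fun b _ => hψ b) (Finset.mem_univ x))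
    (box_nonneg _ _ _)

lemma tendsto_inv_sqrt : Tendsto (fun n : ℕ => (√(n:ℝ))⁻¹) atTop (𝓝 0) :=
  tendsto_inv_atTop_zero.comp (Real.tendsto_sqrt_atTop.comp tendsto_natCast_atTop_atTop)

lemma exists_inv_sqrt_lt (C : ℝ) {ε : ℝ} (hε : 0 < ε) :
    ∃ N : ℕ, ∀ n : ℕ, N ≤ n → C * (√(n:ℝ))⁻¹ < ε := by
  have := tendsto_inv_sqrt.const_mul C
  rw [mul_zero] at this
  exact eventually_atTop.mp (this.eventually_lt_const hε)

lemma sum_inv_sqrt (n : ℕ) : ∑ i ∈ range n, 1 / √((i:ℝ) + 1) ≤ 2 * √(n:ℝ) := by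
  induction n with
  | zero => simp
  | succ n ih =>
    rw [Finset.sum_range_succ]
    have h0 : 0 ≤ (n:ℝ) := Nat.cast_nonneg n
    have h1 := Real.sq_sqrt h0
    have h2 := Real.sq_sqrt (show 0 ≤ (n:ℝ) + 1 by linarith)
    have h3 : 0 < √((n:ℝ) + 1) := by positivity
    have h4 := Real.sqrt_nonneg (n:ℝ)
    have h5 : 1 / √((n:ℝ) + 1) ≤ 2 * √((n:ℝ) + 1) - 2 * √(n:ℝ) := by
      rw [div_le_iff₀ h3]
      nlinarith [sq_nonneg (√((n:ℝ) + 1) - √(n:ℝ))]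
    push_cast
    linarith

lemma odd_bound [Nonempty X] (hS : IsStochastic P ν) (h1 : Primitive P) (h3 : NonLattice P f)
    (M : Mart P (fun _ x' => f x') α β s2 B) {ψ : X → ℝ} (hψ : ∀ b, 0 ≤ ψ b) {a : ℝ} (ha : 0 < a)
    {ε : ℝ} (hε : 0 < ε) : ∃ N : ℕ, ∀ n : ℕ, N ≤ n → ∀ (x : X) (v z : ℝ), - B ≤ v → v ≤ 0 →
      |(Tm P (fun _ x' => f x') mone ^ n) (gz ψ z a - gz ψ (-z - a) a) x v| ≤ ε / √((n:ℝ) + 1) := by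
  obtain ⟨N, hN⟩ := llt hS h1 h3 M hψ ha (show 0 < ε / 8 by positivity)
  have hm : 0 ≤ ∑ b, ψ b * ν b := Finset.sum_nonneg fun b _ => mul_nonneg (hψ b) (hS.nuPos b).le
  set m := ∑ b, ψ b * ν b
  have hB := M.hB
  have hL := gLip_pos M.hs
  obtain ⟨N2, hN2⟩ := exists_inv_sqrt_lt (a * m * (gLip s2 * (2 * B + a)))
    (show 0 < ε / 4 by positivity)
  refine ⟨max 1 (max N N2), fun n hn x v z hv1 hv2 => ?_⟩
  have hn1 : 1 ≤ n := le_of_max_le_left hn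
  have hn1' : (1:ℝ) ≤ n := by exact_mod_cast hn1
  have hn2 := le_of_max_le_left (le_of_max_le_right hn)
  have hn3 := le_of_max_le_right (le_of_max_le_right hn)
  have a1 := hN n hn2 x v z
  have a2 := hN n hn2 x v (-z - a)
  have a3 := hN2 n hn3
  rw [map_sub, Pi.sub_apply, Pi.sub_apply]
  change |√(n:ℝ) * (Tm P (fun _ x' => f x') mone ^ n) (gz ψ z a) x v - _| ≤ _ at a1
  change |√(n:ℝ) * (Tm P (fun _ x' => f x') mone ^ n) (gz ψ (-z - a) a) x v - _| ≤ _ at a2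
  set A := (Tm P (fun _ x' => f x') mone ^ n) (gz ψ z a) x v
  set A' := (Tm P (fun _ x' => f x') mone ^ n) (gz ψ (-z - a) a) x v
  have hsn : 0 < √(n:ℝ) := by positivity
  have a4 : |gam s2 ((v - z) / √(n:ℝ)) - gam s2 ((v - (-z - a)) / √(n:ℝ))| ≤
      gLip s2 * ((2 * B + a) * (√(n:ℝ))⁻¹) := by
    rw [← gam_neg ((v - z) / √(n:ℝ))]
    refine (gam_lip M.hs _ _).trans ?_
    refine mul_le_mul_of_nonneg_left ?_ hL.le
    rw [← neg_div, ← sub_div, abs_div, abs_of_pos hsn, div_eq_mul_inv]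
    refine mul_le_mul_of_nonneg_right ?_ (by positivity)
    rw [abs_le]; constructor <;> linarith
  have a5 : |a * m * gam s2 ((v - z) / √(n:ℝ)) - a * m * gam s2 ((v - (-z - a)) / √(n:ℝ))| ≤ ε / 4 := by
    rw [← mul_sub, abs_mul, abs_of_nonneg (by positivity)]
    refine (mul_le_mul_of_nonneg_left a4 (by positivity)).trans ?_
    linarith
  have a6 : √(n:ℝ) * |A - A'| ≤ ε / 2 := by
    rw [← abs_of_pos hsn, ← abs_mul]
    rw [abs_le] at a1 a2 a5 ⊢
    constructor <;> linarith
  rw [le_div_iff₀ (by positivity)]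
  have : √((n:ℝ) + 1) ≤ 2 * √(n:ℝ) := by
    rw [Real.sqrt_le_left (by positivity), mul_pow, Real.sq_sqrt (by positivity)]; linarith
  nlinarith [abs_nonneg (A - A')]

lemma sum_exit_le (hS : IsStochastic P ν) (n : ℕ) (x : X) (y : ℝ) :
    ∑ j ∈ range n, (Tm P (fun _ x' => f x') mpos ^ j) (Tm P (fun _ x' => f x') mneg one1) x y ≤ 1 := by
  have h := pow_decomp (Tm P (fun _ x' => f x') mpos) (Tm P (fun _ x' => f x') mneg) 0 n
  rw [← Tm_one_eq] at h
  have hT : ∀ k, (Tm P (fun _ x' => f x') mone ^ k) one1 = one1 := by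
    intro k
    induction k with
    | zero => simp
    | succ k ih =>
      rw [pow_succ', Module.End.mul_apply, ih]
      funext x u
      simp [Tm_apply, mone, one1, hS.rowSum]
  have h2 := congrFun (congrFun (LinearMap.congr_fun h one1) x) y
  simp only [LinearMap.add_apply, Module.End.mul_apply, LinearMap.sum_apply, Pi.add_apply,
    Finset.sum_apply, add_zero, hT, pow_zero, Module.End.one_apply] at h2
  have h3 := Tm_pow_nonneg (w := fun _ x' => f x') hS.nonneg mpos_nonneg (g := one1)
    (by simp [one1]) n x y
  have h4 : one1 x y = (1:ℝ) := rfl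
  linarith

lemma mpos_Ioi (y : ℝ) (hy : mpos y ≠ 0) : y ∈ Set.Ioi (0:ℝ) := by
  unfold mpos at hy; by_contra h; simp only [Set.mem_Ioi] at h; simp [h] at hy

/-- Dirichlet local limit theorem by reflection. -/
lemma dirichlet [Nonempty X] (hS : IsStochastic P ν) (h1 : Primitive P) (h2 : ∑ x, f x * ν x = 0)
    (h3 : NonLattice P f)
    (M : Mart P (fun _ x' => f x') α β s2 B) {ψ : X → ℝ} (hψ : ∀ b, 0 ≤ ψ b) {a : ℝ} (ha : 0 < a)
    {Q ε : ℝ} (hQ : 0 < Q) (hε : 0 < ε) : ∃ N : ℕ, ∀ n : ℕ, N ≤ n → ∀ (x : X) (y z : ℝ), 0 < y →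
      y ≤ Q * √(n:ℝ) → 0 ≤ z →
      |√(n:ℝ) * (Tm P (fun _ x' => f x') mpos ^ n) (gz ψ z a) x y -
        a * (∑ b, ψ b * ν b) * (gam s2 ((z - y) / √(n:ℝ)) - gam s2 ((z + y) / √(n:ℝ)))| ≤ ε := by
  obtain ⟨Ce, hCe, hexit⟩ := exit_bound hS h1 h2 h3 M
  obtain ⟨Cb, hCb, hbound⟩ := llt_bound hS h1 h3 M ha
  have hm : 0 ≤ ∑ b, ψ b * ν b := Finset.sum_nonneg fun b _ => mul_nonneg (hψ b) (hS.nuPos b).le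
  have hΨ : 0 ≤ ∑ b, ψ b := Finset.sum_nonneg fun b _ => hψ b
  have hB := M.hB
  have hL := gLip_pos M.hs
  set m := ∑ b, ψ b * ν b
  set Ψ := ∑ b, ψ b
  set ε1 := ε / (8 * (1 + 3 * Ce * (1 + Q))) with hε1
  have hε1p : 0 < ε1 := by positivity
  obtain ⟨N1, hN1⟩ := odd_bound hS h1 h3 M hψ ha hε1p
  obtain ⟨N2, hN2⟩ := llt hS h1 h3 M hψ ha (show 0 < ε / 8 by positivity)
  obtain ⟨N3, hN3⟩ := exists_inv_sqrt_lt (a * m * (gLip s2 * a)) (show 0 < ε / 8 by positivity)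
  obtain ⟨N4, hN4⟩ := exists_inv_sqrt_lt (3 * Ce * (1 + Q) * (2 * Ψ * Cb * N1))
    (show 0 < ε / 8 by positivity)
  refine ⟨max (2 * N1 + 2) (max N2 (max N3 N4)), fun n hn x y z hy hyQ hz => ?_⟩
  have hn1 : 2 * N1 + 2 ≤ n := le_of_max_le_left hn
  have hnN := le_of_max_le_right hn
  have hn2 : N2 ≤ n := le_of_max_le_left hnN
  have hn3 : N3 ≤ n := le_of_max_le_left (le_of_max_le_right hnN)
  have hn4 : N4 ≤ n := le_of_max_le_right (le_of_max_le_right hnN)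
  have hn0 : (1:ℝ) ≤ n := by exact_mod_cast (show 1 ≤ n by omega)
  have hs1 : 1 ≤ √(n:ℝ) := by rw [Real.one_le_sqrt]; exact hn0
  have hsn : 0 < √(n:ℝ) := by linarith
  set K := Tm P (fun _ x' => f x') mpos with hK
  set D := Tm P (fun _ x' => f x') mneg with hD
  set T := Tm P (fun _ x' => f x') mone with hT
  set G := gz ψ z a - gz ψ (-z - a) a with hG
  -- the reflected term is killed
  have hkill : (K ^ n) (gz ψ (-z - a) a) x y = 0 := by
    have hz0 : ∀ x, ∀ u ∈ Set.Ioi (0:ℝ), |gz ψ (-z - a) a x u| ≤ 0 * one1 x u := by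
      intro x u hu
      have hu' : 0 < u := hu
      have : box (-z - a) a u = 0 := by unfold box; rw [if_neg]; intro h; linarith [h.2]
      simp [gz, this]
    have := Tm_pow_abs_le (w := fun _ x' => f x') hS.nonneg mpos_nonneg (Set.Ioi 0) mpos_Ioi 0 hz0
      n x y hy
    rw [zero_mul] at this
    exact abs_nonpos_iff.mp this
  -- the decomposition
  have hdec : (K ^ n) (gz ψ z a) x y = (T ^ n) G x y -
      ∑ j ∈ range n, (K ^ j) (D ((T ^ (n - 1 - j)) G)) x y := by
    have h := pow_decomp K D 0 n
    rw [hK, hD, ← Tm_one_eq, ← hK, ← hD, ← hT] at h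
    have h5 := congrFun (congrFun (LinearMap.congr_fun h G) x) y
    simp only [LinearMap.add_apply, Module.End.mul_apply, LinearMap.sum_apply, Pi.add_apply,
      Finset.sum_apply, add_zero, pow_zero, Module.End.one_apply] at h5
    have h6 : (K ^ n) G x y = (K ^ n) (gz ψ z a) x y := by
      rw [hG, map_sub, Pi.sub_apply, Pi.sub_apply, hkill, sub_zero]
    rw [h5, h6]; ring
  -- bound on the odd part
  set e : ℕ → ℝ := fun i => (ε1 + if i < N1 then 2 * Ψ * Cb else 0) * (1 / √((i:ℝ) + 1)) with he
  have he0 : ∀ i, 0 ≤ e i := by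
    intro i
    simp only [he]
    split_ifs <;> positivity
  have hTb : ∀ (i : ℕ) (x : X) (v z : ℝ), |(T ^ i) (gz ψ z a) x v| ≤ Ψ * Cb / √((i:ℝ) + 1) := by
    intro i x v z
    have := Tm_pow_abs_le (w := fun _ x' => f x') hS.nonneg (m := mone) (fun _ => zero_le_one)
      Set.univ (fun _ _ => trivial) (g := gz ψ z a) (h := fun _ u => box z a u) Ψ (by
        intro x u _
        rw [abs_of_nonneg (gz_nonneg hψ _ _ _ _)]
        exact gz_le hψ _ _ _ _) i x v trivial
    refine this.trans ?_
    rw [mul_div_assoc]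
    exact mul_le_mul_of_nonneg_left (hbound i x v z) hΨ
  have hodd : ∀ (i : ℕ) (x : X) (v : ℝ), -B ≤ v → v ≤ 0 → |(T ^ i) G x v| ≤ e i := by
    intro i x v hv1 hv2
    simp only [he]
    split_ifs with hi
    · rw [hG, map_sub, Pi.sub_apply, Pi.sub_apply]
      refine (abs_sub _ _).trans ?_
      have b1 := hTb i x v z
      have b2 := hTb i x v (-z - a)
      have : 0 ≤ ε1 * (1 / √((i:ℝ) + 1)) := by positivity
      rw [add_mul]
      have e : 2 * Ψ * Cb * (1 / √((i:ℝ) + 1)) = Ψ * Cb / √((i:ℝ) + 1) + Ψ * Cb / √((i:ℝ) + 1) := by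
        ring
      linarith
    · have := hN1 i (not_lt.mp hi) x v z hv1 hv2
      rw [add_zero, mul_one_div]
      exact this
  have hterm : ∀ j i, |(K ^ j) (D ((T ^ i) G)) x y| ≤ e i * (K ^ j) (D one1) x y := by
    intro j i
    refine Tm_pow_abs_le (w := fun _ x' => f x') hS.nonneg mpos_nonneg (Set.Ioi 0) mpos_Ioi (e i)
      (fun x u hu => ?_) j x y hy
    have hu' : 0 < u := hu
    rw [hD, Tm_apply, Tm_apply, Finset.mul_sum]
    refine (Finset.abs_sum_le_sum_abs _ _).trans (Finset.sum_le_sum fun x' _ => ?_)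
    have hw := (abs_le.mp (M.hw x x')).1
    rw [abs_mul, abs_mul, abs_of_nonneg (hS.nonneg x x'), abs_of_nonneg (mneg_nonneg _)]
    by_cases h : 0 < u + f x'
    · have : mneg (u + f x') = 0 := by unfold mneg; rw [if_pos h]
      rw [this]; simp
    · have := hodd i x' (u + f x') (by linarith) (not_lt.mp h)
      simp only [one1, mul_one]
      calc _ ≤ P x x' * (mneg (u + f x') * e i) := by
            gcongr
            · exact hS.nonneg x x'
            · exact mneg_nonneg _
        _ = _ := by ring
  have hq0 : ∀ j, 0 ≤ (K ^ j) (D one1) x y := fun j =>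
    Tm_pow_nonneg hS.nonneg mpos_nonneg (fun x u => Tm_nonneg hS.nonneg mneg_nonneg
      (by simp [one1]) x u) j x y
  have hmy : max y 0 = y := max_eq_left hy.le
  have hterm2 : ∀ j ∈ range n, √(n:ℝ) * |(K ^ j) (D ((T ^ (n - 1 - j)) G)) x y| ≤
      2 * ε1 * (K ^ j) (D one1) x y + 3 * Ce * (1 + Q) * (√(n:ℝ))⁻¹ * e (n - 1 - j) := by
    intro j hj
    rw [Finset.mem_range] at hj
    have t1 := mul_le_mul_of_nonneg_left (hterm j (n - 1 - j)) hsn.le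
    have q0 := hq0 j
    have e0 := he0 (n - 1 - j)
    by_cases hc : 2 * (j + 1) ≤ n
    · have hi : ¬ (n - 1 - j < N1) := by omega
      have t2 : √(n:ℝ) * e (n - 1 - j) ≤ 2 * ε1 := by
        simp only [he]
        rw [if_neg hi, add_zero]
        have hcast : (n:ℝ) ≤ 2 ^ 2 * (((n - 1 - j : ℕ):ℝ) + 1) := by
          exact_mod_cast (show n ≤ 2 ^ 2 * ((n - 1 - j) + 1) by omega)
        have : √(n:ℝ) ≤ 2 * √(((n - 1 - j : ℕ):ℝ) + 1) := by
          rw [Real.sqrt_le_left (by positivity), mul_pow, Real.sq_sqrt (by positivity)]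
          exact hcast
        rw [mul_one_div, mul_div_assoc', div_le_iff₀ (by positivity)]
        nlinarith
      have t3 := mul_le_mul_of_nonneg_right t2 q0
      have t4 : 0 ≤ 3 * Ce * (1 + Q) * (√(n:ℝ))⁻¹ * e (n - 1 - j) := by positivity
      linarith
    · have t2 : (K ^ j) (D one1) x y ≤ 3 * Ce * (1 + Q) / n := by
        refine (hexit j x y).trans ?_
        rw [hmy]
        have j1 : (n:ℝ) ≤ 2 * ((j:ℝ) + 1) := by
          exact_mod_cast (show n ≤ 2 * (j + 1) by omega)
        have j2 : √(n:ℝ) ≤ (3/2) * √((j:ℝ) + 1) := by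
          rw [Real.sqrt_le_left (by positivity), mul_pow, Real.sq_sqrt (by positivity)]
          linarith
        have j3 : 1 + y ≤ (1 + Q) * √(n:ℝ) := by nlinarith
        rw [div_le_div_iff₀ (by positivity) (by positivity)]
        calc Ce * (1 + y) * n ≤ Ce * ((1 + Q) * ((3/2) * √((j:ℝ) + 1))) * (2 * ((j:ℝ) + 1)) := by
              gcongr
              exact j3.trans (by gcongr)
          _ = _ := by ring
      have t3 := mul_le_mul_of_nonneg_left t2 (mul_nonneg hsn.le e0)
      have t4 : √(n:ℝ) * e (n - 1 - j) * (3 * Ce * (1 + Q) / n) =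
          3 * Ce * (1 + Q) * (√(n:ℝ))⁻¹ * e (n - 1 - j) := by
        have : (n:ℝ) = √(n:ℝ) * √(n:ℝ) := (Real.mul_self_sqrt (by linarith)).symm
        rw [show 3 * Ce * (1 + Q) / (n:ℝ) = 3 * Ce * (1 + Q) / (√(n:ℝ) * √(n:ℝ)) by rw [← this]]
        field_simp
      have t5 : 0 ≤ 2 * ε1 * (K ^ j) (D one1) x y := by positivity
      linarith
  have hsume : ∑ j ∈ range n, e (n - 1 - j) ≤ 2 * ε1 * √(n:ℝ) + 2 * Ψ * Cb * N1 := by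
    rw [Finset.sum_range_reflect e n]
    have : ∀ i ∈ range n, e i ≤ ε1 * (1 / √((i:ℝ) + 1)) + (if i < N1 then 2 * Ψ * Cb else 0) := by
      intro i _
      simp only [he]
      rw [add_mul]
      have h7 : 1 / √((i:ℝ) + 1) ≤ 1 := by
        rw [div_le_one (by positivity), Real.one_le_sqrt]
        have : (0:ℝ) ≤ i := Nat.cast_nonneg i
        linarith
      split_ifs
      · have : 0 ≤ 2 * Ψ * Cb := by positivity
        nlinarith
      · simp
    refine (Finset.sum_le_sum this).trans ?_
    rw [Finset.sum_add_distrib, ← Finset.mul_sum]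
    have h8 := sum_inv_sqrt n
    have h9 : ∑ i ∈ range n, (if i < N1 then 2 * Ψ * Cb else 0) ≤ 2 * Ψ * Cb * N1 := by
      rw [← Finset.sum_filter, Finset.sum_const, nsmul_eq_mul, mul_comm]
      have h10 : ((range n).filter (fun i => i < N1)).card ≤ N1 := by
        calc _ ≤ (range N1).card := Finset.card_le_card (by
              intro i hi; simp at hi ⊢; exact hi.2)
          _ = N1 := Finset.card_range _
      have h10' : (((range n).filter (fun i => i < N1)).card : ℝ) ≤ N1 := by exact_mod_cast h10
      exact mul_le_mul_of_nonneg_left h10' (by positivity)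
    nlinarith
  have hsum : √(n:ℝ) * |∑ j ∈ range n, (K ^ j) (D ((T ^ (n - 1 - j)) G)) x y| ≤ 3 * ε / 8 := by
    have u1 : √(n:ℝ) * |∑ j ∈ range n, (K ^ j) (D ((T ^ (n - 1 - j)) G)) x y| ≤
        ∑ j ∈ range n, √(n:ℝ) * |(K ^ j) (D ((T ^ (n - 1 - j)) G)) x y| := by
      rw [← Finset.mul_sum]
      exact mul_le_mul_of_nonneg_left (Finset.abs_sum_le_sum_abs _ _) hsn.le
    have u2 := u1.trans (Finset.sum_le_sum hterm2)
    rw [Finset.sum_add_distrib, ← Finset.mul_sum, ← Finset.mul_sum] at u2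
    have u3 := sum_exit_le (f := f) hS n x y
    have u4 := hN4 n hn4
    have u5 : 3 * Ce * (1 + Q) * (√(n:ℝ))⁻¹ * ∑ j ∈ range n, e (n - 1 - j) ≤
        6 * Ce * (1 + Q) * ε1 + ε / 8 := by
      refine (mul_le_mul_of_nonneg_left hsume (by positivity)).trans ?_
      have : 3 * Ce * (1 + Q) * (√(n:ℝ))⁻¹ * (2 * ε1 * √(n:ℝ) + 2 * Ψ * Cb * N1) =
        6 * Ce * (1 + Q) * ε1 + 3 * Ce * (1 + Q) * (2 * Ψ * Cb * N1) * (√(n:ℝ))⁻¹ := by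
        field_simp; ring
      rw [this]; linarith
    have u6 : 2 * ε1 + 6 * Ce * (1 + Q) * ε1 = ε / 4 := by
      rw [hε1]; field_simp; ring
    have u7 := mul_le_mul_of_nonneg_left u3 (show 0 ≤ 2 * ε1 by positivity)
    linarith
  -- the free part
  have a1 := hN2 n hn2 x y z
  have a2 := hN2 n hn2 x y (-z - a)
  change |√(n:ℝ) * (T ^ n) (gz ψ z a) x y - _| ≤ _ at a1
  change |√(n:ℝ) * (T ^ n) (gz ψ (-z - a) a) x y - _| ≤ _ at a2
  have a3 := hN3 n hn3
  have a4 : |gam s2 ((y - (-z - a)) / √(n:ℝ)) - gam s2 ((z + y) / √(n:ℝ))| ≤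
      gLip s2 * (a * (√(n:ℝ))⁻¹) := by
    refine (gam_lip M.hs _ _).trans ?_
    refine mul_le_mul_of_nonneg_left ?_ hL.le
    rw [← sub_div, abs_div, abs_of_pos hsn, div_eq_mul_inv]
    refine mul_le_mul_of_nonneg_right ?_ (by positivity)
    rw [abs_le]; constructor <;> linarith
  have a5 : |a * m * gam s2 ((y - (-z - a)) / √(n:ℝ)) - a * m * gam s2 ((z + y) / √(n:ℝ))| ≤ ε / 8 := by
    rw [← mul_sub, abs_mul, abs_of_nonneg (by positivity)]
    refine (mul_le_mul_of_nonneg_left a4 (by positivity)).trans ?_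
    linarith
  have a6 : gam s2 ((y - z) / √(n:ℝ)) = gam s2 ((z - y) / √(n:ℝ)) := by
    rw [← gam_neg, ← neg_div, neg_sub]
  rw [a6] at a1
  have a7 : (T ^ n) G x y = (T ^ n) (gz ψ z a) x y - (T ^ n) (gz ψ (-z - a) a) x y := by
    rw [hG, map_sub, Pi.sub_apply, Pi.sub_apply]
  rw [hdec, a7]
  rw [← abs_of_pos hsn, ← abs_mul] at hsum
  rw [abs_le] at a1 a2 a5 hsum ⊢
  constructor <;> linarith [hsum.1, hsum.2, a1.1, a1.2, a2.1, a2.2, a5.1, a5.2]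

end

section

/-- unnormalised Gaussian -/
noncomputable def Eg (t : ℝ) : ℝ := exp (-(t ^ 2 / 2))

lemma Eg_nonneg (t : ℝ) : 0 ≤ Eg t := (exp_pos _).le

lemma Eg_deriv (t : ℝ) : HasDerivAt Eg (-(t * Eg t)) t := by
  have h : HasDerivAt (fun t : ℝ => -(t ^ 2 / 2)) (-((2:ℕ) * t ^ (2 - 1) * 1 / 2)) t :=
    (((hasDerivAt_id t).pow 2).div_const 2).neg
  have h2 := h.exp
  unfold Eg
  convert h2 using 1
  simp
  ring

lemma Eg_deriv2 (t : ℝ) : HasDerivAt (fun t => -(t * Eg t)) ((t ^ 2 - 1) * Eg t) t := by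
  have h : HasDerivAt (fun t => -(t * Eg t)) (-(1 * Eg t + t * (-(t * Eg t)))) t :=
    ((hasDerivAt_id t).mul (Eg_deriv t)).neg
  convert h using 1
  ring

lemma Eg_pow_bound (t : ℝ) : (1 + t ^ 2 / 2 + t ^ 4 / 8) * Eg t ≤ 1 := by
  have h : 1 + t ^ 2 / 2 + (t ^ 2 / 2) ^ 2 / 2 ≤ exp (t ^ 2 / 2) :=
    Real.quadratic_le_exp_of_nonneg (by positivity)
  unfold Eg
  rw [exp_neg, ← div_eq_mul_inv, div_le_one (exp_pos _)]
  nlinarith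

lemma Eg_b (t c : ℝ) {u : ℝ} (h : |u| ≤ c * (1 + t ^ 2 / 2 + t ^ 4 / 8)) (hc : 0 ≤ c) :
    |u * Eg t| ≤ c := by
  rw [abs_mul, abs_of_nonneg (Eg_nonneg t)]
  have := mul_le_mul_of_nonneg_right h (Eg_nonneg t)
  nlinarith [Eg_pow_bound t]

lemma Eg_lip1 (s t : ℝ) : |(-(s * Eg s)) - (-(t * Eg t))| ≤ 3 * |s - t| := by
  have := Convex.norm_image_sub_le_of_norm_hasDerivWithin_le (f := fun t => -(t * Eg t))
    (f' := fun t => (t ^ 2 - 1) * Eg t) (s := Set.univ) (x := t) (y := s) (C := 3)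
    (fun x _ => (Eg_deriv2 x).hasDerivWithinAt) (fun x _ => by
      rw [Real.norm_eq_abs]
      apply Eg_b _ _ _ (by norm_num)
      rw [abs_le]; constructor <;> nlinarith [sq_nonneg x, sq_nonneg (x ^ 2)])
    convex_univ trivial trivial
  simpa using this

lemma Eg_taylor (A s : ℝ) : |Eg (A + s) - Eg A + s * (A * Eg A)| ≤ 3 * s ^ 2 := by
  have := Convex.norm_image_sub_le_of_norm_hasDerivWithin_le (f := fun t => Eg t + t * (A * Eg A))
    (f' := fun t => -(t * Eg t) + 1 * (A * Eg A)) (s := Set.uIcc A (A + s)) (x := A) (y := A + s)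
    (C := 3 * |s|)
    (fun x _ => ((Eg_deriv x).add ((hasDerivAt_id x).mul_const _)).hasDerivWithinAt) (fun x hx => by
      rw [Real.norm_eq_abs]
      have h1 := Eg_lip1 x A
      have h2 : |x - A| ≤ |s| := by
        have := Set.abs_sub_left_of_mem_uIcc hx
        simpa using this
      rw [show -(x * Eg x) + 1 * (A * Eg A) = (-(x * Eg x)) - (-(A * Eg A)) by ring]
      linarith)
    (convex_uIcc _ _) Set.left_mem_uIcc Set.right_mem_uIcc
  rw [Real.norm_eq_abs, Real.norm_eq_abs] at this
  rw [show A + s - A = s by ring, mul_assoc, abs_mul_abs_self, ← pow_two] at this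
  rw [show Eg (A + s) - Eg A + s * (A * Eg A) =
    Eg (A + s) + (A + s) * (A * Eg A) - (Eg A + A * (A * Eg A)) by ring]
  exact this

lemma Eg_psi (ζ : ℝ) {q : ℝ} (h1 : 1 ≤ q) (h2 : q ≤ 3 / 2) :
    |q ^ 3 * ζ * Eg (q * ζ) - ζ * Eg ζ| ≤ 11 * (q - 1) := by
  have hd : ∀ q : ℝ, HasDerivAt (fun q => q ^ 3 * ζ * Eg (q * ζ))
      ((3 * q * (q * ζ) - q * (q * ζ) ^ 3) * Eg (q * ζ)) q := by
    intro q
    have d1 : HasDerivAt (fun q : ℝ => q ^ 3 * ζ) ((3:ℕ) * q ^ (3 - 1) * 1 * ζ) q :=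
      ((hasDerivAt_id q).pow 3).mul_const ζ
    have d2 : HasDerivAt (fun q : ℝ => Eg (q * ζ)) (-(q * ζ * Eg (q * ζ)) * (1 * ζ)) q := by
      have e : HasDerivAt (fun q : ℝ => q * ζ) (1 * ζ) q := (hasDerivAt_id q).mul_const ζ
      exact HasDerivAt.comp (h₂ := Eg) (h := fun q : ℝ => q * ζ) q (Eg_deriv (q * ζ)) e
    refine (d1.mul d2).congr_deriv ?_
    push_cast
    ring
  have := Convex.norm_image_sub_le_of_norm_hasDerivWithin_le
    (f := fun q => q ^ 3 * ζ * Eg (q * ζ))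
    (f' := fun q => (3 * q * (q * ζ) - q * (q * ζ) ^ 3) * Eg (q * ζ))
    (s := Set.Icc 1 (3/2)) (x := 1) (y := q) (C := 11)
    (fun x _ => (hd x).hasDerivWithinAt) (fun x hx => by
      rw [Real.norm_eq_abs]
      apply Eg_b _ _ _ (by norm_num)
      set t := x * ζ
      have a1 : |3 * x * t - x * t ^ 3| = x * |3 * t - t ^ 3| := by
        rw [show 3 * x * t - x * t ^ 3 = x * (3 * t - t ^ 3) by ring, abs_mul,
          abs_of_nonneg (by linarith [hx.1])]
      have a2 : |3 * t - t ^ 3| ≤ 7 * (1 + t ^ 2 / 2 + t ^ 4 / 8) := by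
        rw [abs_le]; constructor <;>
          nlinarith [sq_nonneg (t - 1), sq_nonneg (t + 1), sq_nonneg (t ^ 2 - t),
            sq_nonneg (t ^ 2 + t), sq_nonneg (t ^ 2)]
      rw [a1]
      have a3 : 0 ≤ 1 + t ^ 2 / 2 + t ^ 4 / 8 := by positivity
      nlinarith [hx.1, hx.2, abs_nonneg (3 * t - t ^ 3)])
    (convex_Icc _ _) (by constructor <;> norm_num) ⟨h1, h2⟩
  rw [Real.norm_eq_abs, Real.norm_eq_abs, abs_of_nonneg (by linarith : 0 ≤ q - 1)] at this
  simpa using this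

lemma Eg_refl (ζ : ℝ) {d q : ℝ} (hd : 0 ≤ d) (h1 : 1 ≤ q) (h2 : q ≤ 3 / 2) :
    |q * (Eg (q * (ζ - d)) - Eg (q * (ζ + d))) - 2 * d * (ζ * Eg ζ)| ≤ 22 * d * (d + (q - 1)) := by
  have t1 := Eg_taylor (q * ζ) (-(q * d))
  have t2 := Eg_taylor (q * ζ) (q * d)
  have t3 := Eg_psi ζ h1 h2
  rw [show q * ζ + -(q * d) = q * (ζ - d) by ring] at t1
  rw [show q * ζ + q * d = q * (ζ + d) by ring] at t2
  have t4 : |Eg (q * (ζ - d)) - Eg (q * (ζ + d)) - 2 * (q * d) * (q * ζ * Eg (q * ζ))| ≤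
      6 * (q * d) ^ 2 := by
    rw [abs_le] at t1 t2 ⊢
    constructor <;> nlinarith
  have t5 : |q * (Eg (q * (ζ - d)) - Eg (q * (ζ + d))) - 2 * d * (q ^ 3 * ζ * Eg (q * ζ))| ≤
      22 * d ^ 2 := by
    rw [show q * (Eg (q * (ζ - d)) - Eg (q * (ζ + d))) - 2 * d * (q ^ 3 * ζ * Eg (q * ζ)) =
      q * (Eg (q * (ζ - d)) - Eg (q * (ζ + d)) - 2 * (q * d) * (q * ζ * Eg (q * ζ))) by ring,
      abs_mul, abs_of_nonneg (by linarith)]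
    have hq3 : q ^ 3 ≤ 27 / 8 := by
      calc q ^ 3 ≤ (3/2) ^ 3 := by gcongr
        _ = 27 / 8 := by norm_num
    calc _ ≤ q * (6 * (q * d) ^ 2) := by gcongr
      _ = 6 * q ^ 3 * d ^ 2 := by ring
      _ ≤ _ := by nlinarith [sq_nonneg d]
  have t6 : |2 * d * (q ^ 3 * ζ * Eg (q * ζ)) - 2 * d * (ζ * Eg ζ)| ≤ 22 * d * (q - 1) := by
    rw [← mul_sub, abs_mul, abs_of_nonneg (by linarith)]
    nlinarith
  rw [abs_le] at t5 t6 ⊢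
  constructor <;> nlinarith

/-- limiting profile -/
noncomputable def prof (s2 ζ : ℝ) : ℝ := 2 * ζ / s2 * gam s2 ζ

lemma gam_Eg {s2 : ℝ} (hs : 0 < s2) (u : ℝ) : gam s2 u = Eg (u / √s2) / √(2 * π * s2) := by
  unfold gam Eg
  rw [div_pow, Real.sq_sqrt hs.le, div_div, mul_comm s2 2]

lemma prof_bound {s2 : ℝ} (hs : 0 < s2) : ∃ C : ℝ, 0 < C ∧ ∀ ζ, |prof s2 ζ| ≤ C := by
  have hσ : 0 < √s2 := Real.sqrt_pos.mpr hs
  have hG : 0 < √(2 * π * s2) := by positivity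
  refine ⟨2 / (√s2 * √(2 * π * s2)), by positivity, fun ζ => ?_⟩
  unfold prof
  rw [gam_Eg hs]
  have h1 : |ζ / √s2 * Eg (ζ / √s2)| ≤ 1 := by
    apply Eg_b _ _ _ (by norm_num)
    rw [abs_le]; constructor <;> nlinarith [sq_nonneg (ζ / √s2 - 1), sq_nonneg (ζ / √s2 + 1),
      sq_nonneg ((ζ / √s2) ^ 2)]
  have e : 2 * ζ / s2 * (Eg (ζ / √s2) / √(2 * π * s2)) =
      2 / (√s2 * √(2 * π * s2)) * (ζ / √s2 * Eg (ζ / √s2)) := by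
    have : s2 = √s2 * √s2 := (Real.mul_self_sqrt hs.le).symm
    rw [show 2 * ζ / s2 = 2 * ζ / (√s2 * √s2) by rw [← this]]
    field_simp
  rw [e, abs_mul, abs_of_pos (by positivity)]
  nlinarith [show 0 < 2 / (√s2 * √(2 * π * s2)) by positivity]

lemma gam_refl {s2 : ℝ} (hs : 0 < s2) : ∃ C : ℝ, 0 < C ∧ ∀ (s s' u z : ℝ), 0 < s' → s' ≤ s →
    s ≤ 3 / 2 * s' → 0 ≤ u →
    |s / s' * (gam s2 ((z - u) / s') - gam s2 ((z + u) / s')) - u / s * prof s2 (z / s)| ≤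
      C * (u / s) * (u / s + (s / s' - 1)) := by
  have hσ : 0 < √s2 := Real.sqrt_pos.mpr hs
  have hG : 0 < √(2 * π * s2) := by positivity
  refine ⟨22 / √(2 * π * s2) * (1 / √s2) * (1 / √s2 + 1), by positivity,
    fun s s' u z h0 h1 h2 hu => ?_⟩
  have hs0 : 0 < s := by linarith
  have hq1 : 1 ≤ s / s' := by rw [le_div_iff₀ h0]; linarith
  have hq2 : s / s' ≤ 3 / 2 := by rw [div_le_iff₀ h0]; linarith
  have key := Eg_refl (z / s / √s2) (d := u / s / √s2) (q := s / s') (by positivity) hq1 hq2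
  have e1 : s / s' * (z / s / √s2 - u / s / √s2) = (z - u) / s' / √s2 := by field_simp
  have e2 : s / s' * (z / s / √s2 + u / s / √s2) = (z + u) / s' / √s2 := by field_simp
  rw [e1, e2] at key
  have e3 : s / s' * (gam s2 ((z - u) / s') - gam s2 ((z + u) / s')) - u / s * prof s2 (z / s) =
      (s / s' * (Eg ((z - u) / s' / √s2) - Eg ((z + u) / s' / √s2)) -
        2 * (u / s / √s2) * (z / s / √s2 * Eg (z / s / √s2))) / √(2 * π * s2) := by
    unfold prof
    rw [gam_Eg hs, gam_Eg hs, gam_Eg hs]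
    have : s2 = √s2 * √s2 := (Real.mul_self_sqrt hs.le).symm
    rw [show 2 * (z / s) / s2 = 2 * (z / s) / (√s2 * √s2) by rw [← this]]
    field_simp
  rw [e3, abs_div, abs_of_pos hG]
  set q1 := s / s' - 1
  have hq0 : 0 ≤ q1 := by simp only [q1]; linarith
  set d := u / s
  have hd : 0 ≤ d := by positivity
  calc _ ≤ 22 * (d / √s2) * (d / √s2 + q1) / √(2 * π * s2) := by gcongr
    _ ≤ 22 * (d / √s2) * ((1 / √s2 + 1) * (d + q1)) / √(2 * π * s2) := by
        gcongr
        have : 0 < 1 / √s2 := by positivity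
        have e : d / √s2 = d * (1 / √s2) := by ring
        rw [e]
        nlinarith
    _ = _ := by ring

end

section

variable [Fintype X] {P w : X → X → ℝ} {α β : X → ℝ} {s2 B : ℝ}

/-- Decomposition at the first entrance above level `L` with constant top value. -/
lemma strip_decomp (M : Mart P w α β s2 B) {L : ℝ} (m n : ℕ) (g : X → ℝ → ℝ)
    (c θ e e' : ℝ)
    (hH : ∀ x u, u < L → |c * (Tm P w mpos ^ n) g x u| ≤ e')
    (hT : ∀ k < m, ∀ x u, L ≤ u → u ≤ L + B →
      |c * (Tm P w mpos ^ (m + n - 1 - k)) g x u - θ| ≤ e)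
    (x : X) (y : ℝ) (hy : y < L) :
    |c * (Tm P w mpos ^ (m + n)) g x y - θ * ptop P w L m x y| ≤
      e' * (Tm P w (mstrip L) ^ m) one1 x y + e * ptop P w L m x y := by
  have hd := pow_decomp (Tm P w (mstrip L)) (Tm P w (mtop L)) n m
  rw [← Tm_pos_eq L] at hd
  rw [hd]
  unfold ptop
  rw [Finset.mul_sum, Finset.mul_sum]
  simp only [LinearMap.add_apply, LinearMap.sum_apply, Module.End.mul_apply, Pi.add_apply,
    Finset.sum_apply]
  have hA : ∀ u : ℝ, mstrip L u ≠ 0 → u ∈ Set.Iio L := fun u hu => (mstrip_ne L u hu).2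
  have h1 : |c * (Tm P w (mstrip L) ^ m) ((Tm P w mpos ^ n) g) x y| ≤
      e' * (Tm P w (mstrip L) ^ m) one1 x y := by
    have := Tm_pow_abs_le (w := w) M.nonneg (mstrip_nonneg L) (Set.Iio L) hA
      (g := c • ((Tm P w mpos ^ n) g)) (h := one1) e'
      (fun x u hu => by simpa [one1] using hH x u hu) m x y hy
    rw [map_smul] at this
    simpa using this
  have h2 : ∀ k ∈ range m,
      |c * (Tm P w (mstrip L) ^ k) ((Tm P w (mtop L)) ((Tm P w mpos ^ (m + n - 1 - k)) g)) x y -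
        θ * (Tm P w (mstrip L) ^ k) ((Tm P w (mtop L)) one1) x y| ≤
      e * (Tm P w (mstrip L) ^ k) ((Tm P w (mtop L)) one1) x y := by
    intro k hk
    have := Tm_pow_abs_le (w := w) M.nonneg (mstrip_nonneg L) (Set.Iio L) hA
      (g := c • ((Tm P w (mtop L)) ((Tm P w mpos ^ (m + n - 1 - k)) g)) -
        θ • ((Tm P w (mtop L)) one1)) (h := (Tm P w (mtop L)) one1) e
      (fun x u hu => ?_) k x y hy
    · rw [map_sub, map_smul, map_smul] at this
      simpa using this
    · simp only [Pi.sub_apply, Pi.smul_apply, smul_eq_mul, Tm_apply, Finset.mul_sum]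
      rw [← Finset.sum_sub_distrib]
      refine (Finset.abs_sum_le_sum_abs _ _).trans (Finset.sum_le_sum fun x' _ => ?_)
      by_cases h : mtop L (u + w x x') = 0
      · simp [h]
      · have hu' : u < L := hu
        have hw := (abs_le.mp (M.hw x x')).2
        have := hT k (Finset.mem_range.mp hk) x' (u + w x x') (mtop_ne L _ h).2 (by linarith)
        have hp := M.nonneg x x'
        have hm := mtop_nonneg L (u + w x x')
        simp only [one1, mul_one]
        rw [show ∀ a b : ℝ, c * (P x x' * (mtop L (u + w x x') * a)) -
          θ * (P x x' * mtop L (u + w x x')) = (P x x' * mtop L (u + w x x')) * (c * a - θ) by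
            intros; ring, abs_mul, abs_of_nonneg (mul_nonneg hp hm), mul_comm e]
        exact mul_le_mul_of_nonneg_left this (mul_nonneg hp hm)
        exact 0
  have h3 : |∑ k ∈ range m,
      (c * (Tm P w (mstrip L) ^ k) ((Tm P w (mtop L)) ((Tm P w mpos ^ (m + n - 1 - k)) g)) x y -
        θ * (Tm P w (mstrip L) ^ k) ((Tm P w (mtop L)) one1) x y)| ≤
      ∑ k ∈ range m, e * (Tm P w (mstrip L) ^ k) ((Tm P w (mtop L)) one1) x y :=
    (Finset.abs_sum_le_sum_abs _ _).trans (Finset.sum_le_sum h2)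
  rw [Finset.sum_sub_distrib, ← Finset.mul_sum] at h3
  rw [abs_le] at h1 h3 ⊢
  rw [← Finset.mul_sum] at h3 ⊢
  rw [← Finset.mul_sum] at h3 ⊢
  constructor <;> nlinarith [h1.1, h1.2, h3.1, h3.2]

end

section

variable [Fintype X] [DecidableEq X] [Nonempty X] {P : X → X → ℝ} {ν f : X → ℝ} {α β : X → ℝ} {s2 B : ℝ}

lemma mst_aux1 {t s B : ℝ} (ht0 : 0 < t) (ht1 : t < 1 / 2) (hs0 : 0 < s) (hB : 1 ≤ B)
    (hBs : B ≤ t ^ 3 * s) : B ≤ t ^ 2 * s ∧ 2 ≤ t * (s * s) := by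
  have h2 : 0 < t ^ 2 * s := by positivity
  have h1 : B ≤ t ^ 2 * s := by
    refine hBs.trans ?_
    nlinarith
  have hts : 1 ≤ t * s := by nlinarith [mul_pos ht0 hs0]
  have hs2 : 2 ≤ s := by nlinarith
  exact ⟨h1, by nlinarith⟩

lemma mst_aux2 {t s s' n j : ℝ} (ht0 : 0 < t) (ht1 : t < 1 / 2) (hn : 0 ≤ n) (hs0 : 0 < s)
    (hs'0 : 0 < s')
    (hss : s * s = n) (hss' : s' * s' = j) (h6 : (1 - t) * n ≤ j) : s / s' - 1 ≤ 2 * t := by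
  have : s ≤ (1 + 2 * t) * s' := by
    have h0 : s ^ 2 ≤ ((1 + 2 * t) * s') ^ 2 := by
      have : ((1 + 2 * t) * s') ^ 2 = (1 + 2 * t) ^ 2 * j := by
        rw [← hss']; ring
      rw [this, pow_two, hss]
      have h7 : (1 + 2 * t) ^ 2 * ((1 - t) * n) ≤ (1 + 2 * t) ^ 2 * j := by gcongr
      have h8 : 1 ≤ (1 + 2 * t) ^ 2 * (1 - t) := by nlinarith [mul_pos ht0 ht0]
      have h9 := mul_le_mul_of_nonneg_right h8 hn
      linarith
    exact (abs_le_of_sq_le_sq' h0 (by positivity)).2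
  have := (div_le_iff₀ hs'0).mpr this
  linarith

lemma mst_aux3 {s s' n j : ℝ} (hs'0 : 0 < s') (hn : 0 ≤ n)
    (hss : s * s = n) (hss' : s' * s' = j) (h6 : n / 2 ≤ j) : s ≤ 3 / 2 * s' := by
  have : s ^ 2 ≤ (3 / 2 * s') ^ 2 := by
    rw [mul_pow, pow_two, pow_two s', hss, hss']; linarith
  exact (abs_le_of_sq_le_sq' this (by positivity)).2

set_option maxHeartbeats 1600000 in
lemma master (hS : IsStochastic P ν) (h1 : Primitive P) (h2 : ∑ x, f x * ν x = 0)
    (h3 : NonLattice P f) (M : Mart P (fun _ x' => f x') α β s2 B) {ψ : X → ℝ}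
    (hψ : ∀ b, 0 ≤ ψ b) {a : ℝ} (ha : 0 < a) :
    ∃ C, 0 < C ∧ ∀ t : ℝ, 0 < t → t < 1 / 2 → ∃ N : ℕ, ∀ n, N ≤ n → ∀ x y z, 0 ≤ z →
      y < t ^ 2 * √(n:ℝ) →
      |n * (Tm P (fun _ x' => f x') mpos ^ n) (gz ψ z a) x y -
        (a * ∑ b, ψ b * ν b) * prof s2 (z / √(n:ℝ)) *
          (t ^ 2 * √(n:ℝ) * ptop P (fun _ x' => f x') (t ^ 2 * √(n:ℝ)) ⌊t * n⌋₊ x y)| ≤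
        C * (1 + max y 0) * t := by
  obtain ⟨Ck, hCk, hk⟩ := kbound hS h1 h3 M ha
  obtain ⟨Cr, hCr, hr⟩ := gam_refl M.hs
  obtain ⟨Cp, hCp, hp⟩ := prof_bound M.hs
  set A := a * ∑ b, ψ b * ν b with hA
  have hA0 : 0 ≤ A := mul_nonneg ha.le (Finset.sum_nonneg fun b _ => mul_nonneg (hψ b) (hS.nuPos b).le)
  set Ψ := ∑ b, ψ b with hΨ
  have hΨ0 : 0 ≤ Ψ := Finset.sum_nonneg fun b _ => hψ b
  have hB := M.hB
  have hc := cExit_pos M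
  set C1 := 3 / 2 + 8 * A * Cr + A * Cp with hC1
  have hC1p : 0 < C1 := by positivity
  refine ⟨8 * Ψ * Ck * cExit s2 B + C1 * (4 * B), by positivity, fun t ht0 ht1 => ?_⟩
  obtain ⟨Nd, hNd⟩ := dirichlet hS h1 h2 h3 M hψ ha (Q := 1) (ε := t ^ 3) one_pos (by positivity)
  obtain ⟨Nb, hNb⟩ := exists_inv_sqrt_lt B (ε := t ^ 3) (by positivity)
  refine ⟨max 1 (max (2 * Nd) Nb), fun n hn x y z hz hy => ?_⟩
  have hn1 : 1 ≤ n := (le_max_left _ _).trans hn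
  have hn2 : 2 * Nd ≤ n := (le_max_left _ _).trans ((le_max_right _ _).trans hn)
  have hn3 : Nb ≤ n := (le_max_right _ _).trans ((le_max_right _ _).trans hn)
  have hnR : (1:ℝ) ≤ n := by exact_mod_cast hn1
  set s := √(n:ℝ) with hs
  have hs0 : 0 < s := Real.sqrt_pos.mpr (by linarith)
  have hss : s * s = n := Real.mul_self_sqrt (by linarith)
  have hBs : B ≤ t ^ 3 * s := by
    have := hNb n hn3
    rw [← div_eq_mul_inv, div_lt_iff₀ hs0] at this
    exact this.le
  set L := t ^ 2 * s with hL
  have hBL : B ≤ L := (mst_aux1 ht0 ht1 hs0 hB hBs).1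
  have hL1 : 1 ≤ L := hB.trans hBL
  set m := ⌊t * n⌋₊ with hm
  have hmle : (m:ℝ) ≤ t * n := Nat.floor_le (by positivity)
  have hmlt : t * n < m + 1 := Nat.lt_floor_add_one _
  have htn : 2 ≤ t * n := by rw [← hss]; exact (mst_aux1 ht0 ht1 hs0 hB hBs).2
  have hm2 : t * n / 2 ≤ m := by linarith
  have hm1 : 1 ≤ m := by
    have : (0:ℝ) < m := by linarith
    exact_mod_cast this
  have hmn : (m:ℝ) ≤ n / 2 := by
    have := mul_le_mul_of_nonneg_right ht1.le (show (0:ℝ) ≤ n by linarith)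
    linarith
  have hmn' : m ≤ n := by
    have : (m:ℝ) ≤ n := by linarith
    exact_mod_cast this
  obtain ⟨n', hn'⟩ := Nat.exists_eq_add_of_le hmn'
  have hn'R : (n:ℝ) = m + n' := by exact_mod_cast hn'
  have hn'2 : (n:ℝ) / 2 ≤ n' := by linarith
  have hmx : 0 ≤ max y 0 := le_max_right _ _
  have hmain := strip_decomp M (L := L) m n' (gz ψ z a) n (A * prof s2 (z / s) * L)
    (s * t ^ 3 * C1) (4 * Ψ * Ck * L) ?_ ?_ x y hy
  · rw [← hn'] at hmain
    rw [show A * prof s2 (z / s) * (L * ptop P (fun _ x' => f x') L m x y) =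
      A * prof s2 (z / s) * L * ptop P (fun _ x' => f x') L m x y by ring]
    refine hmain.trans ?_
    have e1 := strip_le M hL1 hm1 x y hy
    have e2 := ptop_le M hL1 m x y
    have e3 : L * L / m ≤ 2 * t ^ 3 := by
      rw [div_le_iff₀ (by linarith), hL]
      have : t ^ 2 * s * (t ^ 2 * s) = t ^ 4 * n := by rw [← hss]; ring
      rw [this]
      have := mul_le_mul_of_nonneg_left hm2 (show 0 ≤ 2 * t ^ 3 by positivity)
      linarith
    have e4 : t ^ 3 ≤ t := pow_le_of_le_one ht0.le (by linarith) three_ne_zero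
    have f1 : 4 * Ψ * Ck * L * (Tm P (fun _ x' => f x') (mstrip L) ^ m) one1 x y ≤
        8 * Ψ * Ck * cExit s2 B * (1 + max y 0) * t := by
      calc _ ≤ 4 * Ψ * Ck * L * (cExit s2 B * (1 + max y 0) * L / m) := by gcongr
        _ = 4 * Ψ * Ck * cExit s2 B * (1 + max y 0) * (L * L / m) := by ring
        _ ≤ 4 * Ψ * Ck * cExit s2 B * (1 + max y 0) * (2 * t) := by
            gcongr
            linarith
        _ = _ := by ring
    have f2 : s * t ^ 3 * C1 * ptop P (fun _ x' => f x') L m x y ≤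
        C1 * (4 * B) * (1 + max y 0) * t := by
      calc _ ≤ s * t ^ 3 * C1 * (4 * B * (1 + max y 0) / L) := by gcongr
        _ = _ := by rw [hL]; field_simp
    linarith
  · intro x u hu
    have g0 : 0 ≤ (Tm P (fun _ x' => f x') mpos ^ n') (gz ψ z a) x u :=
      Tm_pow_nonneg hS.nonneg mpos_nonneg (gz_nonneg hψ z a) n' x u
    rw [abs_of_nonneg (by positivity)]
    have g1 : (Tm P (fun _ x' => f x') mpos ^ n') (gz ψ z a) x u ≤
        Ψ * (Ck * (1 + max u 0) / (n' + 1)) := by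
      refine (Tm_pow_smul_le (w := fun _ x' => f x') hS.nonneg mpos_nonneg Set.univ
        (fun _ _ => trivial) Ψ (h := fun _ u => box z a u)
        (fun x u _ => gz_le hψ z a x u) n' x u trivial).trans ?_
      exact mul_le_mul_of_nonneg_left (hk n' x u z) hΨ0
    have g2 : max u 0 ≤ L := max_le hu.le (by linarith)
    have g3 : (n:ℝ) / (n' + 1) ≤ 2 := by
      rw [div_le_iff₀ (by positivity)]; linarith
    calc (n:ℝ) * (Tm P (fun _ x' => f x') mpos ^ n') (gz ψ z a) x u
        ≤ n * (Ψ * (Ck * (1 + max u 0) / (n' + 1))) := by gcongr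
      _ = Ψ * Ck * (1 + max u 0) * (n / (n' + 1)) := by ring
      _ ≤ Ψ * Ck * (L + L) * 2 := by gcongr
      _ = _ := by ring
  · intro k hk x u hu1 hu2
    set j := m + n' - 1 - k with hj
    have hj1 : n' ≤ j := by omega
    have hjn : j ≤ n := by omega
    have hj1R : (n':ℝ) ≤ j := by exact_mod_cast hj1
    have hjnR : (j:ℝ) ≤ n := by exact_mod_cast hjn
    have hj2 : (n:ℝ) / 2 ≤ j := by linarith
    have hjN : Nd ≤ j := by
      have : n ≤ 2 * j := by
        have : (n:ℝ) ≤ 2 * j := by linarith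
        exact_mod_cast this
      omega
    set s' := √(j:ℝ) with hs'
    have hs'0 : 0 < s' := Real.sqrt_pos.mpr (by linarith)
    have hss' : s' * s' = j := Real.mul_self_sqrt (by linarith)
    have hs's : s' ≤ s := Real.sqrt_le_sqrt hjnR
    have hs32 : s ≤ 3 / 2 * s' := mst_aux3 hs'0 (by linarith) hss hss' hj2
    have hu0 : 0 < u := by linarith
    have hu3 : u ≤ 2 * L := by linarith
    have hu4 : u / s ≤ 2 * t ^ 2 := by
      rw [div_le_iff₀ hs0]; rw [hL] at hu3; linarith
    have hd := hNd j hjN x u z hu0 (by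
      have : 2 * t ^ 2 ≤ 1 / 2 := by
        have := pow_le_pow_left₀ ht0.le ht1.le 2
        linarith
      have := mul_le_mul_of_nonneg_right this hs0.le
      rw [hL] at hu3
      linarith) hz
    have hg := hr s s' u z hs'0 hs's hs32 hu0.le
    set Δ := gam s2 ((z - u) / s') - gam s2 ((z + u) / s') with hΔ
    set G := (Tm P (fun _ x' => f x') mpos ^ j) (gz ψ z a) x u with hG
    set p := prof s2 (z / s) with hpp
    have hpb : |p| ≤ Cp := hp (z / s)
    have hq : s / s' - 1 ≤ 2 * t := by
      refine mst_aux2 ht0 ht1 (by linarith) hs0 hs'0 hss hss' ?_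
      rw [sub_mul, one_mul]
      linarith
    have q0 : 0 ≤ s / s' := by positivity
    have q1 : s / s' ≤ 3 / 2 := by rw [div_le_iff₀ hs'0]; exact hs32
    have i1 : |n * G - s * (s / s') * (A * Δ)| ≤ s * (3 / 2 * t ^ 3) := by
      have : n * G - s * (s / s') * (A * Δ) = s * (s / s') * (s' * G - A * Δ) := by
        rw [← hss]; field_simp
      rw [this, abs_mul, abs_of_nonneg (by positivity), mul_assoc]
      gcongr
    have i2 : |s * (s / s') * (A * Δ) - A * p * u| ≤ s * (8 * A * Cr * t ^ 3) := by
      have : s * (s / s') * (A * Δ) - A * p * u = s * A * (s / s' * Δ - u / s * p) := by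
        field_simp
      rw [this, abs_mul, abs_of_nonneg (by positivity)]
      calc _ ≤ s * A * (Cr * (u / s) * (u / s + (s / s' - 1))) := by gcongr
        _ ≤ s * A * (Cr * (2 * t ^ 2) * (2 * t ^ 2 + 2 * t)) := by
            have : 0 ≤ s / s' - 1 := by
              rw [sub_nonneg, le_div_iff₀ hs'0]; linarith
            gcongr
        _ = s * (A * Cr * (4 * t ^ 3 + 4 * t ^ 4)) := by ring
        _ ≤ s * (A * Cr * (8 * t ^ 3)) := by
            have : t ^ 4 ≤ t ^ 3 := pow_le_pow_of_le_one ht0.le (by linarith) (by norm_num)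
            gcongr
            linarith
        _ = _ := by ring
    have i3 : |A * p * u - A * p * L| ≤ s * (A * Cp * t ^ 3) := by
      have hul : 0 ≤ u - L := by linarith
      rw [← mul_sub, abs_mul, abs_mul, abs_of_nonneg hA0, abs_of_nonneg hul]
      calc _ ≤ A * Cp * (t ^ 3 * s) := by
            gcongr
            linarith
        _ = _ := by ring
    have : s * t ^ 3 * C1 = s * (3 / 2 * t ^ 3) + s * (8 * A * Cr * t ^ 3) +
        s * (A * Cp * t ^ 3) := by rw [hC1]; ring
    rw [this]
    rw [abs_le] at i1 i2 i3 ⊢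
    constructor <;> linarith [i1.1, i1.2, i2.1, i2.2, i3.1, i3.2]

end

section

variable [Fintype X] [DecidableEq X] {P w : X → X → ℝ} {α β : X → ℝ} {s2 B : ℝ}

lemma quad_le (M : Mart P w α β s2 B) (n : ℕ) (x : X) {y : ℝ} (hy : 0 < y) :
    (Tm P w mpos ^ n) (fun _ u => u ^ 2 / 2) x y ≤
      y ^ 2 + 2 * B * y + 4 * B ^ 2 + s2 * (8 * cExit s2 B * (1 + y) * √(n:ℝ)) := by
  have hB := M.hB
  have hs := M.hs
  set Gq : X → ℝ → ℝ := fun x y => y ^ 2 + 2 * y * α x + β x with hGq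
  set G : X → ℝ → ℝ := Gq + (fun x y => 0 * (y + α x) + 3 * B ^ 2) with hG
  have hGv : ∀ x u, G x u = u ^ 2 + 2 * u * α x + β x + 3 * B ^ 2 := by
    intro x u; simp [hG, hGq]
  have hd := dynkin (w := w) M.nonneg (m := mpos) (m' := mneg) mpos_nonneg (Set.Ioi 0) mpos_Ioi
    (fun u => by unfold mone mpos mneg; split_ifs <;> norm_num) (G := G) (r := fun _ _ => -s2)
    (fun x u _ => by
      rw [hG, map_add, Pi.add_apply, Pi.add_apply, M.Tlin (3 * B ^ 2) 0, M.Tquad, ← hG, hGv]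
      linarith) n x y hy
  have hGlow : ∀ x, ∀ u ∈ Set.Ioi (0:ℝ), (fun (_:X) (u:ℝ) => u ^ 2 / 2) x u ≤ G x u := by
    intro x u hu
    have hu' : 0 < u := hu
    have a1 := abs_le.mp (M.hα x)
    have a2 := abs_le.mp (M.hβ x)
    rw [hGv]
    have : -(2 * u * B) ≤ 2 * u * α x := by nlinarith [a1.1]
    have : u ^ 2 / 2 - 2 * u * B + 2 * B ^ 2 = (u - 2 * B) ^ 2 / 2 := by ring
    have := sq_nonneg (u - 2 * B)
    simp only
    nlinarith [a2.1]
  have h1 := Tm_pow_mono_on (w := w) M.nonneg mpos_nonneg (Set.Ioi 0) mpos_Ioi hGlow n x y hy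
  have h2 : ∑ k ∈ range n, (-s2) * (Tm P w mpos ^ k) one1 x y ≤
      ∑ k ∈ range n, (Tm P w mpos ^ k) ((fun _ _ => -s2) + (Tm P w mneg) G) x y := by
    refine Finset.sum_le_sum fun k _ => ?_
    have := Tm_pow_mono_on (w := w) M.nonneg mpos_nonneg (Set.Ioi 0) mpos_Ioi
      (g := (-s2) • one1) (h := (fun _ _ => -s2) + (Tm P w mneg) G) (fun x u hu => ?_) k x y hy
    · rw [map_smul] at this
      simpa using this
    · have hu' : 0 < u := hu
      simp only [Pi.smul_apply, one1, smul_eq_mul, Pi.add_apply, mul_one]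
      have : 0 ≤ (Tm P w mneg) G x u := by
        rw [Tm_apply]
        refine Finset.sum_nonneg fun x' _ => mul_nonneg (M.nonneg x x') ?_
        unfold mneg
        split_ifs with h
        · simp
        · rw [hGv, one_mul]
          have a1 := abs_le.mp (M.hα x')
          have a2 := abs_le.mp (M.hβ x')
          have a3 := abs_le.mp (M.hw x x')
          set v := u + w x x'
          have v0 : v ≤ 0 := not_lt.mp h
          have v1 : -B ≤ v := by simp only [v]; linarith
          have : |v * α x'| ≤ B * B := by
            rw [abs_mul]
            exact mul_le_mul (abs_le.mpr ⟨v1, by linarith⟩) (M.hα x') (abs_nonneg _) (by linarith)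
          have := (abs_le.mp this).1
          nlinarith [sq_nonneg v]
      linarith
  have h3 : ∑ k ∈ range n, (Tm P w mpos ^ k) one1 x y ≤ 8 * cExit s2 B * (1 + y) * √(n:ℝ) := by
    have hc := cExit_pos M
    calc _ ≤ ∑ k ∈ range n, 4 * cExit s2 B * (1 + y) * (1 / √((k:ℝ) + 1)) := by
          refine Finset.sum_le_sum fun k _ => ?_
          have := survive_le' M k x y
          rw [max_eq_left hy.le] at this
          rw [mul_one_div]; exact this
      _ = 4 * cExit s2 B * (1 + y) * ∑ k ∈ range n, (1 / √((k:ℝ) + 1)) := by rw [Finset.mul_sum]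
      _ ≤ 4 * cExit s2 B * (1 + y) * (2 * √(n:ℝ)) := by
          gcongr
          exact sum_inv_sqrt n
      _ = _ := by ring
  rw [← Finset.mul_sum] at h2
  have h4 := mul_le_mul_of_nonneg_left h3 hs.le
  have h5 : G x y ≤ y ^ 2 + 2 * B * y + 4 * B ^ 2 := by
    have a1 := abs_le.mp (M.hα x)
    have a2 := abs_le.mp (M.hβ x)
    rw [hGv]
    nlinarith [a1.2, a2.2]
  linarith

end

section

variable [Fintype X] [DecidableEq X] {P w : X → X → ℝ} {α β : X → ℝ} {s2 B : ℝ} {κ : ℝ} {V : X → ℝ → ℝ}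

lemma V_nonneg (M : Mart P w α β s2 B) (hκ : 0 ≤ κ)
    (hV : ∀ x y, Tendsto (fun n : ℕ => κ * √(n:ℝ) * (Tm P w mpos ^ n) one1 x y) atTop (𝓝 (V x y)))
    (x : X) (y : ℝ) : 0 ≤ V x y :=
  ge_of_tendsto' (hV x y) fun n => mul_nonneg (mul_nonneg hκ (Real.sqrt_nonneg _))
    (Tm_pow_nonneg M.nonneg mpos_nonneg (by simp [one1]) n x y)

lemma V_le (M : Mart P w α β s2 B) (hκ : 0 ≤ κ)
    (hV : ∀ x y, Tendsto (fun n : ℕ => κ * √(n:ℝ) * (Tm P w mpos ^ n) one1 x y) atTop (𝓝 (V x y)))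
    (x : X) (y : ℝ) : V x y ≤ 2 * κ * cExit s2 B * (1 + max y 0) := by
  refine le_of_tendsto (hV x y) ?_
  filter_upwards [eventually_ge_atTop 1] with n hn
  have h := survive_le M hn x y
  have hs : 0 < √(n:ℝ) := Real.sqrt_pos.mpr (by exact_mod_cast hn)
  calc _ ≤ κ * √(n:ℝ) * (2 * cExit s2 B * (1 + max y 0) / √(n:ℝ)) := by gcongr
    _ = _ := by field_simp

lemma V_harm
    (hV : ∀ x y, Tendsto (fun n : ℕ => κ * √(n:ℝ) * (Tm P w mpos ^ n) one1 x y) atTop (𝓝 (V x y))) :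
    Tm P w mpos V = V := by
  funext x y
  have h1 : Tendsto (fun n : ℕ => κ * √(n:ℝ) * (Tm P w mpos ^ (n + 1)) one1 x y) atTop
      (𝓝 (Tm P w mpos V x y)) := by
    rw [Tm_apply]
    have : ∀ n : ℕ, κ * √(n:ℝ) * (Tm P w mpos ^ (n + 1)) one1 x y =
        ∑ x', P x x' * (mpos (y + w x x') * (κ * √(n:ℝ) * (Tm P w mpos ^ n) one1 x' (y + w x x'))) := by
      intro n
      rw [pow_succ', Module.End.mul_apply, Tm_apply, Finset.mul_sum]
      refine Finset.sum_congr rfl fun x' _ => by ring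
    simp only [this]
    exact tendsto_finsetSum _ fun x' _ => ((hV x' _).const_mul _).const_mul _
  have h2 : Tendsto (fun n : ℕ => κ * √((n + 1 : ℕ):ℝ) * (Tm P w mpos ^ (n + 1)) one1 x y) atTop
      (𝓝 (V x y)) := (tendsto_add_atTop_iff_nat 1).mpr (hV x y)
  have h3 : Tendsto (fun n : ℕ => √((n:ℝ) / (n + 1))) atTop (𝓝 1) := by
    have : Tendsto (fun n : ℕ => (n:ℝ) / (n + 1)) atTop (𝓝 1) := tendsto_natCast_div_add_atTop 1
    simpa using this.sqrt
  have h4 := h3.mul h2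
  rw [one_mul] at h4
  refine tendsto_nhds_unique h1 (h4.congr fun n => ?_)
  have hs : 0 < √((n:ℝ) + 1) := Real.sqrt_pos.mpr (by positivity)
  rw [Real.sqrt_div (Nat.cast_nonneg n)]
  push_cast
  field_simp

end

section

lemma prof_int {s2 : ℝ} (hs2 : 0 < s2) {s : ℝ} (hs : 0 < s) {R : ℝ} (hR : 0 ≤ R) :
    IntegrableOn (fun z => prof s2 (z / s)) (Set.Ioc 0 (R * s)) ∧
    ∫ z in Set.Ioc 0 (R * s), prof s2 (z / s) = 2 * s * (gam s2 0 - gam s2 R) := by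
  have hcont : Continuous (fun z => prof s2 (z / s)) := by
    unfold prof gam
    fun_prop
  refine ⟨(hcont.integrableOn_Icc (a := 0) (b := R * s)).mono_set Set.Ioc_subset_Icc_self, ?_⟩
  rw [← intervalIntegral.integral_of_le (by positivity)]
  have hd : ∀ z : ℝ, HasDerivAt (fun z => -(2 * s) * gam s2 (z / s)) (prof s2 (z / s)) z := by
    intro z
    have h1 := gam_deriv (s2 := s2) hs2 (z / s)
    have h2 : HasDerivAt (fun z : ℝ => z / s) (1 / s) z := (hasDerivAt_id z).div_const s
    have h3 := (HasDerivAt.comp (h₂ := gam s2) (h := fun z : ℝ => z / s) z h1 h2).const_mul (-(2 * s))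
    refine h3.congr_deriv ?_
    unfold prof
    field_simp
  rw [intervalIntegral.integral_eq_sub_of_hasDerivAt (fun z _ => hd z)
    (hcont.intervalIntegrable _ _)]
  rw [mul_div_assoc, div_self hs.ne', zero_div, mul_one]
  ring

lemma kap_gam {s2 : ℝ} (hs2 : 0 < s2) (ζ : ℝ) :
    √s2 * √(2 * π) / 2 * (2 * gam s2 ζ) = exp (-(ζ ^ 2 / (2 * s2))) := by
  unfold gam
  have h1 : √(2 * π * s2) = √(2 * π) * √s2 := Real.sqrt_mul (by positivity) _
  have h2 : 0 < √s2 := Real.sqrt_pos.mpr hs2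
  have h3 : 0 < √(2 * π) := by positivity
  rw [h1]
  field_simp

lemma exp_neg_le_inv {u : ℝ} (hu : 0 < u) : exp (-u) ≤ 1 / u := by
  rw [exp_neg, inv_eq_one_div]
  apply one_div_le_one_div_of_le hu
  linarith [Real.add_one_le_exp u]

lemma box_z_int (S : Set ℝ) (u : ℝ) : IntegrableOn (fun z => box z 1 u) S := by
  have : (fun z => box z 1 u) = fun z => box (u - 1) 1 z := by
    funext z
    unfold box
    congr 1
    rw [eq_iff_iff]
    constructor <;> rintro ⟨p, q⟩ <;> constructor <;> linarith
  rw [this]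
  exact (box_integrable _ _).integrableOn

lemma box_z_eq (u : ℝ) : (∫ z, box z 1 u) = 1 := by
  have : (fun z => box z 1 u) = fun z => box (u - 1) 1 z := by
    funext z
    unfold box
    congr 1
    rw [eq_iff_iff]
    constructor <;> rintro ⟨p, q⟩ <;> constructor <;> linarith
  rw [this]
  exact box_int _ zero_le_one

lemma box_z_le (S : Set ℝ) (u : ℝ) : (∫ z in S, box z 1 u) ≤ 1 := by
  refine (setIntegral_le_integral ?_ ?_).trans (box_z_eq u).le
  · have := box_z_int Set.univ u
    rwa [integrableOn_univ] at this
  · exact Eventually.of_forall fun z => box_nonneg z 1 u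

lemma box_z_ge {u T : ℝ} (hu : 0 < u) (hT : u ≤ T) :
    1 ≤ (∫ z in Set.Ioc 0 T, box z 1 u) + ∫ z in Set.Ioc (-1) 0, box z 1 u := by
  have h : (∫ z in Set.Ioc (-1) 0 ∪ Set.Ioc 0 T, box z 1 u) =
      (∫ z in Set.Ioc (-1) 0, box z 1 u) + ∫ z in Set.Ioc 0 T, box z 1 u :=
    setIntegral_union (by
      rw [Set.disjoint_left]
      intro z h1 h2
      exact absurd h1.2 (not_le.mpr h2.1)) measurableSet_Ioc (box_z_int _ u) (box_z_int _ u)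
  rw [add_comm, ← h, Set.Ioc_union_Ioc_eq_Ioc (by norm_num) (by linarith),
    setIntegral_eq_integral_of_forall_compl_eq_zero, box_z_eq]
  intro z hz
  unfold box
  rw [if_neg]
  rintro ⟨p, q⟩
  exact hz ⟨by linarith, by linarith⟩

lemma mst_aux4 {t s n L : ℝ} {m : ℕ} (ht0 : 0 < t) (hss : s * s = n) (hn : 0 < n) (hL : L = t ^ 2 * s)
    (hm2 : t * n / 2 ≤ m) : L * L / m ≤ 2 * t ^ 3 := by
  have : 0 < t * n / 2 := by positivity
  rw [div_le_iff₀ (by linarith), hL]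
  have : t ^ 2 * s * (t ^ 2 * s) = t ^ 4 * n := by rw [← hss]; ring
  rw [this]
  have := mul_le_mul_of_nonneg_left hm2 (show 0 ≤ 2 * t ^ 3 by positivity)
  linarith

end

section

variable [Fintype X] [DecidableEq X] {P w : X → X → ℝ} {α β : X → ℝ} {s2 B : ℝ}

/-- Chebyshev tail bound. -/
lemma tail_le (M : Mart P w α β s2 B) {n : ℕ} (hn : 1 ≤ n) (x : X) {y : ℝ} (hy : 0 < y)
    (hys : y ≤ √(n:ℝ)) {R : ℝ} (hR : 0 < R) :
    √(n:ℝ) * (Tm P w mpos ^ n) (fun _ u => if R * √(n:ℝ) < u then 1 else 0) x y ≤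
      2 * (1 + 2 * B + 4 * B ^ 2 + 8 * s2 * cExit s2 B) * (1 + y) / R ^ 2 := by
  have hB := M.hB
  have hs2 := M.hs
  have hc := cExit_pos M
  set s := √(n:ℝ) with hs
  have hs1 : 1 ≤ s := by rw [hs, Real.one_le_sqrt]; exact_mod_cast hn
  have hss : s * s = n := Real.mul_self_sqrt (Nat.cast_nonneg n)
  have h1 := Tm_pow_smul_le (w := w) M.nonneg mpos_nonneg (Set.Ioi 0) mpos_Ioi
    (g := fun _ u => if R * s < u then 1 else 0) (h := fun _ u => u ^ 2 / 2) (2 / (R * s) ^ 2)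
    (fun x u hu => by
      split_ifs with h
      · rw [div_mul_div_comm, le_div_iff₀ (by positivity), one_mul]
        have : (R * s) ^ 2 ≤ u ^ 2 := pow_le_pow_left₀ (by positivity) h.le 2
        linarith
      · positivity) n x y hy
  have h2 := quad_le M n x hy
  rw [← hs] at h2
  have h3 : y ^ 2 + 2 * B * y + 4 * B ^ 2 + s2 * (8 * cExit s2 B * (1 + y) * s) ≤
      (1 + 2 * B + 4 * B ^ 2 + 8 * s2 * cExit s2 B) * (1 + y) * s := by
    have a1 : y ^ 2 ≤ (1 + y) * s := by nlinarith
    have a2 : y ≤ (1 + y) * s := by nlinarith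
    have a3 : 1 ≤ (1 + y) * s := by nlinarith
    have b2 := mul_le_mul_of_nonneg_left a2 (show 0 ≤ 2 * B by linarith)
    have b3 := mul_le_mul_of_nonneg_left a3 (show 0 ≤ 4 * B ^ 2 by positivity)
    linarith
  have hs0 : 0 < s := by linarith
  calc _ ≤ s * (2 / (R * s) ^ 2 * ((1 + 2 * B + 4 * B ^ 2 + 8 * s2 * cExit s2 B) * (1 + y) * s)) := by
        refine mul_le_mul_of_nonneg_left (h1.trans ?_) hs0.le
        exact mul_le_mul_of_nonneg_left (h2.trans h3) (by positivity)
    _ = _ := by field_simp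

end

section

variable [Fintype X] [DecidableEq X] [Nonempty X] {P : X → X → ℝ} {ν f : X → ℝ} {α β : X → ℝ} {s2 B : ℝ}

/-- Survival probability sandwiched between integrals of local probabilities. -/
lemma surv_sand (M : Mart P (fun _ x' => f x') α β s2 B) {Ck : ℝ}
    (hk : ∀ (n : ℕ) (x : X) (y z : ℝ),
      (Tm P (fun _ x' => f x') mpos ^ n) (fun _ u => box z 1 u) x y ≤ Ck * (1 + max y 0) / (n + 1))
    (n : ℕ) (x : X) {y : ℝ} (hy : 0 < y) (T : ℝ) :
    (∫ z in Set.Ioc 0 T, (Tm P (fun _ x' => f x') mpos ^ n) (fun _ u => box z 1 u) x y) ≤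
      (Tm P (fun _ x' => f x') mpos ^ n) one1 x y ∧
    (Tm P (fun _ x' => f x') mpos ^ n) one1 x y ≤
      (∫ z in Set.Ioc 0 T, (Tm P (fun _ x' => f x') mpos ^ n) (fun _ u => box z 1 u) x y) +
      Ck * (1 + y) / (n + 1) +
      (Tm P (fun _ x' => f x') mpos ^ n) (fun _ u => if T < u then 1 else 0) x y := by
  have key : ∀ S : Set ℝ, (Tm P (fun _ x' => f x') mpos ^ n)
      (fun _ u => ∫ z in S, box z 1 u) x y =
      ∫ z in S, (Tm P (fun _ x' => f x') mpos ^ n) (fun _ u => box z 1 u) x y := fun S =>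
    (Tm_pow_integral (volume.restrict S) (fun z (_ : X) u => box z 1 u)
      (fun _ u => box_z_int S u) n x y).2
  rw [← key]
  constructor
  · exact Tm_pow_mono M.nonneg mpos_nonneg (fun x u => by
      simpa [one1] using box_z_le _ u) n x y
  · have h1 : (∫ z in Set.Ioc (-1) 0, (Tm P (fun _ x' => f x') mpos ^ n)
        (fun _ u => box z 1 u) x y) ≤ Ck * (1 + y) / (n + 1) := by
      have hIntg := (Tm_pow_integral (P := P) (w := fun _ x' => f x') (mk := mpos)
        (volume.restrict (Set.Ioc (-1:ℝ) 0)) (fun z (_ : X) u => box z 1 u)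
        (fun _ u => box_z_int _ u) n x y).1
      have := setIntegral_mono (μ := volume) (s := Set.Ioc (-1:ℝ) 0) hIntg
        (integrable_const (Ck * (1 + y) / ((n:ℝ) + 1))) (fun z => by
          have := hk n x y z
          rwa [max_eq_left hy.le] at this)
      refine this.trans ?_
      rw [setIntegral_const]
      simp
    rw [← key] at h1
    have h2 := Tm_pow_mono_on (w := fun _ x' => f x') M.nonneg mpos_nonneg (Set.Ioi 0) mpos_Ioi
      (g := one1) (h := (fun (_ : X) u => ∫ z in Set.Ioc 0 T, box z 1 u) +
        (fun (_ : X) u => ∫ z in Set.Ioc (-1) 0, box z 1 u) +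
        (fun (_ : X) u => if T < u then 1 else 0)) (fun x u hu => by
          have hu' : 0 < u := hu
          simp only [one1, Pi.add_apply]
          have n1 : 0 ≤ ∫ z in Set.Ioc 0 T, box z 1 u := integral_nonneg fun z => box_nonneg z 1 u
          have n2 : 0 ≤ ∫ z in Set.Ioc (-1) 0, box z 1 u := integral_nonneg fun z => box_nonneg z 1 u
          split_ifs with h
          · linarith
          · have := box_z_ge hu' (not_lt.mp h)
            linarith) n x y hy
    rw [map_add, map_add] at h2
    simp only [Pi.add_apply] at h2
    linarith

set_option maxHeartbeats 1600000 in
lemma survive_asymp (hS : IsStochastic P ν) (h1 : Primitive P) (h2 : ∑ x, f x * ν x = 0)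
    (h3 : NonLattice P f) (M : Mart P (fun _ x' => f x') α β s2 B) :
    ∃ C, 0 < C ∧ ∀ R : ℝ, 2 ≤ R → ∀ x y, 0 < y → ∃ N : ℕ, ∀ n, N ≤ n →
      |√s2 * √(2 * π) / 2 * √(n:ℝ) * (Tm P (fun _ x' => f x') mpos ^ n) one1 x y - y| ≤
        3 * B + C * (1 + y) / R := by
  obtain ⟨Ck, hCk, hk⟩ := kbound hS h1 h3 M one_pos
  obtain ⟨Cm, hCm, hm⟩ := master hS h1 h2 h3 M (ψ := fun _ => 1) (fun _ => zero_le_one) one_pos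
  have hB := M.hB
  have hs2 := M.hs
  have hc := cExit_pos M
  set κ := √s2 * √(2 * π) / 2 with hκ
  have hκ0 : 0 < κ := by positivity
  set Ct := 2 * (1 + 2 * B + 4 * B ^ 2 + 8 * s2 * cExit s2 B) with hCt
  have hCt0 : 0 < Ct := by positivity
  refine ⟨κ * Cm + κ * Ck + κ * Ct + 8 * s2 * B + 4 * cExit s2 B, by positivity,
    fun R hR x y hy => ?_⟩
  have hR0 : 0 < R := by linarith
  set t := 1 / R ^ 2 with ht
  have ht0 : 0 < t := by positivity
  have ht4 : t ≤ 1 / 4 := by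
    rw [ht]; exact one_div_le_one_div_of_le (by norm_num) (by nlinarith)
  have htR : t * R = 1 / R := by rw [ht]; field_simp
  have htR2 : t ≤ 1 / R := by rw [← htR]; nlinarith
  obtain ⟨N1, hN1⟩ := hm t ht0 (by linarith)
  obtain ⟨N2, hN2⟩ := exists_inv_sqrt_lt (B + y) (ε := t ^ 3) (by positivity)
  obtain ⟨N3, hN3⟩ := exists_inv_sqrt_lt R (ε := 1) one_pos
  refine ⟨max 1 (max N1 (max N2 N3)), fun n hn => ?_⟩
  have hn1 : 1 ≤ n := (le_max_left _ _).trans hn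
  have hn' := (le_max_right _ _).trans hn
  have hnN1 : N1 ≤ n := (le_max_left _ _).trans hn'
  have hn'' := (le_max_right _ _).trans hn'
  have hnN2 : N2 ≤ n := (le_max_left _ _).trans hn''
  have hnN3 : N3 ≤ n := (le_max_right _ _).trans hn''
  have hnR : (1:ℝ) ≤ n := by exact_mod_cast hn1
  have hm' := fun z hz hyz => hN1 n hnN1 x y z hz hyz
  have hby := hN2 n hnN2
  have hRs := hN3 n hnN3
  set s := √(n:ℝ) with hs
  have hs0 : 0 < s := Real.sqrt_pos.mpr (by linarith)
  have hss : s * s = n := Real.mul_self_sqrt (by linarith)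
  rw [← div_eq_mul_inv, div_lt_iff₀ hs0] at hby hRs
  rw [one_mul] at hRs
  have ht3 : 0 < t ^ 3 := by positivity
  have ht32 : t ^ 3 ≤ t ^ 2 := pow_le_pow_of_le_one ht0.le (by linarith) (by norm_num)
  have ht31 : t ^ 3 ≤ t := pow_le_of_le_one ht0.le (by linarith) three_ne_zero
  have ht21 : t ^ 2 ≤ 1 := pow_le_one₀ ht0.le (by linarith)
  have hBs : B ≤ t ^ 3 * s := by linarith
  set L := t ^ 2 * s with hL
  have hyL : y < L := by
    have : t ^ 3 * s ≤ t ^ 2 * s := by gcongr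
    linarith
  have hys : y ≤ s := by
    have : t ^ 2 * s ≤ 1 * s := by gcongr
    linarith
  have hax := mst_aux1 ht0 (by linarith) hs0 hB hBs
  have hBL : B ≤ L := hax.1
  have hL1 : 1 ≤ L := hB.trans hBL
  have hL0 : 0 < L := by linarith
  have htn : 2 ≤ t * n := by rw [← hss]; exact hax.2
  set m := ⌊t * n⌋₊ with hmdef
  have hmlt : t * n < m + 1 := Nat.lt_floor_add_one _
  have hm2 : t * n / 2 ≤ m := by linarith
  have hm1 : 1 ≤ m := by
    have : (0:ℝ) < m := by linarith
    exact_mod_cast this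
  have hLm := mst_aux4 ht0 hss (by linarith) hL hm2
  set p := ptop P (fun _ x' => f x') L m x y with hp
  have hp1 := ptop_le M hL1 m x y
  have hp2 := ptop_lin M hBL m x y hy hyL
  have hp3 := strip_le M hL1 hm1 x y hyL
  rw [max_eq_left hy.le] at hp1 hp3
  rw [← hp] at hp1 hp2
  have hp0 : 0 ≤ L * p := mul_nonneg hL0.le (ptop_nonneg M L m x y)
  have hLp1 : L * p ≤ 4 * B * (1 + y) := by
    rw [le_div_iff₀ hL0] at hp1
    linarith
  have hLp2 : |L * p - y| ≤ 3 * B + 4 * cExit s2 B * (1 + y) / R := by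
    refine hp2.trans ?_
    have : 2 * L * (Tm P (fun _ x' => f x') (mstrip L) ^ m) one1 x y ≤
        4 * cExit s2 B * (1 + y) / R := by
      calc _ ≤ 2 * L * (cExit s2 B * (1 + y) * L / m) := by gcongr
        _ = 2 * cExit s2 B * (1 + y) * (L * L / m) := by ring
        _ ≤ 2 * cExit s2 B * (1 + y) * (2 * t) := by gcongr; linarith
        _ ≤ 2 * cExit s2 B * (1 + y) * (2 * (1 / R)) := by gcongr
        _ = _ := by ring
    linarith
  -- the integral
  have hgz : ∀ z, gz (fun _ : X => (1:ℝ)) z 1 = fun _ u => box z 1 u := by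
    intro z; funext x u; simp [gz]
  set I := ∫ z in Set.Ioc 0 (R * s), (Tm P (fun _ x' => f x') mpos ^ n)
    (fun _ u => box z 1 u) x y with hI
  have hsand := surv_sand M hk n x hy (R * s)
  rw [← hI] at hsand
  have htail := tail_le M hn1 x hy hys hR0
  rw [← hs, ← hCt] at htail
  obtain ⟨hpi, hpe⟩ := prof_int hs2 hs0 hR0.le
  have hIint := (Tm_pow_integral (P := P) (w := fun _ x' => f x') (mk := mpos)
    (volume.restrict (Set.Ioc 0 (R * s))) (fun z (_ : X) u => box z 1 u)
    (fun _ u => box_z_int _ u) n x y).1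
  have hdiff : |n * I - L * p * (2 * s * (gam s2 0 - gam s2 R))| ≤
      Cm * (1 + y) * t * (R * s) := by
    rw [hI, ← hpe, ← integral_const_mul, ← integral_const_mul,
      ← integral_sub (hIint.const_mul _) (hpi.const_mul _), ← Real.norm_eq_abs]
    refine (norm_setIntegral_le_of_norm_le_const (C := Cm * (1 + y) * t) (by simp) ?_).trans ?_
    · intro z hz
      have := hm' z hz.1.le hyL
      rw [hgz, max_eq_left hy.le] at this
      simp only [one_mul, hS.nuSum] at this
      rw [Real.norm_eq_abs]
      rw [mul_comm (L * p)]
      exact this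
    · apply le_of_eq
      rw [Real.volume_real_Ioc_of_le (by positivity), sub_zero]
  have hdiff2 : |s * I - L * p * (2 * (gam s2 0 - gam s2 R))| ≤ Cm * (1 + y) / R := by
    have e : n * I - L * p * (2 * s * (gam s2 0 - gam s2 R)) =
        s * (s * I - L * p * (2 * (gam s2 0 - gam s2 R))) := by rw [← hss]; ring
    rw [e, abs_mul, abs_of_pos hs0] at hdiff
    have e2 : Cm * (1 + y) * t * (R * s) = s * (Cm * (1 + y) / R) := by
      rw [show Cm * (1 + y) * t * (R * s) = Cm * (1 + y) * (t * R) * s by ring, htR]; ring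
    rw [e2] at hdiff
    exact le_of_mul_le_mul_left hdiff hs0
  set E := exp (-(R ^ 2 / (2 * s2))) with hE
  have hE0 : 0 < E := exp_pos _
  have hE1 : E ≤ 2 * s2 / R := by
    refine (exp_neg_le_inv (by positivity)).trans ?_
    rw [one_div_div]
    gcongr
    nlinarith
  have k0 : κ * (2 * gam s2 0) = 1 := by rw [hκ, kap_gam hs2]; simp
  have kR : κ * (2 * gam s2 R) = E := by rw [hκ, kap_gam hs2]
  have hfin1 : |κ * s * I - L * p * (1 - E)| ≤ κ * (Cm * (1 + y) / R) := by
    have : κ * s * I - L * p * (1 - E) = κ * (s * I - L * p * (2 * (gam s2 0 - gam s2 R))) := by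
      rw [← k0, ← kR]; ring
    rw [this, abs_mul, abs_of_pos hκ0]
    gcongr
  set S := (Tm P (fun _ x' => f x') mpos ^ n) one1 x y with hSd
  have hup : s * S - s * I ≤ Ck * (1 + y) / R + Ct * (1 + y) / R := by
    have e1 := mul_le_mul_of_nonneg_left hsand.2 hs0.le
    have e2 : s * (Ck * (1 + y) / (n + 1)) ≤ Ck * (1 + y) / R := by
      rw [mul_div_assoc', div_le_div_iff₀ (by positivity) hR0]
      calc s * (Ck * (1 + y)) * R ≤ s * (Ck * (1 + y)) * s := by gcongr
        _ = Ck * (1 + y) * n := by rw [← hss]; ring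
        _ ≤ _ := by gcongr; linarith
    have e3 : Ct * (1 + y) / R ^ 2 ≤ Ct * (1 + y) / R := by
      gcongr
      nlinarith
    linarith
  have hlo : 0 ≤ s * S - s * I := by
    have := mul_le_mul_of_nonneg_left hsand.1 hs0.le
    linarith
  have hup' := mul_le_mul_of_nonneg_left hup hκ0.le
  have hlo' := mul_nonneg hκ0.le hlo
  have hEp : L * p * E ≤ 8 * s2 * B * (1 + y) / R := by
    calc _ ≤ 4 * B * (1 + y) * (2 * s2 / R) := by gcongr
      _ = _ := by ring
  have hEp0 : 0 ≤ L * p * E := mul_nonneg hp0 hE0.le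
  have hexp : 3 * B + (κ * Cm + κ * Ck + κ * Ct + 8 * s2 * B + 4 * cExit s2 B) * (1 + y) / R =
      3 * B + 4 * cExit s2 B * (1 + y) / R + κ * (Cm * (1 + y) / R) +
      κ * (Ck * (1 + y) / R + Ct * (1 + y) / R) + 8 * s2 * B * (1 + y) / R := by ring
  rw [hexp]
  have hn0 : 0 ≤ κ * (Ck * (1 + y) / R + Ct * (1 + y) / R) := by positivity
  rw [abs_le] at hfin1 hLp2 ⊢
  constructor <;> linarith [hfin1.1, hfin1.2, hLp2.1, hLp2.2]

lemma V_near (hS : IsStochastic P ν) (h1 : Primitive P) (h2 : ∑ x, f x * ν x = 0)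
    (h3 : NonLattice P f) (M : Mart P (fun _ x' => f x') α β s2 B) {V : X → ℝ → ℝ}
    (hV : ∀ x y, Tendsto (fun n : ℕ => √s2 * √(2 * π) / 2 * √(n:ℝ) *
      (Tm P (fun _ x' => f x') mpos ^ n) one1 x y) atTop (𝓝 (V x y))) (x : X) {y : ℝ} (hy : 0 < y) :
    |V x y - y| ≤ 4 * B := by
  obtain ⟨C, hC, h⟩ := survive_asymp hS h1 h2 h3 M
  obtain ⟨N, hN⟩ := h (2 + C * (1 + y)) (by
    have : 0 ≤ C * (1 + y) := by positivity
    linarith) x y hy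
  have ht := ((hV x y).sub_const y).abs
  refine le_of_tendsto ht ?_
  filter_upwards [eventually_ge_atTop N] with n hn
  refine (hN n hn).trans ?_
  have : C * (1 + y) / (2 + C * (1 + y)) ≤ 1 := by
    rw [div_le_one (by positivity)]
    linarith
  linarith [M.hB]

set_option maxHeartbeats 800000 in
lemma V_ptop (hS : IsStochastic P ν) (h1 : Primitive P) (h2 : ∑ x, f x * ν x = 0)
    (h3 : NonLattice P f) (M : Mart P (fun _ x' => f x') α β s2 B) {V : X → ℝ → ℝ}
    (hV : ∀ x y, Tendsto (fun n : ℕ => √s2 * √(2 * π) / 2 * √(n:ℝ) *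
      (Tm P (fun _ x' => f x') mpos ^ n) one1 x y) atTop (𝓝 (V x y))) :
    ∃ C, 0 < C ∧ ∀ t : ℝ, 0 < t → t < 1 / 2 → ∃ N : ℕ, ∀ n, N ≤ n → ∀ x y,
      y < t ^ 2 * √(n:ℝ) →
      |V x y - t ^ 2 * √(n:ℝ) * ptop P (fun _ x' => f x') (t ^ 2 * √(n:ℝ)) ⌊t * n⌋₊ x y| ≤
        C * (1 + max y 0) * t := by
  have hB := M.hB
  have hs2 := M.hs
  have hc := cExit_pos M
  set κ := √s2 * √(2 * π) / 2 with hκ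
  have hκ0 : 0 < κ := by positivity
  have hVn := V_nonneg M hκ0.le hV
  have hVl := V_le M hκ0.le hV
  have hVh := V_harm hV
  have hVp : ∀ n : ℕ, (Tm P (fun _ x' => f x') mpos ^ n) V = V := by
    intro n
    induction n with
    | zero => rfl
    | succ n ih => rw [pow_succ, Module.End.mul_apply, hVh, ih]
  set Cv := 4 * κ * cExit s2 B with hCv
  have hCv0 : 0 < Cv := by positivity
  refine ⟨2 * Cv * cExit s2 B + 20 * B, by positivity, fun t ht0 ht1 => ?_⟩
  obtain ⟨N, hN⟩ := exists_inv_sqrt_lt B (ε := t ^ 3) (by positivity)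
  refine ⟨max 1 N, fun n hn x y hy => ?_⟩
  have hn1 : 1 ≤ n := (le_max_left _ _).trans hn
  have hnR : (1:ℝ) ≤ n := by exact_mod_cast hn1
  have hBs := hN n ((le_max_right _ _).trans hn)
  set s := √(n:ℝ) with hs
  have hs0 : 0 < s := Real.sqrt_pos.mpr (by linarith)
  have hss : s * s = n := Real.mul_self_sqrt (by linarith)
  rw [← div_eq_mul_inv, div_lt_iff₀ hs0] at hBs
  set L := t ^ 2 * s with hL
  have hax := mst_aux1 ht0 ht1 hs0 hB hBs.le
  have hBL : B ≤ L := hax.1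
  have hL1 : 1 ≤ L := hB.trans hBL
  have hL0 : 0 < L := by linarith
  have htn : 2 ≤ t * n := by rw [← hss]; exact hax.2
  set m := ⌊t * n⌋₊ with hmdef
  have hmlt : t * n < m + 1 := Nat.lt_floor_add_one _
  have hm2 : t * n / 2 ≤ m := by linarith
  have hm1 : 1 ≤ m := by
    have : (0:ℝ) < m := by linarith
    exact_mod_cast this
  have hLm := mst_aux4 ht0 hss (by linarith) hL hm2
  have hmx : 0 ≤ max y 0 := le_max_right _ _
  have ht31 : t ^ 3 ≤ t := pow_le_of_le_one ht0.le (by linarith) three_ne_zero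
  have hd := strip_decomp M (L := L) m 0 V 1 L (5 * B) (Cv * L)
    (fun x u hu => by
      rw [hVp, one_mul, abs_of_nonneg (hVn x u)]
      refine (hVl x u).trans ?_
      have : 1 + max u 0 ≤ 2 * L := by
        have : max u 0 ≤ L := max_le hu.le hL0.le
        linarith
      calc _ ≤ 2 * κ * cExit s2 B * (2 * L) := by gcongr
        _ = _ := by rw [hCv]; ring)
    (fun k _ x u hu1 hu2 => by
      rw [hVp, one_mul]
      have hu0 : 0 < u := by linarith
      have := V_near hS h1 h2 h3 M hV x hu0
      rw [abs_le] at this ⊢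
      constructor <;> linarith [this.1, this.2]) x y hy
  rw [hVp, one_mul] at hd
  refine hd.trans ?_
  have e1 := strip_le M hL1 hm1 x y hy
  have e2 := ptop_le M hL1 m x y
  have f1 : Cv * L * (Tm P (fun _ x' => f x') (mstrip L) ^ m) one1 x y ≤
      2 * Cv * cExit s2 B * (1 + max y 0) * t := by
    calc _ ≤ Cv * L * (cExit s2 B * (1 + max y 0) * L / m) := by gcongr
      _ = Cv * cExit s2 B * (1 + max y 0) * (L * L / m) := by ring
      _ ≤ Cv * cExit s2 B * (1 + max y 0) * (2 * t) := by
          gcongr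
          linarith
      _ = _ := by ring
  have f2 : 5 * B * ptop P (fun _ x' => f x') L m x y ≤ 20 * B * (1 + max y 0) * t := by
    have e3 : B / L ≤ t := by
      rw [div_le_iff₀ hL0, hL]
      calc B ≤ t ^ 3 * s := hBs.le
        _ = _ := by ring
    calc _ ≤ 5 * B * (4 * B * (1 + max y 0) / L) := by gcongr
      _ = 20 * B * (1 + max y 0) * (B / L) := by ring
      _ ≤ _ := by gcongr
  linarith

end

section

lemma Spath_range (f : X → ℝ) (ω : ℕ → X) (k : ℕ) :
    Spath f ω k = ∑ i ∈ range k, f (ω (i + 1)) := by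
  unfold Spath
  induction k with
  | zero => simp
  | succ k ih => rw [Finset.sum_Icc_succ_top (by omega), ih, Finset.sum_range_succ]

lemma pathExt_cons (x x' : X) {n : ℕ} (p : Fin n → X) {k : ℕ} (hk : k ≤ n) :
    pathExt x (Fin.cons x' p : Fin (n + 1) → X) (k + 1) = pathExt x' p k := by
  unfold pathExt
  rw [dif_pos ⟨by omega, by omega⟩]
  rcases k with _ | k
  · rw [dif_neg (by omega)]
    rfl
  · rw [dif_pos ⟨by omega, hk⟩]
    rfl

lemma Spath_cons (f : X → ℝ) (x x' : X) {n : ℕ} (p : Fin n → X) {k : ℕ} (hk : k ≤ n) :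
    Spath f (pathExt x (Fin.cons x' p : Fin (n + 1) → X)) (k + 1) =
      f x' + Spath f (pathExt x' p) k := by
  rw [Spath_range, Spath_range, Finset.sum_range_succ', add_comm]
  congr 1
  refine Finset.sum_congr rfl fun i hi => ?_
  rw [Finset.mem_range] at hi
  rw [pathExt_cons x x' p (by omega)]

lemma survives_cons (f : X → ℝ) (y : ℝ) (x x' : X) {n : ℕ} (p : Fin n → X) :
    survives f y (n + 1) (pathExt x (Fin.cons x' p : Fin (n + 1) → X)) ↔
      0 < y + f x' ∧ survives f (y + f x') n (pathExt x' p) := by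
  unfold survives
  constructor
  · intro h
    constructor
    · have := h 1 (by simp)
      rw [Spath_cons f x x' p (Nat.zero_le n)] at this
      simpa [Spath_range] using this
    · intro k hk
      rw [Finset.mem_Icc] at hk
      have := h (k + 1) (by rw [Finset.mem_Icc]; omega)
      rw [Spath_cons f x x' p hk.2] at this
      linarith
  · rintro ⟨h0, h⟩ k hk
    rw [Finset.mem_Icc] at hk
    obtain ⟨j, rfl⟩ : ∃ j, k = j + 1 := ⟨k - 1, by omega⟩
    rw [Spath_cons f x x' p (by omega)]
    rcases Nat.eq_zero_or_pos j with rfl | hj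
    · simpa [Spath_range] using h0
    · have := h j (by rw [Finset.mem_Icc]; omega)
      linarith

lemma ind_and (p q : Prop) : ind (p ∧ q) = ind p * ind q := by
  unfold ind
  by_cases hp : p <;> by_cases hq : q <;> simp [hp, hq]

variable [Fintype X]

lemma Ex_eq (P : X → X → ℝ) (f : X → ℝ) (h : X → ℝ → ℝ) (n : ℕ) (x : X) (y : ℝ) :
    Ex P x n (fun ω => h (ω n) (y + Spath f ω n) * ind (survives f y n ω)) =
      (Tm P (fun _ x' => f x') mpos ^ n) h x y := by
  induction n generalizing x y with
  | zero => simp [Ex, wt, pathExt, Spath, survives, ind]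
  | succ n ih =>
    rw [pow_succ', Module.End.mul_apply, Tm_apply]
    unfold Ex
    rw [← (Fin.consEquiv (fun _ : Fin (n + 1) => X)).sum_comp, Fintype.sum_prod_type]
    refine Finset.sum_congr rfl fun x' _ => ?_
    rw [← ih]
    unfold Ex
    rw [Finset.mul_sum, Finset.mul_sum]
    refine Finset.sum_congr rfl fun p _ => ?_
    have e : (Fin.consEquiv (fun _ : Fin (n + 1) => X)) (x', p) = (Fin.cons x' p : Fin (n + 1) → X) := rfl
    rw [e, List.ofFn_succ]
    simp only [Fin.cons_zero, Fin.cons_succ, wt]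
    rw [pathExt_cons x x' p le_rfl, Spath_cons f x x' p le_rfl]
    have e2 : ind (survives f y (n + 1) (pathExt x (Fin.cons x' p : Fin (n + 1) → X))) =
        mpos (y + f x') * ind (survives f (y + f x') n (pathExt x' p)) := by
      rw [show survives f y (n + 1) (pathExt x (Fin.cons x' p : Fin (n + 1) → X)) =
        (0 < y + f x' ∧ survives f (y + f x') n (pathExt x' p)) from
        propext (survives_cons f y x x' p), ind_and]
      rfl
    rw [e2, ← add_assoc]
    ring

end

section

lemma ray_prof {s2 : ℝ} (hs2 : 0 < s2) {n z : ℝ} (hn : 0 < n) (hz : 0 ≤ z) (A V : ℝ) :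
    n * (2 * A * V / (√(2 * π) * s2 * n) * rayleigh (z / (√n * √s2))) =
      A * prof s2 (z / √n) * V := by
  have h1 : √(2 * π * s2) = √(2 * π) * √s2 := Real.sqrt_mul (by positivity) _
  have h2 : 0 < √s2 := Real.sqrt_pos.mpr hs2
  have h3 : 0 < √(2 * π) := by positivity
  have h4 : 0 < √n := Real.sqrt_pos.mpr hn
  have h5 : 0 ≤ z / (√n * √s2) := by positivity
  have h6 : √s2 ^ 2 = s2 := Real.sq_sqrt hs2.le
  unfold rayleigh prof gam
  rw [if_pos h5, h1]
  have e : -(z / (√n * √s2)) ^ 2 / 2 = -((z / √n) ^ 2 / (2 * s2)) := by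
    rw [div_pow, mul_pow, h6, div_pow]
    field_simp
  rw [e]
  field_simp

variable [Fintype X] [DecidableEq X] [Nonempty X] {P : X → X → ℝ} {ν f : X → ℝ} {α β : X → ℝ} {s2 B : ℝ}

lemma core (hS : IsStochastic P ν) (h1 : Primitive P) (h2 : ∑ x, f x * ν x = 0)
    (h3 : NonLattice P f) (M : Mart P (fun _ x' => f x') α β s2 B) {V : X → ℝ → ℝ}
    (hV : ∀ x y, Tendsto (fun n : ℕ => √s2 * √(2 * π) / 2 * √(n:ℝ) *
      (Tm P (fun _ x' => f x') mpos ^ n) one1 x y) atTop (𝓝 (V x y)))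
    {ψ : X → ℝ} (hψ : ∀ b, 0 ≤ ψ b) {a : ℝ} (ha : 0 < a) :
    ∃ C, 0 < C ∧ ∀ t : ℝ, 0 < t → t < 1 / 2 → ∃ N : ℕ, ∀ n, N ≤ n → ∀ x y z, 0 ≤ z →
      y < t ^ 2 * √(n:ℝ) →
      |n * (Tm P (fun _ x' => f x') mpos ^ n) (gz ψ z a) x y -
        (a * ∑ b, ψ b * ν b) * prof s2 (z / √(n:ℝ)) * V x y| ≤ C * (1 + max y 0) * t := by
  obtain ⟨C1, hC1, H1⟩ := master hS h1 h2 h3 M hψ ha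
  obtain ⟨C2, hC2, H2⟩ := V_ptop hS h1 h2 h3 M hV
  obtain ⟨Cp, hCp, hp⟩ := prof_bound M.hs
  set A := a * ∑ b, ψ b * ν b with hA
  have hA0 : 0 ≤ A := mul_nonneg ha.le (Finset.sum_nonneg fun b _ => mul_nonneg (hψ b) (hS.nuPos b).le)
  refine ⟨C1 + A * Cp * C2, by positivity, fun t ht0 ht1 => ?_⟩
  obtain ⟨N1, hN1⟩ := H1 t ht0 ht1
  obtain ⟨N2, hN2⟩ := H2 t ht0 ht1
  refine ⟨max N1 N2, fun n hn x y z hz hy => ?_⟩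
  have e1 := hN1 n ((le_max_left _ _).trans hn) x y z hz hy
  have e2 := hN2 n ((le_max_right _ _).trans hn) x y hy
  set G := (n:ℝ) * (Tm P (fun _ x' => f x') mpos ^ n) (gz ψ z a) x y
  set p := t ^ 2 * √(n:ℝ) * ptop P (fun _ x' => f x') (t ^ 2 * √(n:ℝ)) ⌊t * n⌋₊ x y
  set q := prof s2 (z / √(n:ℝ))
  have hq : |q| ≤ Cp := hp _
  have e3 : |A * q * p - A * q * V x y| ≤ A * Cp * (C2 * (1 + max y 0) * t) := by
    rw [← mul_sub, abs_mul, abs_mul, abs_of_nonneg hA0, abs_sub_comm]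
    gcongr
  calc _ = |(G - A * q * p) + (A * q * p - A * q * V x y)| := by congr 1; ring
    _ ≤ C1 * (1 + max y 0) * t + A * Cp * (C2 * (1 + max y 0) * t) :=
        (abs_add_le _ _).trans (add_le_add e1 e3)
    _ = _ := by ring

lemma le_supN {ψ : X → ℝ} (hψ : ∀ b, 0 ≤ ψ b) (b : X) : ψ b ≤ supN ψ := by
  unfold supN
  rw [← abs_of_nonneg (hψ b)]
  exact le_ciSup (f := fun x => |ψ x|) (Set.finite_range _).bddAbove b

lemma core_unif (hS : IsStochastic P ν) (h1 : Primitive P) (h2 : ∑ x, f x * ν x = 0)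
    (h3 : NonLattice P f) (M : Mart P (fun _ x' => f x') α β s2 B) {V : X → ℝ → ℝ}
    (hV : ∀ x y, Tendsto (fun n : ℕ => √s2 * √(2 * π) / 2 * √(n:ℝ) *
      (Tm P (fun _ x' => f x') mpos ^ n) one1 x y) atTop (𝓝 (V x y)))
    {a : ℝ} (ha : 0 < a) :
    ∃ C, 0 < C ∧ ∀ t : ℝ, 0 < t → t < 1 / 2 → ∃ N : ℕ, ∀ n, N ≤ n → ∀ ψ : X → ℝ, (∀ b, 0 ≤ ψ b) →
      ∀ x y z, 0 ≤ z → y < t ^ 2 * √(n:ℝ) →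
      |n * (Tm P (fun _ x' => f x') mpos ^ n) (gz ψ z a) x y -
        (a * ∑ b, ψ b * ν b) * prof s2 (z / √(n:ℝ)) * V x y| ≤
          C * (1 + max y 0) * supN ψ * t := by
  have hc := fun b : X => core hS h1 h2 h3 M hV (ψ := fun x => if x = b then 1 else 0)
    (fun x => by split_ifs <;> norm_num) ha
  choose C hC hH using hc
  refine ⟨∑ b, C b, Finset.sum_pos (fun b _ => hC b) Finset.univ_nonempty, fun t ht0 ht1 => ?_⟩
  choose N hN using fun b => hH b t ht0 ht1
  refine ⟨∑ b, N b, fun n hn ψ hψ x y z hz hy => ?_⟩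
  have hmx : 0 ≤ max y 0 := le_max_right _ _
  have hb := fun b => hN b n ((Finset.single_le_sum (f := N) (fun _ _ => Nat.zero_le _)
    (Finset.mem_univ b)).trans hn) x y z hz hy
  have e1 : gz ψ z a = ∑ b, ψ b • gz (fun x => if x = b then 1 else 0) z a := by
    funext x u
    simp [gz, Finset.sum_apply]
  have e2 : n * (Tm P (fun _ x' => f x') mpos ^ n) (gz ψ z a) x y -
        (a * ∑ b, ψ b * ν b) * prof s2 (z / √(n:ℝ)) * V x y =
      ∑ b, ψ b * (n * (Tm P (fun _ x' => f x') mpos ^ n) (gz (fun x => if x = b then 1 else 0) z a) x y -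
        (a * ∑ b', (if b' = b then 1 else 0) * ν b') * prof s2 (z / √(n:ℝ)) * V x y) := by
    rw [e1, map_sum]
    simp only [map_smul, Finset.sum_apply, Pi.smul_apply, smul_eq_mul, ite_mul, one_mul, zero_mul,
      Finset.sum_ite_eq', Finset.mem_univ, if_true]
    rw [Finset.mul_sum, Finset.mul_sum, Finset.sum_mul, Finset.sum_mul, ← Finset.sum_sub_distrib]
    refine Finset.sum_congr rfl fun b _ => by ring
  rw [e2]
  refine (Finset.abs_sum_le_sum_abs _ _).trans ?_
  rw [Finset.sum_mul, Finset.sum_mul, Finset.sum_mul]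
  refine Finset.sum_le_sum fun b _ => ?_
  rw [abs_mul, abs_of_nonneg (hψ b)]
  have h0 : 0 ≤ C b * (1 + max y 0) * t := by have := hC b; positivity
  calc _ ≤ ψ b * (C b * (1 + max y 0) * t) := mul_le_mul_of_nonneg_left (hb b) (hψ b)
    _ ≤ supN ψ * (C b * (1 + max y 0) * t) := mul_le_mul_of_nonneg_right (le_supN hψ b) h0
    _ = _ := by ring

lemma crude (hS : IsStochastic P ν) (h1 : Primitive P)
    (h3 : NonLattice P f) (M : Mart P (fun _ x' => f x') α β s2 B) {V : X → ℝ → ℝ}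
    (hV : ∀ x y, Tendsto (fun n : ℕ => √s2 * √(2 * π) / 2 * √(n:ℝ) *
      (Tm P (fun _ x' => f x') mpos ^ n) one1 x y) atTop (𝓝 (V x y)))
    {a : ℝ} (ha : 0 < a) :
    ∃ C, 0 < C ∧ ∀ n : ℕ, ∀ ψ : X → ℝ, (∀ b, 0 ≤ ψ b) → ∀ x y z,
      |n * (Tm P (fun _ x' => f x') mpos ^ n) (gz ψ z a) x y -
        (a * ∑ b, ψ b * ν b) * prof s2 (z / √(n:ℝ)) * V x y| ≤
          C * (1 + max y 0) * supN ψ := by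
  obtain ⟨Ck, hCk, hk⟩ := kbound hS h1 h3 M ha
  obtain ⟨Cp, hCp, hp⟩ := prof_bound M.hs
  have hs2 := M.hs
  have hc := cExit_pos M
  set κ := √s2 * √(2 * π) / 2 with hκ
  have hκ0 : 0 < κ := by positivity
  have hVn := V_nonneg M hκ0.le hV
  have hVl := V_le M hκ0.le hV
  refine ⟨Fintype.card X * Ck + a * Cp * (2 * κ * cExit s2 B), by positivity,
    fun n ψ hψ x y z => ?_⟩
  have hmx : 0 ≤ max y 0 := le_max_right _ _
  obtain ⟨b0⟩ := (inferInstance : Nonempty X)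
  have hs0 : 0 ≤ supN ψ := (hψ b0).trans (le_supN hψ b0)
  have hΨ : ∑ b, ψ b ≤ Fintype.card X * supN ψ := by
    refine (Finset.sum_le_sum fun b _ => le_supN hψ b).trans ?_
    simp
  have hΨ0 : 0 ≤ ∑ b, ψ b := Finset.sum_nonneg fun b _ => hψ b
  have hA : ∑ b, ψ b * ν b ≤ supN ψ := by
    calc _ ≤ ∑ b, supN ψ * ν b := Finset.sum_le_sum fun b _ =>
          mul_le_mul_of_nonneg_right (le_supN hψ b) (hS.nuPos b).le
      _ = _ := by rw [← Finset.mul_sum, hS.nuSum, mul_one]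
  have hA0 : 0 ≤ ∑ b, ψ b * ν b := Finset.sum_nonneg fun b _ => mul_nonneg (hψ b) (hS.nuPos b).le
  have g0 : 0 ≤ (Tm P (fun _ x' => f x') mpos ^ n) (gz ψ z a) x y :=
    Tm_pow_nonneg hS.nonneg mpos_nonneg (gz_nonneg hψ z a) n x y
  have g1 : (Tm P (fun _ x' => f x') mpos ^ n) (gz ψ z a) x y ≤
      (∑ b, ψ b) * (Ck * (1 + max y 0) / (n + 1)) := by
    refine (Tm_pow_smul_le (w := fun _ x' => f x') hS.nonneg mpos_nonneg Set.univ
      (fun _ _ => trivial) (∑ b, ψ b) (h := fun _ u => box z a u)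
      (fun x u _ => gz_le hψ z a x u) n x y trivial).trans ?_
    exact mul_le_mul_of_nonneg_left (hk n x y z) hΨ0
  have g2 : |n * (Tm P (fun _ x' => f x') mpos ^ n) (gz ψ z a) x y| ≤
      Fintype.card X * Ck * (1 + max y 0) * supN ψ := by
    rw [abs_of_nonneg (by positivity)]
    have : (n:ℝ) / (n + 1) ≤ 1 := by
      rw [div_le_one (by positivity)]; linarith
    calc _ ≤ n * ((∑ b, ψ b) * (Ck * (1 + max y 0) / (n + 1))) := by gcongr
      _ = (∑ b, ψ b) * (Ck * (1 + max y 0)) * (n / (n + 1)) := by ring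
      _ ≤ (Fintype.card X * supN ψ) * (Ck * (1 + max y 0)) * 1 := by gcongr
      _ = _ := by ring
  have g3 : |(a * ∑ b, ψ b * ν b) * prof s2 (z / √(n:ℝ)) * V x y| ≤
      a * Cp * (2 * κ * cExit s2 B) * (1 + max y 0) * supN ψ := by
    rw [abs_mul, abs_mul, abs_of_nonneg (mul_nonneg ha.le hA0), abs_of_nonneg (hVn x y)]
    calc _ ≤ (a * supN ψ) * Cp * (2 * κ * cExit s2 B * (1 + max y 0)) := by
          have := hp (z / √(n:ℝ))
          have := hVl x y
          have := hVn x y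
          gcongr
      _ = _ := by ring
  refine (abs_sub _ _).trans ?_
  linarith

end

/-- Theorem 2.4, Gnedenko–Stone type conditioned local limit theorem. -/
theorem conditioned_gnedenko_stone_llt [Fintype X] [DecidableEq X] [Nonempty X]
    (P : X → X → ℝ) (ν f : X → ℝ) (hS : IsStochastic P ν)
    (h1 : Primitive P) (h2 : ∑ x, f x * ν x = 0) (h3 : NonLattice P f)
    (V : X → ℝ → ℝ)
    (hV : ∀ (x : X) (y : ℝ),
      Tendsto (fun n : ℕ =>
          Real.sqrt (sigma2 P ν f) * Real.sqrt (2 * π * n) / 2 *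
            Ex P x n (fun ω => ind (survives f y n ω)))
        atTop (nhds (V x y))) :
    ∀ a : ℝ, 0 < a → ∃ c > 0, ∃ ε₀ ∈ Set.Ioo (0 : ℝ) (1 / 4),
      ∀ ε ∈ Set.Ioo (0 : ℝ) ε₀, ∃ cε > 0,
        ∀ ψ : X → ℝ, (∀ b, 0 ≤ ψ b) → ∀ y : ℝ, ∀ n : ℕ, 3 / ε ^ 3 ≤ (n : ℝ) →
          ∀ x : X, ∀ z : ℝ, 0 ≤ z →
            (n : ℝ) *
              |Ex P x n (fun ω =>
                  ψ (ω n) * ind (y + Spath f ω n ∈ Set.Icc z (z + a) ∧ survives f y n ω)) -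
                2 * a * (∑ b, ψ b * ν b) * V x y /
                    (Real.sqrt (2 * π) * sigma2 P ν f * n) *
                  rayleigh (z / (Real.sqrt n * Real.sqrt (sigma2 P ν f)))| ≤
            c * (1 + max y 0) * supN ψ *
              (Real.sqrt ε + cε * (1 + max y 0) / (n : ℝ) ^ ε) := by
  intro a ha
  obtain ⟨α, β, B, M⟩ := fwd_mart hS h1 h2 h3
  have hV' : ∀ x y, Tendsto (fun n : ℕ => √(sigma2 P ν f) * √(2 * π) / 2 * √(n:ℝ) *
      (Tm P (fun _ x' => f x') mpos ^ n) one1 x y) atTop (𝓝 (V x y)) := by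
    intro x y
    refine (hV x y).congr fun n => ?_
    have := Ex_eq P f one1 n x y
    simp only [one1, one_mul] at this
    rw [this, Real.sqrt_mul (by positivity)]
    unfold one1
    ring
  have hs2 := M.hs
  obtain ⟨C1, hC1, H1⟩ := core_unif hS h1 h2 h3 M hV' ha
  obtain ⟨C2, hC2, H2⟩ := crude hS h1 h3 M hV' ha
  refine ⟨C1 + C2, by positivity, 1 / 8, by norm_num, fun ε hε => ?_⟩
  obtain ⟨hε0, hε1⟩ := hε
  have hq0 : 0 < √ε := Real.sqrt_pos.mpr hε0
  have hq2 : √ε ^ 2 = ε := Real.sq_sqrt hε0.le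
  obtain ⟨N, hN⟩ := H1 (√ε) hq0 (by
    rw [Real.sqrt_lt' (by norm_num)]
    norm_num
    linarith)
  rw [hq2] at hN
  refine ⟨1 / ε + N, by positivity, fun ψ hψ y n hn x z hz => ?_⟩
  have hmx : 0 ≤ max y 0 := le_max_right _ _
  obtain ⟨b0⟩ := (inferInstance : Nonempty X)
  have hs0 : 0 ≤ supN ψ := (hψ b0).trans (le_supN hψ b0)
  have hn1 : (1:ℝ) ≤ n := by
    refine le_trans ?_ hn
    rw [le_div_iff₀ (by positivity)]
    have : ε ^ 3 ≤ 1 := pow_le_one₀ hε0.le (by linarith)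
    linarith
  have hn0 : (0:ℝ) < n := by linarith
  have hex : Ex P x n (fun ω =>
      ψ (ω n) * ind (y + Spath f ω n ∈ Set.Icc z (z + a) ∧ survives f y n ω)) =
      (Tm P (fun _ x' => f x') mpos ^ n) (gz ψ z a) x y := by
    rw [← Ex_eq]
    congr 1
    funext ω
    rw [ind_and, ← mul_assoc]
    congr 1
    by_cases h : z ≤ y + Spath f ω n ∧ y + Spath f ω n ≤ z + a <;>
      simp [gz, box, ind, Set.mem_Icc, h]
  have hlhs : (n : ℝ) *
      |Ex P x n (fun ω =>
          ψ (ω n) * ind (y + Spath f ω n ∈ Set.Icc z (z + a) ∧ survives f y n ω)) -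
        2 * a * (∑ b, ψ b * ν b) * V x y / (Real.sqrt (2 * π) * sigma2 P ν f * n) *
          rayleigh (z / (Real.sqrt n * Real.sqrt (sigma2 P ν f)))| =
      |n * (Tm P (fun _ x' => f x') mpos ^ n) (gz ψ z a) x y -
        (a * ∑ b, ψ b * ν b) * prof (sigma2 P ν f) (z / √(n:ℝ)) * V x y| := by
    rw [hex, ← ray_prof hs2 hn0 hz, ← abs_of_pos hn0, ← abs_mul, abs_of_pos hn0, mul_sub]
    ring_nf
  rw [hlhs]
  have hpw0 : 0 < (n:ℝ) ^ ε := Real.rpow_pos_of_pos hn0 ε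
  have hT0 : 0 ≤ (1 / ε + N) * (1 + max y 0) / (n:ℝ) ^ ε := by positivity
  by_cases hcase : N ≤ n ∧ y < ε * √(n:ℝ)
  · refine (hN n hcase.1 ψ hψ x y z hz hcase.2).trans ?_
    gcongr
    · linarith
    · linarith
  · have hpw : (n:ℝ) ^ ε ≤ √(n:ℝ) := by
      rw [Real.sqrt_eq_rpow]
      exact Real.rpow_le_rpow_of_exponent_le hn1 (by linarith)
    have hsq : √(n:ℝ) ≤ n := by
      rw [Real.sqrt_le_left hn0.le]
      nlinarith
    have hbig : 1 ≤ (1 / ε + N) * (1 + max y 0) / (n:ℝ) ^ ε := by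
      rw [one_le_div hpw0]
      have hNn : (0:ℝ) ≤ N := Nat.cast_nonneg N
      have hie : 0 < 1 / ε := by positivity
      rw [not_and_or, not_le, not_lt] at hcase
      rcases hcase with h | h
      · have h' : (n:ℝ) ≤ N := by exact_mod_cast h.le
        nlinarith [mul_nonneg hie.le hmx, mul_nonneg hNn hmx]
      · have h' : √(n:ℝ) ≤ 1 / ε * max y 0 := by
          rw [div_mul_eq_mul_div, one_mul, le_div_iff₀ hε0]
          have := le_max_left y 0
          linarith
        nlinarith [mul_nonneg hNn hmx]
    refine (H2 n ψ hψ x y z).trans ?_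
    have hb : 0 ≤ (1 + max y 0) * supN ψ := by positivity
    calc C2 * (1 + max y 0) * supN ψ = C2 * (1 + max y 0) * supN ψ * 1 := by ring
      _ ≤ (C1 + C2) * (1 + max y 0) * supN ψ * 1 := by gcongr; linarith
      _ ≤ _ := by gcongr; linarith

end CLLT
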